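/- arXiv:1609.01083 — 4 statements merged into one kernel-verified Lean document; each statement's English description precedes it below -/
import Mathlib

section
/- Let d ≥ 1, let s > 0 be real, and let p, p₁, p₂ ∈ (1,∞) satisfy 1/p = 1/p₁ + 1/p₂. Then there is a constant C such that for all f, g ∈ ℓ¹(ℤ^d) with the property that there exists ε > 0 with 𝓕f(ξ) = 0 and 𝓕g(ξ) = 0 for every ξ ∈ 𝕋^d with |ξ| < ε, the pointwise product fg (which again lies in ℓ¹(ℤ^d)) satisfies ‖(−Δ_{ℤ^d})^s(fg)‖_{ℓ^p(ℤ^d)} ≤ C ( ‖(−Δ_{ℤ^d})^s f‖_{ℓ^{p₁}(ℤ^d)} ‖g‖_{ℓ^{p₂}(ℤ^d)} + ‖(−Δ_{ℤ^d})^s g‖_{ℓ^{p₂}(ℤ^d)} ‖f‖_{ℓ^{p₁}(ℤ^d)} ). -/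
open MeasureTheory Real
open scoped ENNReal NNReal

/-- The function `Sin(ξ) = (4 ∑_j sin²(π ξ_j))^{1/2}` on `ℝ^d`. -/
noncomputable def SinD (d : ℕ) (ξ : Fin d → ℝ) : ℝ :=
  Real.sqrt (4 * ∑ j, Real.sin (Real.pi * ξ j) ^ 2)

/-- The torus `𝕋^d = [-1/2, 1/2]^d`. -/
noncomputable def Td (d : ℕ) : Set (Fin d → ℝ) :=
  Set.univ.pi fun _ => Set.Icc (-(1 : ℝ) / 2) (1 / 2)

/-- The Fourier transform of `f ∈ ℓ¹(ℤ^d)`: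
`𝓕f(ξ) = ∑_{n ∈ ℤ^d} f(n) e^{2π i n·ξ}`. -/
noncomputable def Ftd (d : ℕ) (f : (Fin d → ℤ) → ℂ) (ξ : Fin d → ℝ) : ℂ :=
  ∑' n : Fin d → ℤ,
    f n * Complex.exp (2 * Real.pi * Complex.I * ∑ j, (n j : ℂ) * (ξ j : ℂ))

/-- The `ℓ^p(ℤ^d)` norm, valued in `ℝ≥0∞`. -/
noncomputable def lpN (d : ℕ) (p : ℝ) (f : (Fin d → ℤ) → ℂ) : ℝ≥0∞ :=
  (∑' n : Fin d → ℤ, (‖f n‖₊ : ℝ≥0∞) ^ p) ^ (1 / p)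

/-- The fractional power of the discrete Laplacian on `ℤ^d`:
`(-Δ_{ℤ^d})^s f(n) = ∫_{𝕋^d} Sin(ξ)^{2s} 𝓕f(ξ) e^{-2πi n·ξ} dξ`. -/
noncomputable def fracLapZ (d : ℕ) (s : ℝ) (f : (Fin d → ℤ) → ℂ)
    (n : Fin d → ℤ) : ℂ :=
  ∫ ξ in Td d,
    ((SinD d ξ ^ (2 * s) : ℝ) : ℂ) * Ftd d f ξ *
      Complex.exp (-(2 * Real.pi * Complex.I) * ∑ j, (n j : ℂ) * (ξ j : ℂ))

namespace FracLeibniz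


theorem _root_.HasSum.of_eq {ι α : Type*} [AddCommMonoid α] [TopologicalSpace α] {f g : ι → α}
    {a b : α} (h : HasSum f a) (hfg : ∀ i, g i = f i) (hab : b = a) : HasSum g b := by
  rw [funext hfg, hab]; exact h

section BanachAlgebra

variable {𝓐 : Type*} [NormedCommRing 𝓐] [NormedAlgebra ℝ 𝓐] [CompleteSpace 𝓐] [NormOneClass 𝓐]

theorem norm_exp_le_exp_norm (x : 𝓐) : ‖NormedSpace.exp x‖ ≤ Real.exp ‖x‖ := by
  have h1 := NormedSpace.exp_series_hasSum_exp' (𝕂 := ℝ) x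
  have h2 := NormedSpace.exp_series_hasSum_exp' (𝕂 := ℝ) ‖x‖
  rw [← Real.exp_eq_exp_ℝ] at h2
  refine h1.norm_le_of_bounded h2 fun n => ?_
  rw [norm_smul, smul_eq_mul, Real.norm_of_nonneg (by positivity)]
  gcongr
  exact norm_pow_le x n

theorem exp_add' (x y : 𝓐) : NormedSpace.exp (x + y) = NormedSpace.exp x * NormedSpace.exp y := by
  let : NormedAlgebra ℚ 𝓐 := NormedAlgebra.restrictScalars ℚ ℝ 𝓐
  exact NormedSpace.exp_add

theorem exp_smul_one (c : ℝ) : NormedSpace.exp (c • (1 : 𝓐)) = Real.exp c • (1 : 𝓐) := by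
  let : NormedAlgebra ℚ 𝓐 := NormedAlgebra.restrictScalars ℚ ℝ 𝓐
  have := NormedSpace.map_exp (algebraMap ℝ 𝓐) (algebraMapCLM ℝ 𝓐).continuous c
  rw [← Algebra.algebraMap_eq_smul_one, ← this, ← Real.exp_eq_exp_ℝ,
    Algebra.algebraMap_eq_smul_one]

theorem norm_exp_smul_sub_le_one {x : 𝓐} {c t : ℝ} (hx : ‖x‖ ≤ c) (ht : 0 ≤ t) :
    ‖NormedSpace.exp (t • (x - c • (1 : 𝓐)))‖ ≤ 1 := by
  have : t • (x - c • (1 : 𝓐)) = t • x + (-(t * c)) • (1 : 𝓐) := by module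
  rw [this, exp_add', exp_smul_one, mul_smul_comm, mul_one, norm_smul,
    Real.norm_of_nonneg (Real.exp_pos _).le]
  calc _ ≤ Real.exp (-(t * c)) * Real.exp (t * c) := by
        gcongr
        refine (norm_exp_le_exp_norm _).trans ?_
        gcongr
        rw [norm_smul, Real.norm_of_nonneg ht]
        gcongr
    _ = 1 := by rw [← Real.exp_add]; simp

/-- Variance of the Poisson distribution. -/
theorem hasSum_poisson_variance {t : ℝ} (ht : 0 < t) :
    HasSum (fun k : ℕ => t ^ k / k.factorial * ((k : ℝ) / t - 1) ^ 2) (Real.exp t / t) := by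
  have h0 : HasSum (fun k : ℕ => t ^ k / k.factorial) (Real.exp t) := by
    rw [Real.exp_eq_exp_ℝ]; exact NormedSpace.expSeries_div_hasSum_exp t
  have h1 : HasSum (fun k : ℕ => (k : ℝ) * (t ^ k / k.factorial)) (t * Real.exp t) := by
    rw [← hasSum_nat_add_iff' 1]
    simp only [Finset.range_one, Finset.sum_singleton, Nat.cast_zero, zero_mul, sub_zero]
    refine (h0.mul_left t).of_eq (fun k => ?_) rfl
    symm
    rw [Nat.factorial_succ]; push_cast; field_simp; ring
  have h2 : HasSum (fun k : ℕ => (k : ℝ) ^ 2 * (t ^ k / k.factorial))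
      (t * (t * Real.exp t + Real.exp t)) := by
    rw [← hasSum_nat_add_iff' 1]
    simp only [Finset.range_one, Finset.sum_singleton, Nat.cast_zero, zero_mul, sub_zero, ne_eq,
      OfNat.ofNat_ne_zero, not_false_eq_true, zero_pow]
    refine ((h1.add h0).mul_left t).of_eq (fun k => ?_) rfl
    symm
    rw [Nat.factorial_succ]; push_cast; field_simp; ring
  refine (((h2.mul_left (t⁻¹ ^ 2)).sub (h1.mul_left (2 * t⁻¹))).add h0).of_eq (fun k => ?_) ?_
  · field_simp; ring
  · field_simp; ring

/-- Poisson smoothing. -/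
theorem norm_sub_one_mul_exp_le {S : 𝓐} (hS : ‖S‖ ≤ 1) {t : ℝ} (ht : 0 < t) :
    ‖(S - 1) * NormedSpace.exp (t • (S - 1))‖ ≤ 1 / √t := by
  have e1 : NormedSpace.exp (t • (S - 1)) = Real.exp (-t) • NormedSpace.exp (t • S) := by
    rw [show t • (S - 1) = t • S + (-t) • (1 : 𝓐) by module, exp_add', exp_smul_one]
    simp
  have h0 : HasSum (fun k : ℕ => (t ^ k / k.factorial) • S ^ k) (NormedSpace.exp (t • S)) := by
    refine (NormedSpace.exp_series_hasSum_exp' (𝕂 := ℝ) (t • S)).of_eq (fun k => ?_) rfl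
    symm
    rw [smul_pow, smul_smul]; congr 1; field_simp
  have h1 : HasSum (fun k : ℕ => ((k : ℝ) / t * (t ^ k / k.factorial)) • S ^ k)
      (S * NormedSpace.exp (t • S)) := by
    rw [← hasSum_nat_add_iff' 1]
    simp only [Finset.range_one, Finset.sum_singleton, Nat.cast_zero, zero_mul, sub_zero, zero_div,
      zero_smul]
    refine (h0.mul_left S).of_eq (fun k => ?_) rfl
    symm
    rw [mul_smul_comm, pow_succ' S]
    congr 1
    rw [Nat.factorial_succ]; push_cast; field_simp; ring
  have h2 : HasSum (fun k : ℕ => (t ^ k / k.factorial * ((k : ℝ) / t - 1)) • S ^ k)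
      ((S - 1) * NormedSpace.exp (t • S)) := by
    refine (h1.sub h0).of_eq (fun k => ?_) ?_
    · rw [← sub_smul]; congr 1; ring
    · ring
  have h3 : HasSum (fun k : ℕ => t ^ k / k.factorial *
      ((√t * ((k : ℝ) / t - 1) ^ 2 + 1 / √t) / 2)) (Real.exp t / √t) := by
    have h00 : HasSum (fun k : ℕ => t ^ k / k.factorial) (Real.exp t) := by
      rw [Real.exp_eq_exp_ℝ]; exact NormedSpace.expSeries_div_hasSum_exp t
    refine ((((hasSum_poisson_variance ht).mul_left √t).add (h00.mul_left (1 / √t))).mul_left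
      (1 / 2)).of_eq (fun k => ?_) ?_
    · ring
    · have := Real.sq_sqrt ht.le
      have h4 : √t * (Real.exp t / t) = Real.exp t / √t := by
        rw [mul_div_left_comm, Real.sqrt_div_self', mul_one_div]
      rw [h4]; ring
  have h4 : ‖(S - 1) * NormedSpace.exp (t • S)‖ ≤ Real.exp t / √t := by
    refine h2.norm_le_of_bounded h3 fun k => ?_
    rw [norm_smul, norm_mul, Real.norm_of_nonneg (by positivity : 0 ≤ t ^ k / k.factorial)]
    have hSk : ‖S ^ k‖ ≤ 1 := (norm_pow_le S k).trans (pow_le_one₀ (norm_nonneg _) hS)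
    calc _ ≤ t ^ k / k.factorial * ‖(k : ℝ) / t - 1‖ * 1 := by gcongr
      _ ≤ _ := by
        rw [mul_one]
        gcongr
        set y := (k : ℝ) / t - 1
        have hq : 0 < √t := Real.sqrt_pos.2 ht
        have : 0 ≤ (√t * |y| - 1) ^ 2 / √t := by positivity
        have h5 : (√t * |y| - 1) ^ 2 / √t = √t * y ^ 2 + 1 / √t - 2 * |y| := by
          rw [← sq_abs y]; field_simp; ring
        rw [Real.norm_eq_abs]; linarith
  rw [e1, mul_smul_comm, norm_smul, Real.norm_of_nonneg (Real.exp_pos _).le]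
  calc _ ≤ Real.exp (-t) * (Real.exp t / √t) := by gcongr
    _ = _ := by rw [← mul_div_assoc, ← Real.exp_add]; simp

theorem norm_exp_smul_sum_sub_one_le {ι : Type*} (F : Finset ι) {S : ι → 𝓐} (hS : ∀ i, ‖S i‖ ≤ 1)
    {t : ℝ} (ht : 0 ≤ t) : ‖NormedSpace.exp (t • ∑ i ∈ F, (S i - 1))‖ ≤ 1 := by
  have h1 : ∑ i ∈ F, (S i - 1) = ∑ i ∈ F, S i - (F.card : ℝ) • (1 : 𝓐) := by
    rw [Finset.sum_sub_distrib, Finset.sum_const, Nat.cast_smul_eq_nsmul]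
  rw [h1]
  refine norm_exp_smul_sub_le_one ?_ ht
  refine (norm_sum_le _ _).trans ((Finset.sum_le_sum fun i _ => hS i).trans ?_)
  simp

theorem norm_sub_one_mul_exp_sum_le {ι : Type*} [DecidableEq ι] {F : Finset ι} {S : ι → 𝓐}
    (hS : ∀ i, ‖S i‖ ≤ 1) {i : ι} (hi : i ∈ F) {t : ℝ} (ht : 0 < t) :
    ‖(S i - 1) * NormedSpace.exp (t • ∑ i ∈ F, (S i - 1))‖ ≤ 1 / √t := by
  rw [← Finset.add_sum_erase _ _ hi, smul_add, exp_add', ← mul_assoc]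
  refine (norm_mul_le _ _).trans ((mul_le_of_le_one_right (norm_nonneg _)
    (norm_exp_smul_sum_sub_one_le _ hS ht.le)).trans ?_)
  exact norm_sub_one_mul_exp_le (hS i) ht

end BanachAlgebra


section SingularIntegral

open Set

theorem kernel_eqOn_Ioc {σ κ T : ℝ} (hκ : 0 < κ) (hT : 0 < T) :
    EqOn (fun t : ℝ => t ^ (-σ - 1) * min 1 ((t / T) ^ κ))
      (fun t => T ^ (-κ) * t ^ (κ - σ - 1)) (Ioc 0 T) := by
  intro t ht
  have h1 : (t / T) ^ κ ≤ 1 :=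
    Real.rpow_le_one (div_pos ht.1 hT).le ((div_le_one hT).2 ht.2) hκ.le
  simp only
  rw [min_eq_right h1, Real.div_rpow ht.1.le hT.le, Real.rpow_neg hT.le,
    show κ - σ - 1 = (-σ - 1) + κ by ring, Real.rpow_add ht.1]
  field_simp

theorem kernel_eqOn_Ioi {σ κ T : ℝ} (hκ : 0 < κ) (hT : 0 < T) :
    EqOn (fun t : ℝ => t ^ (-σ - 1) * min 1 ((t / T) ^ κ)) (fun t => t ^ (-σ - 1)) (Ioi T) := by
  intro t ht
  have h1 : 1 ≤ (t / T) ^ κ :=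
    Real.one_le_rpow ((one_le_div hT).2 (le_of_lt ht)) hκ.le
  simp only
  rw [min_eq_left h1, mul_one]

variable {σ κ T : ℝ}

theorem integrableOn_kernel (hσ : 0 < σ) (hκ : σ < κ) (hT : 0 < T) :
    IntegrableOn (fun t : ℝ => t ^ (-σ - 1) * min 1 ((t / T) ^ κ)) (Ioi 0) := by
  rw [← Ioc_union_Ioi_eq_Ioi hT.le]
  refine IntegrableOn.union ?_ ?_
  · refine IntegrableOn.congr_fun ?_ (kernel_eqOn_Ioc (hσ.trans hκ) hT).symm measurableSet_Ioc
    refine Integrable.const_mul ?_ _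
    have := intervalIntegral.intervalIntegrable_rpow' (a := 0) (b := T) (r := κ - σ - 1)
      (by linarith)
    exact (intervalIntegrable_iff_integrableOn_Ioc_of_le hT.le).1 this
  · refine IntegrableOn.congr_fun ?_ (kernel_eqOn_Ioi (hσ.trans hκ) hT).symm measurableSet_Ioi
    exact integrableOn_Ioi_rpow_of_lt (by linarith) hT

theorem integral_kernel (hσ : 0 < σ) (hκ : σ < κ) (hT : 0 < T) :
    ∫ t in Ioi (0 : ℝ), t ^ (-σ - 1) * min 1 ((t / T) ^ κ) =
      (1 / (κ - σ) + 1 / σ) * T ^ (-σ) := by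
  have hI := integrableOn_kernel hσ hκ hT
  rw [← Ioc_union_Ioi_eq_Ioi hT.le] at hI ⊢
  rw [setIntegral_union (Ioc_disjoint_Ioi le_rfl) measurableSet_Ioi
    (hI.mono_set subset_union_left) (hI.mono_set subset_union_right),
    setIntegral_congr_fun measurableSet_Ioc (kernel_eqOn_Ioc (hσ.trans hκ) hT),
    setIntegral_congr_fun measurableSet_Ioi (kernel_eqOn_Ioi (hσ.trans hκ) hT),
    integral_Ioi_rpow_of_lt (by linarith) hT, integral_const_mul,
    ← intervalIntegral.integral_of_le hT.le, integral_rpow (Or.inl (by linarith)),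
    show κ - σ - 1 + 1 = κ - σ by ring, show -σ - 1 + 1 = -σ by ring,
    Real.zero_rpow (by linarith), sub_zero, add_mul,
    show κ - σ = κ + (-σ) by ring, Real.rpow_add hT, Real.rpow_neg hT.le κ]
  have := Real.rpow_pos_of_pos hT κ
  have : κ + -σ ≠ 0 := by linarith
  field_simp

variable {X : Type*} [NormedAddCommGroup X] [NormedSpace ℝ X]

theorem integrableOn_rpow_smul {f : ℝ → X} (hf : ContinuousOn f (Ioi 0)) {K : ℝ}
    (hσ : 0 < σ) (hκ : σ < κ) (hT : 0 < T)
    (hK : ∀ t, 0 < t → ‖f t‖ ≤ K * min 1 ((t / T) ^ κ)) :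
    IntegrableOn (fun t => t ^ (-σ - 1) • f t) (Ioi 0) := by
  refine Integrable.mono' ((integrableOn_kernel hσ hκ hT).const_mul K) ?_ ?_
  · refine ContinuousOn.aestronglyMeasurable ?_ measurableSet_Ioi
    refine ContinuousOn.smul (fun t ht => ?_) hf
    exact (Real.continuousAt_rpow_const _ _ (Or.inl (ne_of_gt ht))).continuousWithinAt
  · refine (ae_restrict_iff' measurableSet_Ioi).2 (Filter.Eventually.of_forall fun t ht => ?_)
    have ht : 0 < t := ht
    rw [norm_smul, Real.norm_of_nonneg (by positivity), mul_left_comm]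
    gcongr
    exact hK t ht

theorem norm_integral_rpow_smul_le {f : ℝ → X} {K : ℝ}
    (hσ : 0 < σ) (hκ : σ < κ) (hT : 0 < T)
    (hK : ∀ t, 0 < t → ‖f t‖ ≤ K * min 1 ((t / T) ^ κ)) :
    ‖∫ t in Ioi (0 : ℝ), t ^ (-σ - 1) • f t‖ ≤ K * (1 / (κ - σ) + 1 / σ) * T ^ (-σ) := by
  rw [mul_assoc, ← integral_kernel hσ hκ hT, ← integral_const_mul]
  refine norm_integral_le_of_norm_le ((integrableOn_kernel hσ hκ hT).const_mul K) ?_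
  refine (ae_restrict_iff' measurableSet_Ioi).2 (Filter.Eventually.of_forall fun t ht => ?_)
  have ht : 0 < t := ht
  rw [norm_smul, Real.norm_of_nonneg (by positivity), mul_left_comm]
  gcongr
  exact hK t ht

end SingularIntegral

open Set in
/-- Normalising constant of the Balakrishnan formula
`λ ^ σ = c⁻¹ ∫₀^∞ t ^ (-σ - 1) (1 - e ^ (-t λ)) dt`. -/
noncomputable def balakrishnanConst (σ : ℝ) : ℝ :=
  ∫ t in Ioi (0 : ℝ), t ^ (-σ - 1) • (1 - Real.exp (-t))

section Balakrishnan

open Set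

variable {σ : ℝ}

theorem norm_one_sub_exp_neg_le {t : ℝ} (ht : 0 < t) :
    ‖1 - Real.exp (-t)‖ ≤ 1 * min 1 ((t / 1) ^ (1 : ℝ)) := by
  have h1 : Real.exp (-t) ≤ 1 := Real.exp_le_one_iff.2 (by linarith)
  have h2 := Real.add_one_le_exp (-t)
  have h3 := Real.exp_pos (-t)
  rw [Real.norm_of_nonneg (by linarith), one_mul, div_one, Real.rpow_one]
  exact le_min (by linarith) (by linarith)

theorem balakrishnanConst_pos (hσ : 0 < σ) (hσ1 : σ < 1) : 0 < balakrishnanConst σ := by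
  have hI : IntegrableOn (fun t : ℝ => t ^ (-σ - 1) • (1 - Real.exp (-t))) (Ioi 0) :=
    integrableOn_rpow_smul (by fun_prop) hσ hσ1 one_pos fun t ht => norm_one_sub_exp_neg_le ht
  have hpos : ∀ t : ℝ, 0 < t → 0 < t ^ (-σ - 1) • (1 - Real.exp (-t)) := fun t ht => by
    have : Real.exp (-t) < 1 := by simpa using ht
    have : 0 < 1 - Real.exp (-t) := by linarith
    simp only [smul_eq_mul]; positivity
  rw [balakrishnanConst, setIntegral_pos_iff_support_of_nonneg_ae _ hI]
  · refine lt_of_lt_of_le ?_ (measure_mono (s := Ioi 0) fun t ht => ⟨(hpos t ht).ne', ht⟩)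
    simp
  · exact (ae_restrict_iff' measurableSet_Ioi).2
      (Filter.Eventually.of_forall fun t ht => (hpos t ht).le)

theorem integral_balakrishnan (hσ : 0 < σ) {l : ℝ} (hl : 0 ≤ l) :
    ∫ t in Ioi (0 : ℝ), t ^ (-σ - 1) • (1 - Real.exp (-(t * l))) =
      balakrishnanConst σ * l ^ σ := by
  rcases hl.eq_or_lt with rfl | hl
  · simp [Real.zero_rpow hσ.ne']
  have := integral_comp_mul_left_Ioi (fun t : ℝ => t ^ (-σ - 1) • (1 - Real.exp (-t))) 0 hl
  rw [mul_zero] at this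
  change _ = l⁻¹ • balakrishnanConst σ at this
  have h2 : ∀ t ∈ Ioi (0 : ℝ), t ^ (-σ - 1) • (1 - Real.exp (-(t * l))) =
      l ^ (σ + 1) * ((l * t) ^ (-σ - 1) • (1 - Real.exp (-(l * t)))) := fun t ht => by
    have ht : 0 < t := ht
    rw [Real.mul_rpow hl.le ht.le, smul_eq_mul, smul_eq_mul, mul_comm t l,
      show -σ - 1 = -(σ + 1) by ring, Real.rpow_neg hl.le]
    have := Real.rpow_pos_of_pos hl (σ + 1)
    field_simp
  rw [setIntegral_congr_fun measurableSet_Ioi h2, integral_const_mul, this,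
    Real.rpow_add_one hl.ne']
  simp only [smul_eq_mul]
  field_simp

end Balakrishnan

section Semigroup

variable {𝓐 : Type*} [NormedCommRing 𝓐] [NormedAlgebra ℝ 𝓐]

/-- The semigroup generated by `G`. -/
noncomputable def heat (G : 𝓐) (t : ℝ) : 𝓐 := NormedSpace.exp (t • G)

/-- `G` generates a contraction semigroup with the parabolic smoothing estimate. -/
structure IsSmoothing (G : 𝓐) (K : ℝ) : Prop where
  norm_heat_le : ∀ t, 0 ≤ t → ‖heat G t‖ ≤ 1
  norm_mul_heat_le : ∀ t, 0 < t → ‖G * heat G t‖ ≤ K / t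

/-- The fractional power `(-G) ^ σ`, by Balakrishnan's formula. -/
noncomputable def fracPow (G : 𝓐) (σ : ℝ) : 𝓐 :=
  (balakrishnanConst σ)⁻¹ • ∫ t in Set.Ioi (0 : ℝ), t ^ (-σ - 1) • (1 - heat G t)

theorem heat_zero (G : 𝓐) : heat G 0 = 1 := by
  simp [heat]

variable [CompleteSpace 𝓐]

theorem heat_add (G : 𝓐) (s t : ℝ) : heat G (s + t) = heat G s * heat G t := by
  let : NormedAlgebra ℚ 𝓐 := NormedAlgebra.restrictScalars ℚ ℝ 𝓐
  rw [heat, add_smul, NormedSpace.exp_add]; rfl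

theorem hasDerivAt_heat (G : 𝓐) (t : ℝ) : HasDerivAt (heat G) (G * heat G t) t :=
  hasDerivAt_exp_smul_const' G t

theorem continuous_heat (G : 𝓐) : Continuous (heat G) :=
  continuous_iff_continuousAt.2 fun t => (hasDerivAt_heat G t).continuousAt

theorem heat_nat_mul (G : 𝓐) (n : ℕ) (t : ℝ) : heat G (n * t) = heat G t ^ n := by
  induction n with
  | zero => simp [heat_zero]
  | succ n ih => rw [Nat.cast_succ, add_mul, one_mul, heat_add, ih, pow_succ]

variable [NormOneClass 𝓐] {G : 𝓐} {K : ℝ}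

theorem IsSmoothing.nonneg (h : IsSmoothing G K) : 0 ≤ K := by
  simpa using (norm_nonneg _).trans (h.norm_mul_heat_le 1 one_pos)

theorem norm_one_sub_heat_mul_le {t L : ℝ} (ht : 0 < t) (b : 𝓐)
    (hL : ∀ u, 0 ≤ u → ‖G * heat G u * b‖ ≤ L) : ‖(1 - heat G t) * b‖ ≤ L * t := by
  have := norm_image_sub_le_of_norm_deriv_le_segment' (f := fun u => heat G u * b)
    (f' := fun u => G * heat G u * b) (a := 0) (b := t) (C := L)
    (fun x _ => ((hasDerivAt_heat G x).mul_const b).hasDerivWithinAt) (fun x hx => hL x hx.1) t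
    ⟨ht.le, le_rfl⟩
  rw [heat_zero, sub_zero, ← sub_mul] at this
  rwa [sub_mul, ← norm_neg, neg_sub, ← sub_mul]

theorem IsSmoothing.norm_one_sub_heat_le_two (h : IsSmoothing G K) {t : ℝ} (ht : 0 ≤ t) :
    ‖1 - heat G t‖ ≤ 2 :=
  (norm_sub_le _ _).trans (by rw [norm_one]; linarith [h.norm_heat_le t ht])

theorem le_mul_min_of_le {x a b y : ℝ} (ha : 0 ≤ a) (hb : 0 ≤ b) (h1 : x ≤ a)
    (h2 : x ≤ b * y) (hy : 0 ≤ y) :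
    x ≤ (a + b) * min 1 (y ^ (1 : ℝ)) := by
  rw [Real.rpow_one]
  rcases le_total 1 y with h | h
  · rw [min_eq_left h]; linarith
  · rw [min_eq_right h]; nlinarith

theorem IsSmoothing.norm_one_sub_heat_le (h : IsSmoothing G K) {t : ℝ} (ht : 0 < t) :
    ‖1 - heat G t‖ ≤ (2 + ‖G‖) * min 1 ((t / 1) ^ (1 : ℝ)) := by
  refine le_mul_min_of_le zero_le_two (norm_nonneg _) (h.norm_one_sub_heat_le_two ht.le) ?_
    (by positivity)
  rw [div_one, ← mul_one (1 - heat G t)]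
  refine norm_one_sub_heat_mul_le ht 1 fun u hu => ?_
  rw [mul_one]
  exact (norm_mul_le _ _).trans (mul_le_of_le_one_right (norm_nonneg _) (h.norm_heat_le u hu))

theorem IsSmoothing.norm_one_sub_heat_mul_heat_le (h : IsSmoothing G K) {t r : ℝ} (ht : 0 < t)
    (hr : 0 < r) : ‖(1 - heat G t) * heat G r‖ ≤ (2 + K) * min 1 ((t / r) ^ (1 : ℝ)) := by
  refine le_mul_min_of_le zero_le_two h.nonneg ?_ ?_ (by positivity)
  · refine (norm_mul_le _ _).trans ?_
    have h1 := h.norm_one_sub_heat_le_two ht.le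
    have h2 := h.norm_heat_le r hr.le
    nlinarith [norm_nonneg (1 - heat G t), norm_nonneg (heat G r)]
  · rw [mul_div_left_comm, mul_comm t]
    refine norm_one_sub_heat_mul_le ht _ fun u hu => ?_
    rw [mul_right_comm]
    exact (norm_mul_le _ _).trans ((mul_le_of_le_one_right (norm_nonneg _)
      (h.norm_heat_le u hu)).trans (h.norm_mul_heat_le r hr))

variable {σ : ℝ}

theorem IsSmoothing.integrableOn (h : IsSmoothing G K) (hσ : 0 < σ) (hσ1 : σ < 1) :
    IntegrableOn (fun t : ℝ => t ^ (-σ - 1) • (1 - heat G t)) (Set.Ioi 0) :=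
  integrableOn_rpow_smul (continuous_const.sub (continuous_heat G)).continuousOn hσ hσ1 one_pos
    fun _ ht => h.norm_one_sub_heat_le ht

theorem fracPow_map {Y : Type*} [NormedAddCommGroup Y] [NormedSpace ℝ Y] [CompleteSpace Y]
    (h : IsSmoothing G K) (hσ : 0 < σ) (hσ1 : σ < 1) (φ : 𝓐 →L[ℝ] Y) :
    φ (fracPow G σ) = (balakrishnanConst σ)⁻¹ •
      ∫ t in Set.Ioi (0 : ℝ), t ^ (-σ - 1) • φ (1 - heat G t) := by
  rw [fracPow, map_smul, ← φ.integral_comp_comm (h.integrableOn hσ hσ1)]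
  simp only [map_smul]

/-- Bound for `‖(-G) ^ σ e ^ (r G)‖` in terms of the smoothing constant. -/
noncomputable def fracConst (σ K : ℝ) : ℝ :=
  (balakrishnanConst σ)⁻¹ * ((2 + K) * (1 / (1 - σ) + 1 / σ))

theorem fracConst_nonneg (hσ : 0 < σ) (hσ1 : σ < 1) (hK : 0 ≤ K) : 0 ≤ fracConst σ K := by
  have := balakrishnanConst_pos hσ hσ1
  have : 0 < 1 - σ := by linarith
  unfold fracConst; positivity

theorem IsSmoothing.norm_fracPow_mul_heat_le (h : IsSmoothing G K) (hσ : 0 < σ) (hσ1 : σ < 1)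
    {r : ℝ} (hr : 0 < r) : ‖fracPow G σ * heat G r‖ ≤ fracConst σ K * r ^ (-σ) := by
  have := fracPow_map h hσ hσ1 ((ContinuousLinearMap.mul ℝ 𝓐).flip (heat G r))
  simp only [ContinuousLinearMap.flip_apply, ContinuousLinearMap.mul_apply'] at this
  have hc := balakrishnanConst_pos hσ hσ1
  rw [this, norm_smul, Real.norm_of_nonneg (by positivity), fracConst, mul_assoc]
  gcongr
  exact norm_integral_rpow_smul_le hσ hσ1 hr fun t ht => h.norm_one_sub_heat_mul_heat_le ht hr

theorem IsSmoothing.map_fracPow (h : IsSmoothing G K) (hσ : 0 < σ) (hσ1 : σ < 1)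
    (φ : 𝓐 →ₐ[ℝ] ℂ) (hφ : Continuous φ) {l : ℝ} (hl : 0 ≤ l) (hG : φ G = -l) :
    φ (fracPow G σ) = ((l ^ σ : ℝ) : ℂ) := by
  let : NormedAlgebra ℚ 𝓐 := NormedAlgebra.restrictScalars ℚ ℝ 𝓐
  have h1 : ∀ t : ℝ, φ (1 - heat G t) = ((1 - Real.exp (-(t * l)) : ℝ) : ℂ) := fun t => by
    rw [map_sub, map_one, heat, NormedSpace.map_exp φ hφ, map_smul, hG, ← Complex.exp_eq_exp_ℂ]
    push_cast
    simp
  have := fracPow_map h hσ hσ1 { toFun := φ, map_add' := map_add φ, map_smul' := map_smul φ, cont := hφ }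
  change φ (fracPow G σ) = _ • ∫ t in Set.Ioi (0 : ℝ), t ^ (-σ - 1) • φ (1 - heat G t) at this
  rw [this]
  simp only [h1, Complex.real_smul, ← Complex.ofReal_mul]
  rw [integral_complex_ofReal, ← Complex.ofReal_mul]
  have h2 := integral_balakrishnan hσ hl
  simp only [smul_eq_mul] at h2
  rw [h2, inv_mul_cancel_left₀ (balakrishnanConst_pos hσ hσ1).ne']

end Semigroup


section Interpolation

variable {𝓐 : Type*} [NormedCommRing 𝓐] [NormedAlgebra ℝ 𝓐]

/-- The operator `∫₀ᵀ e ^ (r G) (-G) ^ (1 - σ) dr`, a left inverse of `(-G) ^ σ` up to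
`e ^ (T G)`. -/
noncomputable def approxInv (G : 𝓐) (σ T : ℝ) : 𝓐 :=
  ∫ r in (0 : ℝ)..T, heat G r * fracPow G (1 - σ)

variable [CompleteSpace 𝓐] [NormOneClass 𝓐] {G : 𝓐} {K σ : ℝ}

theorem mul_approxInv (b : 𝓐) (T : ℝ) :
    b * approxInv G σ T = ∫ r in (0 : ℝ)..T, b * (heat G r * fracPow G (1 - σ)) :=
  ((ContinuousLinearMap.mul ℝ 𝓐 b).intervalIntegral_comp_comm
    (((continuous_heat G).mul continuous_const).intervalIntegrable _ _)).symm

theorem approxInv_mul (hAB : fracPow G σ * fracPow G (1 - σ) = -G) (T : ℝ) :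
    approxInv G σ T * fracPow G σ = 1 - heat G T := by
  have hc := continuous_heat G
  have h1 : approxInv G σ T * fracPow G σ = ∫ r in (0 : ℝ)..T, -(G * heat G r) := by
    rw [mul_comm, mul_approxInv]
    refine intervalIntegral.integral_congr fun r _ => ?_
    rw [mul_left_comm, hAB]; ring
  rw [h1, intervalIntegral.integral_neg, intervalIntegral.integral_eq_sub_of_hasDerivAt
    (fun x _ => hasDerivAt_heat G x) ((continuous_const.mul hc).intervalIntegrable _ _),
    heat_zero, neg_sub]

theorem norm_mul_approxInv_le {b : 𝓐} {T C a : ℝ} (ha : -1 < a) (hT : 0 < T)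
    (h : ∀ r, 0 < r → ‖b * (heat G r * fracPow G (1 - σ))‖ ≤ C * r ^ a) :
    ‖b * approxInv G σ T‖ ≤ C / (a + 1) * T ^ (a + 1) := by
  rw [mul_approxInv]
  refine (intervalIntegral.norm_integral_le_of_norm_le hT.le
    (Filter.Eventually.of_forall fun r hr => h r hr.1)
    ((intervalIntegral.intervalIntegrable_rpow' ha).const_mul C)).trans ?_
  rw [intervalIntegral.integral_const_mul, integral_rpow (Or.inl ha),
    Real.zero_rpow (by linarith), sub_zero]
  exact le_of_eq (by ring)

theorem IsSmoothing.exists_norm_approxInv_le (h : IsSmoothing G K) (hσ : 0 < σ) (hσ1 : σ < 1) :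
    ∃ C, 0 ≤ C ∧ ∀ T, 0 < T → ‖approxInv G σ T‖ ≤ C * T ^ σ := by
  have hc := fracConst_nonneg (σ := 1 - σ) (by linarith) (by linarith) h.nonneg
  refine ⟨fracConst (1 - σ) K / σ, by positivity, fun T hT => ?_⟩
  have := norm_mul_approxInv_le (G := G) (σ := σ) (b := 1) (a := σ - 1) (by linarith) hT
    (C := fracConst (1 - σ) K) fun r hr => by
      rw [one_mul, mul_comm, show σ - 1 = -(1 - σ) by ring]
      exact h.norm_fracPow_mul_heat_le (by linarith) (by linarith) hr
  rwa [one_mul, show σ - 1 + 1 = σ by ring] at this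

theorem IsSmoothing.exists_norm_pow_mul_heat_le (h : IsSmoothing G K) (hσ : 0 < σ) (hσ1 : σ < 1)
    (k : ℕ) : ∃ C, 0 ≤ C ∧ ∀ T, 0 < T → ‖fracPow G σ ^ k * heat G T‖ ≤ C * T ^ (-(k * σ)) := by
  have hc := fracConst_nonneg hσ hσ1 h.nonneg
  rcases Nat.eq_zero_or_pos k with rfl | hk
  · exact ⟨1, zero_le_one, fun T hT => by simpa using h.norm_heat_le T hT.le⟩
  have hk' : (0 : ℝ) < k := by exact_mod_cast hk
  refine ⟨fracConst σ K ^ k * (k : ℝ) ^ (k * σ), by positivity, fun T hT => ?_⟩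
  have e1 : fracPow G σ ^ k * heat G T = (fracPow G σ * heat G (T / k)) ^ k := by
    rw [mul_pow, ← heat_nat_mul]; congr 2; field_simp
  rw [e1]
  calc _ ≤ (fracConst σ K * (T / k) ^ (-σ)) ^ k := by
        refine (norm_pow_le _ _).trans ?_
        gcongr
        exact h.norm_fracPow_mul_heat_le hσ hσ1 (by positivity)
    _ = _ := by
        rw [mul_pow, ← Real.rpow_natCast ((T / k) ^ (-σ)), ← Real.rpow_mul (by positivity),
          Real.div_rpow hT.le hk'.le, show -σ * (k : ℝ) = -(k * σ) by ring,
          Real.rpow_neg hk'.le, div_inv_eq_mul]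
        ring

/-- Splitting of `(-G) ^ (kσ)` into a low and a high frequency part at scale `T`. -/
theorem IsSmoothing.exists_splitting (h : IsSmoothing G K) (hσ : 0 < σ) (hσ1 : σ < 1)
    (hAB : fracPow G σ * fracPow G (1 - σ) = -G) (k n : ℕ) :
    ∃ C, 0 ≤ C ∧ ∀ T, 0 < T → ∃ U W : 𝓐, fracPow G σ ^ k = U + W * fracPow G σ ^ (k + n) ∧
      ‖U‖ ≤ C * T ^ (-(k * σ)) ∧ ‖W‖ ≤ C * T ^ (n * σ) := by
  obtain ⟨C₁, hC₁, h₁⟩ := h.exists_norm_pow_mul_heat_le hσ hσ1 k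
  obtain ⟨C₂, hC₂, h₂⟩ := h.exists_norm_approxInv_le hσ hσ1
  refine ⟨(∑ l ∈ Finset.range n, 2 ^ l) * C₁ + C₂ ^ n, by positivity, fun T hT =>
    ⟨(∑ l ∈ Finset.range n, (1 - heat G T) ^ l) * (fracPow G σ ^ k * heat G T),
      approxInv G σ T ^ n, ?_, ?_, ?_⟩⟩
  · have e1 := geom_sum_mul (1 - heat G T) n
    have e2 := approxInv_mul hAB T
    rw [pow_add]
    have e3 : approxInv G σ T ^ n * (fracPow G σ ^ k * fracPow G σ ^ n) =
      fracPow G σ ^ k * (1 - heat G T) ^ n := by rw [← e2, mul_pow]; ring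
    rw [e3]
    linear_combination (fracPow G σ ^ k) * e1
  · have hT' : 0 < T ^ (-(k * σ)) := Real.rpow_pos_of_pos hT _
    have : ‖∑ l ∈ Finset.range n, (1 - heat G T) ^ l‖ ≤ ∑ l ∈ Finset.range n, (2 : ℝ) ^ l := by
      refine norm_sum_le_of_le _ fun l _ => (norm_pow_le _ _).trans ?_
      gcongr
      exact h.norm_one_sub_heat_le_two hT.le
    calc _ ≤ (∑ l ∈ Finset.range n, (2 : ℝ) ^ l) * (C₁ * T ^ (-(k * σ))) :=
          (norm_mul_le _ _).trans (by gcongr; exact h₁ T hT)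
      _ ≤ _ := by rw [← mul_assoc, add_mul]; exact le_add_of_nonneg_right (by positivity)
  · have hT' : 0 < T ^ (n * σ) := Real.rpow_pos_of_pos hT _
    calc _ ≤ (C₂ * T ^ σ) ^ n := (norm_pow_le _ _).trans (by gcongr; exact h₂ T hT)
      _ = C₂ ^ n * T ^ (n * σ) := by
          rw [mul_pow, ← Real.rpow_natCast (T ^ σ), ← Real.rpow_mul hT.le, mul_comm σ]
      _ ≤ _ := by gcongr; exact le_add_of_nonneg_left (by positivity)

theorem le_two_mul_rpow {x y b : ℝ} (h1 : x ≤ 2) (h2 : x ≤ y) (hy : 0 ≤ y) (hb : 0 ≤ b)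
    (hb1 : b ≤ 1) : x ≤ 2 * y ^ b := by
  rcases le_total y 1 with h | h
  · have := Real.rpow_le_rpow_of_exponent_ge_of_imp hy h hb1 (by grind)
    rw [Real.rpow_one] at this
    linarith
  · have := Real.one_le_rpow h hb
    linarith

/-- Splitting of an element `δ` that gains half a derivative against the semigroup. -/
theorem IsSmoothing.exists_splitting_of_half (h : IsSmoothing G K) (hσ1 : σ < 1)
    (hAB : fracPow G σ * fracPow G (1 - σ) = -G) {e : ℝ} (he : 0 < e) (heσ : e < σ)
    (he1 : 2 * e ≤ 1) :
    ∃ C, 0 ≤ C ∧ ∀ (δ : 𝓐) (ℓ : ℝ), 0 ≤ ℓ → ‖δ‖ ≤ 2 →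
      (∀ t, 0 < t → ‖δ * heat G t‖ ≤ ℓ * (1 / √t)) → ∀ T, 0 < T →
      ∃ U W : 𝓐, δ = U + W * fracPow G σ ∧
        ‖U‖ ≤ C * ℓ ^ (2 * e) * T ^ (-e) ∧ ‖W‖ ≤ C * ℓ ^ (2 * e) * T ^ (σ - e) := by
  have hc := fracConst_nonneg (σ := 1 - σ) (by linarith) (by linarith) h.nonneg
  set c := fracConst (1 - σ) K
  set C₁ := 2 * c * (1 / 2) ^ (σ - e - 1) / (σ - e) with hC₁
  have hσe : 0 < σ - e := by linarith
  have hC₁0 : 0 ≤ C₁ := by positivity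
  refine ⟨2 + C₁, by positivity, fun δ ℓ hℓ hδ hδt T hT =>
    ⟨δ * heat G T, δ * approxInv G σ T, ?_, ?_, ?_⟩⟩
  · rw [mul_assoc, approxInv_mul hAB]; ring
  all_goals
    have key : ∀ t, 0 < t → ‖δ * heat G t‖ ≤ 2 * ℓ ^ (2 * e) * t ^ (-e) := fun t ht => by
      have h1 : ‖δ * heat G t‖ ≤ 2 := (norm_mul_le _ _).trans
        ((mul_le_of_le_one_right (norm_nonneg _) (h.norm_heat_le t ht.le)).trans hδ)
      refine (le_two_mul_rpow h1 (hδt t ht) (by positivity) (by positivity) he1).trans_eq ?_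
      rw [Real.mul_rpow hℓ (by positivity), Real.sqrt_eq_rpow, one_div, ← Real.rpow_neg ht.le,
        ← Real.rpow_mul ht.le, mul_assoc]
      congr 3; ring
    have hℓ' := Real.rpow_nonneg hℓ (2 * e)
  · refine (key T hT).trans ?_
    have := Real.rpow_pos_of_pos hT (-e)
    gcongr; linarith
  · have := norm_mul_approxInv_le (G := G) (σ := σ) (b := δ) (a := σ - e - 1) (by linarith) hT
      (C := ℓ ^ (2 * e) * (2 * c * (1 / 2) ^ (σ - e - 1))) fun r hr => by
        have hr2 : 0 < r / 2 := by positivity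
        have e1 : δ * (heat G r * fracPow G (1 - σ)) =
            (δ * heat G (r / 2)) * (fracPow G (1 - σ) * heat G (r / 2)) := by
          have := heat_add G (r / 2) (r / 2)
          rw [add_halves] at this
          rw [this]; ring
        have h3 := h.norm_fracPow_mul_heat_le (σ := 1 - σ) (by linarith) (by linarith) hr2
        have h4 := key _ hr2
        have h5 := Real.rpow_pos_of_pos hr2 (-(1 - σ))
        have h6 := Real.rpow_pos_of_pos hr2 (-e)
        rw [e1]
        calc _ ≤ (2 * ℓ ^ (2 * e) * (r / 2) ^ (-e)) * (c * (r / 2) ^ (-(1 - σ))) :=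
              (norm_mul_le _ _).trans (by gcongr)
          _ = _ := by
            rw [show σ - e - 1 = -e + -(1 - σ) by ring, mul_assoc (ℓ ^ (2 * e)),
              mul_assoc (2 * c), ← Real.mul_rpow (by norm_num) hr.le, one_div_mul_eq_div,
              Real.rpow_add hr2]
            ring
    rw [show σ - e - 1 + 1 = σ - e by ring, mul_div_assoc, ← hC₁] at this
    refine this.trans ?_
    have := Real.rpow_pos_of_pos hT (σ - e)
    rw [mul_comm (ℓ ^ (2 * e))]
    gcongr; linarith

end Interpolation


section Synthesis

variable {ι : Type*} [DecidableEq ι] [Nonempty ι]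
variable {X : Type*} [NormedAddCommGroup X] [NormedSpace ℂ X] [CompleteSpace X]

/-- The unit sequence at `k`. -/
noncomputable def unitSeq (k : ι) : lp (fun _ : ι => ℂ) 1 := lp.single 1 k 1

omit [Nonempty ι] in
theorem norm_unitSeq (k : ι) : ‖unitSeq k‖ = 1 := by
  rw [unitSeq, lp.norm_single (by simp)]; simp

omit [DecidableEq ι] [Nonempty ι] in
theorem l1_norm_eq (f : lp (fun _ : ι => ℂ) 1) : ‖f‖ = ∑' n, ‖f n‖ := by
  simpa using lp.norm_eq_tsum_rpow (by simp) f

omit [DecidableEq ι] [Nonempty ι] in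
theorem l1_summable (f : lp (fun _ : ι => ℂ) 1) : Summable fun n => ‖f n‖ := by
  simpa using (lp.memℓp f).summable (by simp)

omit [Nonempty ι] in
theorem unitSeq_apply (k n : ι) : (unitSeq k : lp (fun _ : ι => ℂ) 1) n = if n = k then 1 else 0 := by
  rw [unitSeq, lp.single_apply, Pi.single_apply]

omit [Nonempty ι] in
theorem hasSum_unitSeq (f : lp (fun _ : ι => ℂ) 1) : HasSum (fun k => f k • unitSeq k) f := by
  have := lp.hasSum_single (p := 1) (by simp) f
  refine this.of_eq (fun k => ?_) rfl
  rw [unitSeq, ← lp.single_smul]; simp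

omit [Nonempty ι] in
theorem l1_clm_ext {Y : Type*} [NormedAddCommGroup Y] [NormedSpace ℂ Y]
    {A B : lp (fun _ : ι => ℂ) 1 →L[ℂ] Y}
    (h : ∀ k, A (unitSeq k) = B (unitSeq k)) : A = B := by
  ext f
  have h1 := (hasSum_unitSeq f).mapL A
  have h2 := (hasSum_unitSeq f).mapL B
  simp only [map_smul, h] at h1 h2
  exact h1.unique h2

/-- The bounded operator on `ℓ¹` that sends the unit sequence at `k` to `u k`. -/
noncomputable def synth (u : ι → X) {K : ℝ} (hu : ∀ k, ‖u k‖ ≤ K) :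
    lp (fun _ : ι => ℂ) 1 →L[ℂ] X :=
  lp.tsumCLM ℂ ι X ∘L lp.mapCLM (E := fun _ => ℂ) (F := fun _ => X) 1
    (fun k => ContinuousLinearMap.toSpanSingleton ℂ (u k))
    ((norm_nonneg _).trans (hu (Classical.arbitrary ι))) (by simpa using hu)

variable (u : ι → X) {K : ℝ} (hu : ∀ k, ‖u k‖ ≤ K)

omit [DecidableEq ι] in
theorem synth_apply (f : lp (fun _ : ι => ℂ) 1) : synth u hu f = ∑' k, f k • u k := rfl

theorem synth_unitSeq (k : ι) : synth u hu (unitSeq k) = u k := by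
  rw [synth_apply, tsum_eq_single k]
  · simp [unitSeq_apply]
  · intro n hn; simp [unitSeq_apply, hn]

omit [DecidableEq ι] [Nonempty ι] [CompleteSpace X] in
include hu in
theorem summable_norm_smul (f : lp (fun _ : ι => ℂ) 1) : Summable fun k => ‖f k‖ * ‖u k‖ :=
  ((l1_summable f).mul_right K).of_nonneg_of_le (fun k => by positivity)
    fun k => by gcongr; exact hu k

omit [DecidableEq ι] in
theorem norm_synth_apply_le (f : lp (fun _ : ι => ℂ) 1) :
    ‖synth u hu f‖ ≤ ∑' k, ‖f k‖ * ‖u k‖ := by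
  rw [synth_apply]
  have := summable_norm_smul u hu f
  simp only [← norm_smul] at this ⊢
  exact norm_tsum_le_tsum_norm this

omit [DecidableEq ι] in
theorem norm_synth_le : ‖synth u hu‖ ≤ K := by
  have hK := (norm_nonneg _).trans (hu (Classical.arbitrary ι))
  refine ContinuousLinearMap.opNorm_le_bound _ hK fun f => (norm_synth_apply_le u hu f).trans ?_
  rw [l1_norm_eq, mul_comm, ← tsum_mul_right]
  refine (summable_norm_smul u hu f).tsum_le_tsum (fun k => ?_) ((l1_summable f).mul_right K)
  gcongr; exact hu k

end Synthesis

section Fourier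

variable {d : ℕ}

/-- `ℓ¹(ℤ^d)`. -/
abbrev L1 (d : ℕ) : Type := lp (fun _ : Fin d → ℤ => ℂ) 1

/-- The character `n ↦ e^{2π i n·ξ}`. -/
noncomputable def chr (n : Fin d → ℤ) (ξ : Fin d → ℝ) : ℂ :=
  Complex.exp (2 * Real.pi * Complex.I * ∑ j, (n j : ℂ) * (ξ j : ℂ))

theorem chr_eq (n : Fin d → ℤ) (ξ : Fin d → ℝ) :
    chr n ξ = Complex.exp ((2 * Real.pi * ∑ j, (n j : ℝ) * ξ j : ℝ) * Complex.I) := by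
  rw [chr]; congr 1; push_cast; ring

theorem norm_chr (n : Fin d → ℤ) (ξ : Fin d → ℝ) : ‖chr n ξ‖ = 1 := by
  rw [chr_eq, Complex.norm_exp_ofReal_mul_I]

theorem chr_add (m n : Fin d → ℤ) (ξ : Fin d → ℝ) : chr (m + n) ξ = chr m ξ * chr n ξ := by
  rw [chr, chr, chr, ← Complex.exp_add, ← mul_add, ← Finset.sum_add_distrib]
  simp [add_mul]

theorem chr_zero (ξ : Fin d → ℝ) : chr 0 ξ = 1 := by simp [chr]

theorem chr_neg (n : Fin d → ℤ) (ξ : Fin d → ℝ) :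
    chr (-n) ξ = Complex.exp (-(2 * Real.pi * Complex.I) * ∑ j, (n j : ℂ) * (ξ j : ℂ)) := by
  rw [chr]; congr 1; simp

theorem continuous_chr (n : Fin d → ℤ) : Continuous (chr n) := by
  unfold chr; fun_prop

theorem integral_exp_unit (k : ℤ) :
    ∫ x : ℝ in Set.Icc (-(1 : ℝ) / 2) (1 / 2), Complex.exp (2 * Real.pi * Complex.I * (k * x)) =
      if k = 0 then 1 else 0 := by
  rw [integral_Icc_eq_integral_Ioc, ← intervalIntegral.integral_of_le (by norm_num)]
  split_ifs with h
  · simp [h]; norm_num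
  · have hc : 2 * Real.pi * Complex.I * (k : ℂ) ≠ 0 := by
      simp [Real.pi_ne_zero, h]
    simp only [← mul_assoc]
    rw [integral_exp_mul_complex hc, div_eq_zero_iff]
    left
    rw [sub_eq_zero, Complex.exp_eq_exp_iff_exists_int]
    exact ⟨k, by push_cast; ring⟩

instance : IsFiniteMeasure ((volume : Measure (Fin d → ℝ)).restrict (Td d)) := by
  refine ⟨?_⟩
  rw [Measure.restrict_apply_univ]
  exact (isCompact_univ_pi fun _ => isCompact_Icc).measure_lt_top

theorem integral_chr (m : Fin d → ℤ) :
    ∫ ξ in Td d, chr m ξ = if m = 0 then 1 else 0 := by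
  have h1 : ∀ ξ : Fin d → ℝ, chr m ξ =
      ∏ j, Complex.exp (2 * Real.pi * Complex.I * ((m j : ℂ) * (ξ j : ℂ))) := fun ξ => by
    rw [chr, Finset.mul_sum, Complex.exp_sum]
  simp only [h1, Td, volume_pi]
  rw [Measure.restrict_pi_pi, integral_fintype_prod_eq_prod (𝕜 := ℂ)
    (f := fun j (x : ℝ) => Complex.exp (2 * Real.pi * Complex.I * ((m j : ℂ) * (x : ℂ))))]
  simp only [integral_exp_unit]
  rw [Finset.prod_ite_zero]
  simp [funext_iff]

/-- The value at `ξ` of the Fourier transform, as a functional on `ℓ¹`. -/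
noncomputable def fourierAt (ξ : Fin d → ℝ) : L1 d →L[ℂ] ℂ :=
  synth (fun n => chr n ξ) (K := 1) fun n => (norm_chr n ξ).le

theorem fourierAt_unitSeq (ξ : Fin d → ℝ) (k : Fin d → ℤ) :
    fourierAt ξ (unitSeq k) = chr k ξ := synth_unitSeq _ _ k

theorem fourier_inversion (f : L1 d) (n : Fin d → ℤ) :
    ∫ ξ in Td d, fourierAt ξ f * chr (-n) ξ = f n := by
  have h := hasSum_integral_of_summable_integral_norm (μ := volume.restrict (Td d))
    (F := fun (k : Fin d → ℤ) ξ => f k * chr (k - n) ξ) ?_ ?_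
  · have h2 : ∀ ξ, ∑' k, f k * chr (k - n) ξ = fourierAt ξ f * chr (-n) ξ := fun ξ => by
      rw [fourierAt, synth_apply, ← tsum_mul_right]
      simp only [sub_eq_add_neg, chr_add, smul_eq_mul, mul_assoc]
    simp only [h2] at h
    rw [← h.tsum_eq, tsum_eq_single n]
    · rw [integral_const_mul, integral_chr]; simp
    · intro k hk
      rw [integral_const_mul, integral_chr]; simp [sub_eq_zero, hk]
  · intro k
    refine Integrable.mono' (integrable_const ‖f k‖)
      (continuous_const.mul (continuous_chr _)).aestronglyMeasurable
      (Filter.Eventually.of_forall fun ξ => ?_)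
    rw [norm_mul, norm_chr, mul_one]
  · simp only [norm_mul, norm_chr, mul_one, integral_const, smul_eq_mul]
    exact (l1_summable f).mul_left _

theorem fourierAt_injective {f g : L1 d} (h : ∀ ξ, fourierAt ξ f = fourierAt ξ g) : f = g := by
  ext n
  rw [← fourier_inversion f, ← fourier_inversion g]
  simp only [h]

end Fourier

section Multipliers

variable (d : ℕ)

/-- The algebra of Fourier multipliers that are bounded on `ℓ¹(ℤ^d)`. -/
noncomputable def multiplierSubalgebra : Subalgebra ℂ (L1 d →L[ℂ] L1 d) where
  carrier := {X | ∀ ξ f, fourierAt ξ (X f) = fourierAt ξ (X (unitSeq 0)) * fourierAt ξ f}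
  mul_mem' := by
    intro X Y hX hY ξ f
    rw [mul_apply_eq_comp, mul_apply_eq_comp, hX, hY,
      hX ξ (Y (unitSeq 0)), mul_assoc]
  add_mem' := by
    intro X Y hX hY ξ f
    rw [add_apply, add_apply, map_add, map_add, hX, hY]
    ring
  algebraMap_mem' := by
    intro c ξ f
    simp [Algebra.algebraMap_eq_smul_one, fourierAt_unitSeq, chr_zero]

theorem isClosed_multiplierSubalgebra :
    IsClosed (multiplierSubalgebra d : Set (L1 d →L[ℂ] L1 d)) := by
  have : (multiplierSubalgebra d : Set (L1 d →L[ℂ] L1 d)) = ⋂ ξ, ⋂ f,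
      {X | fourierAt ξ (X f) = fourierAt ξ (X (unitSeq 0)) * fourierAt ξ f} := by
    ext X; simp only [Set.mem_iInter]; rfl
  rw [this]
  refine isClosed_iInter fun ξ => isClosed_iInter fun f => isClosed_eq ?_ ?_
  · exact (fourierAt ξ).continuous.comp (ContinuousLinearMap.apply ℂ (L1 d) f).continuous
  · exact ((fourierAt ξ).continuous.comp
      (ContinuousLinearMap.apply ℂ (L1 d) (unitSeq 0)).continuous).mul continuous_const

/-- The algebra of Fourier multipliers that are bounded on `ℓ¹(ℤ^d)`, as a type. -/
def Multiplier : Type := multiplierSubalgebra d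

variable {d}

theorem multiplierSubalgebra_mul_comm (X Y : multiplierSubalgebra d) : X * Y = Y * X := by
  refine Subtype.ext (ContinuousLinearMap.ext fun f => fourierAt_injective fun ξ => ?_)
  change fourierAt ξ (X.1 (Y.1 f)) = fourierAt ξ (Y.1 (X.1 f))
  rw [X.2 ξ (Y.1 f), Y.2 ξ f, Y.2 ξ (X.1 f), X.2 ξ f, mul_left_comm]

variable (d) in
/-- The normed ring structure on multipliers, given by composition and the operator norm. -/
noncomputable def multiplierRing : NormedCommRing (Multiplier d) :=
  { (inferInstance : NormedRing (multiplierSubalgebra d)) with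
    mul_comm := multiplierSubalgebra_mul_comm }

noncomputable instance : NormedCommRing (Multiplier d) := multiplierRing d

noncomputable instance : NormedAlgebra ℂ (Multiplier d) :=
  { (inferInstance : Algebra ℂ (multiplierSubalgebra d)) with
    norm_smul_le := fun c X => norm_smul_le c X.1 }

instance : CompleteSpace (Multiplier d) :=
  (isClosed_multiplierSubalgebra d).completeSpace_coe

instance : NormOneClass (Multiplier d) :=
  ⟨by
    refine le_antisymm ContinuousLinearMap.norm_id_le ?_
    have := ContinuousLinearMap.le_opNorm (ContinuousLinearMap.id ℂ (L1 d)) (unitSeq 0)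
    rw [norm_unitSeq, mul_one, ContinuousLinearMap.id_apply, norm_unitSeq] at this
    exact this⟩

/-- The symbol of a multiplier. -/
noncomputable def symbol (ξ : Fin d → ℝ) (X : Multiplier d) : ℂ :=
  fourierAt ξ (X.1 (unitSeq 0))

theorem fourierAt_multiplier (X : Multiplier d) (ξ : Fin d → ℝ) (f : L1 d) :
    fourierAt ξ (X.1 f) = symbol ξ X * fourierAt ξ f := X.2 ξ f

theorem multiplier_ext {X Y : Multiplier d} (h : ∀ ξ, symbol ξ X = symbol ξ Y) : X = Y := by
  refine Subtype.ext (ContinuousLinearMap.ext fun f => fourierAt_injective fun ξ => ?_)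
  rw [fourierAt_multiplier, fourierAt_multiplier, h]

theorem symbol_mul (ξ : Fin d → ℝ) (X Y : Multiplier d) :
    symbol ξ (X * Y) = symbol ξ X * symbol ξ Y := fourierAt_multiplier X ξ _

/-- The symbol at `ξ`, as a character. -/
noncomputable def symbolHom (ξ : Fin d → ℝ) : Multiplier d →ₐ[ℂ] ℂ where
  toFun := symbol ξ
  map_one' := by
    change fourierAt ξ (unitSeq 0) = 1
    rw [fourierAt_unitSeq, chr_zero]
  map_mul' := symbol_mul ξ
  map_zero' := map_zero (fourierAt ξ)
  map_add' := fun X Y => map_add (fourierAt ξ) _ _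
  commutes' := fun c => by
    change fourierAt ξ (c • unitSeq 0) = c
    rw [map_smul, fourierAt_unitSeq, chr_zero, smul_eq_mul, mul_one]

theorem continuous_symbol (ξ : Fin d → ℝ) : Continuous (symbol ξ : Multiplier d → ℂ) :=
  (fourierAt ξ).continuous.comp
    ((ContinuousLinearMap.apply ℂ (L1 d) (unitSeq 0)).continuous.comp continuous_subtype_val)

/-- The symbol at `ξ`, as a bounded functional. -/
noncomputable def symbolCLM (ξ : Fin d → ℝ) : Multiplier d →L[ℂ] ℂ where
  toFun := symbol ξ
  map_add' := map_add (symbolHom ξ)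
  map_smul' := map_smul (symbolHom ξ)
  cont := continuous_symbol ξ

/-- Translation by `k` on `ℓ¹`. -/
noncomputable def translateL1 (k : Fin d → ℤ) : L1 d →L[ℂ] L1 d :=
  synth (fun m => unitSeq (m + k)) (K := 1) fun _ => (norm_unitSeq _).le

theorem fourierAt_translateL1 (k : Fin d → ℤ) (ξ : Fin d → ℝ) (f : L1 d) :
    fourierAt ξ (translateL1 k f) = chr k ξ * fourierAt ξ f := by
  have : fourierAt ξ ∘L translateL1 k = chr k ξ • fourierAt ξ := l1_clm_ext fun m => by
    simp [translateL1, synth_unitSeq, fourierAt_unitSeq, chr_add, mul_comm]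
  exact DFunLike.congr_fun this f

theorem translateL1_apply (k : Fin d → ℤ) (f : L1 d) (n : Fin d → ℤ) :
    translateL1 k f n = f (n - k) := by
  have : lp.evalCLM ℂ (fun _ : Fin d → ℤ => ℂ) 1 n ∘L translateL1 k =
      lp.evalCLM ℂ (fun _ : Fin d → ℤ => ℂ) 1 (n - k) := l1_clm_ext fun m => by
    change (translateL1 k (unitSeq m)) n = (unitSeq m : L1 d) (n - k)
    rw [translateL1, synth_unitSeq, unitSeq_apply, unitSeq_apply]
    simp only [sub_eq_iff_eq_add]
  exact DFunLike.congr_fun this f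

/-- Translation by `k`, as a multiplier. -/
noncomputable def translate (k : Fin d → ℤ) : Multiplier d :=
  ⟨translateL1 k, fun ξ f => by
    rw [fourierAt_translateL1, fourierAt_translateL1, fourierAt_unitSeq, chr_zero, mul_one]⟩

theorem symbol_translate (k : Fin d → ℤ) (ξ : Fin d → ℝ) : symbol ξ (translate k) = chr k ξ := by
  rw [symbol, translate, fourierAt_translateL1, fourierAt_unitSeq, chr_zero, mul_one]

theorem norm_translate_le (k : Fin d → ℤ) : ‖translate k‖ ≤ 1 :=
  norm_synth_le (fun m => unitSeq (m + k)) fun _ => (norm_unitSeq _).le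

theorem translate_add (k l : Fin d → ℤ) : translate (k + l) = translate k * translate l :=
  multiplier_ext fun ξ => by simp only [symbol_mul, symbol_translate, chr_add]

theorem translate_zero : translate (0 : Fin d → ℤ) = 1 :=
  multiplier_ext fun ξ => by
    rw [symbol_translate, chr_zero]; exact (map_one (symbolHom ξ)).symm

/-- A multiplier is a superposition of translations. -/
theorem multiplier_eq_synth (X : Multiplier d) :
    X = synth translate norm_translate_le (X.1 (unitSeq 0)) := by
  refine multiplier_ext fun ξ => ?_
  have h : symbolCLM ξ ∘L
      synth translate norm_translate_le = fourierAt ξ := l1_clm_ext fun k => by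
    change symbol ξ (synth translate norm_translate_le (unitSeq k)) = _
    rw [synth_unitSeq, symbol_translate, fourierAt_unitSeq]
  exact (DFunLike.congr_fun h (X.1 (unitSeq 0))).symm

end Multipliers


section Laplacian

variable {d : ℕ}

/-- The `2 * d` unit vectors, with signs, of `ℤ^d`. -/
def dirVec (i : Fin d × Bool) : Fin d → ℤ := Pi.single i.1 (if i.2 then 1 else -1)

variable (d) in
/-- The discrete Laplacian, as a multiplier. -/
noncomputable def lap : Multiplier d := ∑ i : Fin d × Bool, (translate (dirVec i) - 1)

theorem norm_heat_lap_le {t : ℝ} (ht : 0 ≤ t) : ‖heat (lap d) t‖ ≤ 1 :=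
  norm_exp_smul_sum_sub_one_le _ (fun i => norm_translate_le (dirVec i)) ht

theorem norm_translate_dirVec_sub_one_mul_heat_le (i : Fin d × Bool) {t : ℝ} (ht : 0 < t) :
    ‖(translate (dirVec i) - 1) * heat (lap d) t‖ ≤ 1 / √t :=
  norm_sub_one_mul_exp_sum_le (fun i => norm_translate_le (dirVec i)) (Finset.mem_univ i) ht

theorem lap_eq : lap d = -∑ j : Fin d,
    (translate (dirVec (j, true)) - 1) * (translate (dirVec (j, false)) - 1) := by
  rw [lap, Fintype.sum_prod_type, ← Finset.sum_neg_distrib]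
  refine Finset.sum_congr rfl fun j _ => ?_
  have h : translate (dirVec (j, true)) * translate (dirVec (j, false)) = (1 : Multiplier d) := by
    rw [← translate_add, ← translate_zero]
    congr 1
    simp [dirVec, ← Pi.single_add]
  rw [Fintype.sum_bool]
  linear_combination h

theorem isSmoothing_lap : IsSmoothing (lap d) (2 * d) where
  norm_heat_le := fun t ht => norm_heat_lap_le ht
  norm_mul_heat_le := fun t ht => by
    have ht2 : 0 < t / 2 := by positivity
    have h1 := heat_add (lap d) (t / 2) (t / 2)
    rw [add_halves] at h1
    have h2 : lap d * heat (lap d) t = -∑ j : Fin d,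
        ((translate (dirVec (j, true)) - 1) * heat (lap d) (t / 2)) *
          ((translate (dirVec (j, false)) - 1) * heat (lap d) (t / 2)) := by
      rw [h1]
      nth_rewrite 1 [lap_eq]
      rw [neg_mul, Finset.sum_mul]
      congr 1
      exact Finset.sum_congr rfl fun j _ => by ring
    rw [h2, norm_neg]
    calc _ ≤ ∑ j : Fin d, 1 / √(t / 2) * (1 / √(t / 2)) := by
          refine norm_sum_le_of_le _ fun j _ => (norm_mul_le _ _).trans ?_
          gcongr <;> exact norm_translate_dirVec_sub_one_mul_heat_le _ ht2
      _ = 2 * d / t := by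
          rw [Finset.sum_const, Finset.card_univ, Fintype.card_fin, nsmul_eq_mul,
            div_mul_div_comm, Real.mul_self_sqrt ht2.le]
          field_simp

theorem symbol_lap (ξ : Fin d → ℝ) : symbolHom ξ (lap d) = -((SinD d ξ ^ 2 : ℝ) : ℂ) := by
  have h0 : 0 ≤ 4 * ∑ j, Real.sin (Real.pi * ξ j) ^ 2 := by positivity
  rw [SinD, Real.sq_sqrt h0, lap, map_sum, Fintype.sum_prod_type]
  push_cast
  rw [Finset.mul_sum, ← Finset.sum_neg_distrib]
  refine Finset.sum_congr rfl fun j _ => ?_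
  rw [Fintype.sum_bool, map_sub, map_sub, map_one]
  change (symbol ξ (translate (dirVec (j, true))) - 1) +
    (symbol ξ (translate (dirVec (j, false))) - 1) = _
  rw [symbol_translate, symbol_translate, chr, chr]
  have h : ∀ c : ℤ, ∑ k, ((Pi.single j c : Fin d → ℤ) k : ℂ) * (ξ k : ℂ) = c * ξ j := fun c => by
    rw [Finset.sum_eq_single j]
    · simp
    · intro k _ hk; simp [hk]
    · simp
  simp only [dirVec, h, if_true, Bool.false_eq_true, if_false]
  have h1 := Complex.cos_sq' (Real.pi * ξ j)
  have h2 := Complex.cos_two_mul (Real.pi * ξ j)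
  have h3 := Complex.two_cos (2 * (Real.pi * ξ j))
  rw [show 2 * Real.pi * Complex.I * ((1 : ℤ) * (ξ j : ℂ)) = 2 * (Real.pi * ξ j) * Complex.I by
    push_cast; ring, show 2 * Real.pi * Complex.I * ((-1 : ℤ) * (ξ j : ℂ)) =
    -(2 * (Real.pi * ξ j)) * Complex.I by push_cast; ring]
  linear_combination -h3 + 2 * h2 + 4 * h1

theorem SinD_nonneg (ξ : Fin d → ℝ) : 0 ≤ SinD d ξ := Real.sqrt_nonneg _

theorem symbol_fracPow_lap {σ : ℝ} (hσ : 0 < σ) (hσ1 : σ < 1) (ξ : Fin d → ℝ) :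
    symbol ξ (fracPow (lap d) σ) = ((SinD d ξ ^ (2 * σ) : ℝ) : ℂ) := by
  have := isSmoothing_lap.map_fracPow hσ hσ1 ((symbolHom ξ).restrictScalars ℝ)
    (continuous_symbol ξ) (sq_nonneg (SinD d ξ)) (symbol_lap ξ)
  rw [Real.rpow_mul (SinD_nonneg ξ), Real.rpow_two]
  exact this

theorem fracPow_lap_mul {σ : ℝ} (hσ : 0 < σ) (hσ1 : σ < 1) :
    fracPow (lap d) σ * fracPow (lap d) (1 - σ) = -lap d := by
  refine multiplier_ext fun ξ => ?_
  have h1 : symbol ξ (-lap d) = ((SinD d ξ ^ 2 : ℝ) : ℂ) :=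
    (map_neg (symbolHom ξ) _).trans (by rw [symbol_lap, neg_neg])
  rw [symbol_mul, symbol_fracPow_lap hσ hσ1, symbol_fracPow_lap (by linarith) (by linarith), h1,
    ← Complex.ofReal_mul]
  congr 1
  rw [Real.rpow_mul (SinD_nonneg ξ), Real.rpow_mul (SinD_nonneg ξ), Real.rpow_two,
    ← Real.rpow_add' (sq_nonneg _) (by norm_num)]
  simp

theorem symbol_fracPow_lap_pow {σ : ℝ} (hσ : 0 < σ) (hσ1 : σ < 1) (M : ℕ) (ξ : Fin d → ℝ) :
    symbol ξ (fracPow (lap d) σ ^ M) = ((SinD d ξ ^ (2 * (M * σ)) : ℝ) : ℂ) := by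
  have : symbol ξ (fracPow (lap d) σ ^ M) = symbol ξ (fracPow (lap d) σ) ^ M :=
    map_pow (symbolHom ξ) _ M
  rw [this, symbol_fracPow_lap hσ hσ1, ← Complex.ofReal_pow, ← Real.rpow_natCast,
    ← Real.rpow_mul (SinD_nonneg ξ)]
  congr 2; ring

/-- The powers of the multiplier `(-Δ) ^ σ` represent the fractional Laplacian. -/
theorem fracLapZ_eq {σ : ℝ} (hσ : 0 < σ) (hσ1 : σ < 1) (M : ℕ) (f : L1 d) :
    fracLapZ d (M * σ) f = (fracPow (lap d) σ ^ M).1 f := by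
  ext n
  rw [← fourier_inversion, fracLapZ]
  simp only [fourierAt_multiplier, symbol_fracPow_lap_pow hσ hσ1, chr_neg]
  rfl

/-- The difference operator `1 - τ_m`. -/
noncomputable def diffOp (m : Fin d → ℤ) : Multiplier d := 1 - translate m

/-- The `ℓ¹` length of a lattice vector. -/
noncomputable def len (m : Fin d → ℤ) : ℝ := ∑ j, |(m j : ℝ)|

theorem len_nonneg (m : Fin d → ℤ) : 0 ≤ len m := Finset.sum_nonneg fun _ _ => abs_nonneg _

theorem norm_diffOp_le (m : Fin d → ℤ) : ‖diffOp m‖ ≤ 2 :=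
  (norm_sub_le _ _).trans (by rw [norm_one]; linarith [norm_translate_le m])

theorem norm_diffOp_add_mul_le (m k : Fin d → ℤ) (b : Multiplier d) :
    ‖diffOp (m + k) * b‖ ≤ ‖diffOp m * b‖ + ‖diffOp k * b‖ := by
  have : diffOp (m + k) * b = diffOp m * b + translate m * (diffOp k * b) := by
    rw [diffOp, diffOp, diffOp, translate_add]; ring
  rw [this]
  refine (norm_add_le _ _).trans (add_le_add_right ?_ _)
  exact (norm_mul_le _ _).trans (mul_le_of_le_one_left (norm_nonneg _) (norm_translate_le m))

theorem norm_diffOp_sum_mul_le {ι : Type*} (F : Finset ι) (m : ι → Fin d → ℤ) (b : Multiplier d) :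
    ‖diffOp (∑ i ∈ F, m i) * b‖ ≤ ∑ i ∈ F, ‖diffOp (m i) * b‖ := by
  classical
  induction F using Finset.induction_on with
  | empty => simp [diffOp, translate_zero]
  | insert i F hi ih =>
    rw [Finset.sum_insert hi, Finset.sum_insert hi]
    exact (norm_diffOp_add_mul_le _ _ _).trans (by gcongr)

theorem norm_diffOp_mul_heat_le (m : Fin d → ℤ) {t : ℝ} (ht : 0 < t) :
    ‖diffOp m * heat (lap d) t‖ ≤ len m * (1 / √t) := by
  have h1 : ∀ j, ‖diffOp (Pi.single j (m j)) * heat (lap d) t‖ ≤ |(m j : ℝ)| * (1 / √t) := by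
    intro j
    obtain ⟨b, hb⟩ : ∃ b : Bool, m j = (m j).natAbs * (if b then 1 else -1) := by
      rcases Int.natAbs_eq (m j) with h | h
      · exact ⟨true, by simpa using h⟩
      · exact ⟨false, by simpa using h⟩
    have h2 : (Pi.single j (m j) : Fin d → ℤ) =
        ∑ _i ∈ Finset.range (m j).natAbs, dirVec (j, b) := by
      rw [Finset.sum_const, Finset.card_range, dirVec, ← Pi.single_smul, nsmul_eq_mul]
      nth_rewrite 1 [hb]; rfl
    rw [h2]
    refine (norm_diffOp_sum_mul_le _ _ _).trans ?_
    rw [Finset.sum_const, Finset.card_range, nsmul_eq_mul, ← Int.cast_abs, Int.abs_eq_natAbs,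
      Int.cast_natCast]
    gcongr
    rw [diffOp, ← neg_sub, neg_mul, norm_neg]
    exact norm_translate_dirVec_sub_one_mul_heat_le _ ht
  rw [len, Finset.sum_mul]
  nth_rewrite 1 [← Finset.univ_sum_single m]
  exact (norm_diffOp_sum_mul_le _ _ _).trans (Finset.sum_le_sum fun j _ => h1 j)

end Laplacian


section HeatKernel

variable {d : ℕ}

theorem symbol_heat_lap (t : ℝ) (ξ : Fin d → ℝ) :
    symbol ξ (heat (lap d) t) = ((Real.exp (-(t * SinD d ξ ^ 2)) : ℝ) : ℂ) := by
  let : NormedAlgebra ℚ (Multiplier d) := NormedAlgebra.restrictScalars ℚ ℝ _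
  change (symbolHom ξ).restrictScalars ℝ (heat (lap d) t) = _
  rw [heat, NormedSpace.map_exp _ (show Continuous ((symbolHom ξ).restrictScalars ℝ) from
    continuous_symbol ξ), map_smul, AlgHom.restrictScalars_apply, symbol_lap,
    ← Complex.exp_eq_exp_ℂ]
  push_cast
  simp

/-- The heat kernel on `ℤ^d`. -/
noncomputable def heatKernel (d : ℕ) (t : ℝ) : L1 d := (heat (lap d) t).1 (unitSeq 0)

theorem norm_heatKernel_le {t : ℝ} (ht : 0 ≤ t) : ‖heatKernel d t‖ ≤ 1 := by
  have := (heat (lap d) t).1.le_opNorm (unitSeq 0)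
  rw [norm_unitSeq, mul_one] at this
  exact this.trans (norm_heat_lap_le ht)

theorem hasSum_heatKernel_chr (t : ℝ) (ξ : Fin d → ℝ) :
    HasSum (fun m => heatKernel d t m * chr m ξ)
      ((Real.exp (-(t * SinD d ξ ^ 2)) : ℝ) : ℂ) := by
  rw [← symbol_heat_lap]
  have := summable_norm_smul (fun n => chr n ξ) (K := 1) (fun n => (norm_chr n ξ).le)
    (heatKernel d t)
  simp only [← norm_smul] at this
  exact this.of_norm.hasSum

theorem hasSum_heatKernel (t : ℝ) : HasSum (heatKernel d t) 1 := by
  have := hasSum_heatKernel_chr t (0 : Fin d → ℝ)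
  have h : ∀ m : Fin d → ℤ, chr m 0 = 1 := fun m => by simp [chr]
  simpa [h, SinD] using this

theorem heatKernel_eq_norm {t : ℝ} (ht : 0 ≤ t) (m : Fin d → ℤ) :
    heatKernel d t m = (‖heatKernel d t m‖ : ℂ) := by
  have h1 : HasSum (fun m => ‖heatKernel d t m‖ - (heatKernel d t m).re) (‖heatKernel d t‖ - 1) := by
    rw [l1_norm_eq]
    refine (l1_summable _).hasSum.sub ?_
    simpa using Complex.hasSum_re (hasSum_heatKernel t)
  have h0 : ∀ m, 0 ≤ ‖heatKernel d t m‖ - (heatKernel d t m).re := fun m =>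
    sub_nonneg.2 (Complex.re_le_norm _)
  have h2 : ‖heatKernel d t m‖ - (heatKernel d t m).re ≤ ‖heatKernel d t‖ - 1 :=
    le_hasSum h1 m fun k _ => h0 k
  have h3 := norm_heatKernel_le (d := d) ht
  have h4 : (heatKernel d t m).re = ‖heatKernel d t m‖ := by linarith [h0 m]
  have h5 := (Complex.re_eq_norm.1 h4)
  rw [Complex.norm_of_nonneg' h5]

theorem hasSum_norm_heatKernel {t : ℝ} (ht : 0 ≤ t) :
    HasSum (fun m => ‖heatKernel d t m‖) 1 := by
  rw [← Complex.hasSum_ofReal]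
  refine (hasSum_heatKernel t).of_eq (fun m => ?_) (by simp)
  exact (heatKernel_eq_norm ht m).symm

theorem sum_heatKernel_mul_sq_le {t : ℝ} (ht : 0 ≤ t) (j : Fin d) (F : Finset (Fin d → ℤ)) :
    ∑ m ∈ F, ‖heatKernel d t m‖ * (m j : ℝ) ^ 2 ≤ π ^ 2 / 2 * t := by
  obtain ⟨x, hx, hxF⟩ : ∃ x : ℝ, 0 < x ∧ ∀ m ∈ F, |2 * π * (m j * x)| ≤ π := by
    refine ⟨(2 * (1 + ∑ m ∈ F, |(m j : ℝ)|))⁻¹, by positivity, fun m hm => ?_⟩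
    have h1 : |(m j : ℝ)| ≤ ∑ m ∈ F, |(m j : ℝ)| :=
      Finset.single_le_sum (f := fun m : Fin d → ℤ => |(m j : ℝ)|) (fun _ _ => abs_nonneg _) hm
    have h2 : 0 < 1 + ∑ m ∈ F, |(m j : ℝ)| := by positivity
    rw [abs_mul, abs_of_pos Real.two_pi_pos, abs_mul,
      abs_of_pos (show 0 < (2 * (1 + ∑ m ∈ F, |(m j : ℝ)|))⁻¹ by positivity), mul_inv]
    have h3 : |(m j : ℝ)| * (1 + ∑ m ∈ F, |(m j : ℝ)|)⁻¹ ≤ 1 := by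
      rw [mul_inv_le_iff₀ h2]; linarith
    calc _ = π * (|(m j : ℝ)| * (1 + ∑ m ∈ F, |(m j : ℝ)|)⁻¹) := by ring
      _ ≤ π := mul_le_of_le_one_right Real.pi_pos.le h3
  have hsum : ∀ m : Fin d → ℤ, ∑ k, (m k : ℝ) * (Pi.single j x : Fin d → ℝ) k = m j * x := fun m => by
    rw [Finset.sum_eq_single j]
    · simp
    · intro k _ hk; simp [hk]
    · simp
  have hS : SinD d (Pi.single j x) ^ 2 = 4 * Real.sin (π * x) ^ 2 := by
    rw [SinD, Real.sq_sqrt (by positivity), Finset.sum_eq_single j]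
    · simp
    · intro k _ hk; simp [hk]
    · simp
  have hcos : ∀ m : Fin d → ℤ, (heatKernel d t m * chr m (Pi.single j x)).re =
      ‖heatKernel d t m‖ * Real.cos (2 * π * (m j * x)) := fun m => by
    rw [heatKernel_eq_norm ht, Complex.re_ofReal_mul, chr_eq, hsum, Complex.exp_ofReal_mul_I_re]
    simp
  have h1 : HasSum (fun m => ‖heatKernel d t m‖ * (1 - Real.cos (2 * π * (m j * x))))
      (1 - Real.exp (-(t * (4 * Real.sin (π * x) ^ 2)))) := by
    have := Complex.hasSum_re (hasSum_heatKernel_chr t (Pi.single j x : Fin d → ℝ))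
    simp only [hcos, hS, Complex.ofReal_re] at this
    exact ((hasSum_norm_heatKernel ht).sub this).of_eq (fun m => by ring) rfl
  have h2 : ∑ m ∈ F, ‖heatKernel d t m‖ * (8 * x ^ 2 * (m j : ℝ) ^ 2) ≤
      4 * π ^ 2 * x ^ 2 * t := by
    calc _ ≤ ∑ m ∈ F, ‖heatKernel d t m‖ * (1 - Real.cos (2 * π * (m j * x))) := by
          refine Finset.sum_le_sum fun m hm => ?_
          gcongr
          have := Real.cos_le_one_sub_mul_cos_sq (hxF m hm)
          have h3 : 2 / π ^ 2 * (2 * π * (m j * x)) ^ 2 = 8 * x ^ 2 * (m j : ℝ) ^ 2 := by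
            field_simp; ring
          linarith
      _ ≤ 1 - Real.exp (-(t * (4 * Real.sin (π * x) ^ 2))) :=
          sum_le_hasSum F (fun m _ => mul_nonneg (norm_nonneg _)
            (sub_nonneg.2 (Real.cos_le_one _))) h1
      _ ≤ t * (4 * Real.sin (π * x) ^ 2) := by
          linarith [Real.add_one_le_exp (-(t * (4 * Real.sin (π * x) ^ 2)))]
      _ ≤ t * (4 * (π * x) ^ 2) := by
          have : Real.sin (π * x) ^ 2 ≤ (π * x) ^ 2 := sq_le_sq.2 Real.abs_sin_le_abs
          gcongr
      _ = _ := by ring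
  have h3 : ∑ m ∈ F, ‖heatKernel d t m‖ * (8 * x ^ 2 * (m j : ℝ) ^ 2) =
      (8 * x ^ 2) * ∑ m ∈ F, ‖heatKernel d t m‖ * (m j : ℝ) ^ 2 := by
    rw [Finset.mul_sum]; exact Finset.sum_congr rfl fun m _ => by ring
  rw [h3] at h2
  have h4 : 0 < 8 * x ^ 2 := by positivity
  refine le_of_mul_le_mul_left (h2.trans_eq ?_) h4
  ring

theorem sum_heatKernel_mul_len_sq_le {t : ℝ} (ht : 0 ≤ t) (F : Finset (Fin d → ℤ)) :
    ∑ m ∈ F, ‖heatKernel d t m‖ * len m ^ 2 ≤ d ^ 2 * (π ^ 2 / 2) * t := by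
  have h : ∀ m : Fin d → ℤ, len m ^ 2 ≤ d * ∑ j, (m j : ℝ) ^ 2 := fun m => by
    have := sq_sum_le_card_mul_sum_sq (s := Finset.univ) (f := fun j => |(m j : ℝ)|)
    simpa [len, sq_abs] using this
  calc _ ≤ ∑ m ∈ F, ‖heatKernel d t m‖ * (d * ∑ j, (m j : ℝ) ^ 2) := by
        gcongr with m _; exact h m
    _ = d * ∑ j, ∑ m ∈ F, ‖heatKernel d t m‖ * (m j : ℝ) ^ 2 := by
        rw [Finset.sum_comm, Finset.mul_sum]
        refine Finset.sum_congr rfl fun m _ => ?_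
        rw [← Finset.mul_sum]; ring
    _ ≤ d * ∑ _j : Fin d, π ^ 2 / 2 * t := by
        gcongr with j _; exact sum_heatKernel_mul_sq_le ht j F
    _ = _ := by simp; ring

/-- Parabolic scaling of the heat kernel, in integrated form. -/
theorem tsum_heatKernel_mul_min_le {κ : ℝ} (hκ : 0 ≤ κ) (hκ1 : κ ≤ 1) {t T : ℝ} (ht : 0 < t)
    (hT : 0 < T) :
    ∑' m, ‖heatKernel d t m‖ * min 1 ((len m ^ 2 / T) ^ κ) ≤
      (1 + d ^ 2 * (π ^ 2 / 2)) * min 1 ((t / T) ^ κ) := by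
  have hs := (hasSum_norm_heatKernel (d := d) ht.le)
  have hC : (1 : ℝ) ≤ 1 + d ^ 2 * (π ^ 2 / 2) := le_add_of_nonneg_right (by positivity)
  have hm0 : ∀ m : Fin d → ℤ, 0 ≤ min 1 ((len m ^ 2 / T) ^ κ) := fun m =>
    le_min zero_le_one (by have := len_nonneg m; positivity)
  refine Real.tsum_le_of_sum_le (fun m => mul_nonneg (norm_nonneg _) (hm0 m)) fun F => ?_
  rw [mul_min_of_nonneg _ _ (by positivity)]
  refine le_min ?_ ?_
  · rw [mul_one]
    refine le_trans ?_ hC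
    calc _ ≤ ∑ m ∈ F, ‖heatKernel d t m‖ := Finset.sum_le_sum fun m _ =>
          mul_le_of_le_one_right (norm_nonneg _) (min_le_left _ _)
      _ ≤ 1 := sum_le_hasSum F (fun m _ => norm_nonneg _) hs
  · have hx : ∀ x : ℝ, 0 ≤ x → x ^ κ ≤ 1 + x := fun x hx => by
      rcases le_total x 1 with h | h
      · linarith [Real.rpow_le_one hx h hκ]
      · have := Real.rpow_le_rpow_of_exponent_le h hκ1
        rw [Real.rpow_one] at this; linarith
    calc _ ≤ ∑ m ∈ F, (t / T) ^ κ * (‖heatKernel d t m‖ + t⁻¹ * (‖heatKernel d t m‖ * len m ^ 2)) := by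
          refine Finset.sum_le_sum fun m _ => ?_
          have h1 : len m ^ 2 / T = (t / T) * (len m ^ 2 / t) := by field_simp
          have h2 := hx (len m ^ 2 / t) (by positivity)
          calc _ ≤ ‖heatKernel d t m‖ * (len m ^ 2 / T) ^ κ := by
                gcongr; exact min_le_right _ _
            _ ≤ ‖heatKernel d t m‖ * ((t / T) ^ κ * (1 + len m ^ 2 / t)) := by
                rw [h1, Real.mul_rpow (by positivity) (by positivity)]
                gcongr
            _ = _ := by field_simp
      _ = (t / T) ^ κ * (∑ m ∈ F, ‖heatKernel d t m‖ +
            t⁻¹ * ∑ m ∈ F, ‖heatKernel d t m‖ * len m ^ 2) := by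
          rw [Finset.mul_sum, ← Finset.sum_add_distrib, Finset.mul_sum]
      _ ≤ (t / T) ^ κ * (1 + t⁻¹ * (d ^ 2 * (π ^ 2 / 2) * t)) := by
          gcongr
          · exact sum_le_hasSum F (fun m _ => norm_nonneg _) hs
          · exact sum_heatKernel_mul_len_sq_le ht.le F
      _ = _ := by field_simp

end HeatKernel


section Norms

variable {d : ℕ}

/-- The inclusion of `ℓ¹(ℤ^d)` in `ℓ^q(ℤ^d)`. -/
noncomputable def toLq (q : ℝ≥0∞) [Fact (1 ≤ q)] : L1 d →L[ℂ] lp (fun _ : Fin d → ℤ => ℂ) q :=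
  synth (fun m => lp.single q m 1) (K := 1) fun m => by
    rw [lp.norm_single (zero_lt_one.trans_le Fact.out)]; simp

variable {q : ℝ≥0∞} [Fact (1 ≤ q)]

theorem toLq_apply (f : L1 d) (n : Fin d → ℤ) : toLq q f n = f n := by
  have : lp.evalCLM ℂ (fun _ : Fin d → ℤ => ℂ) q n ∘L toLq q =
      lp.evalCLM ℂ (fun _ : Fin d → ℤ => ℂ) 1 n := l1_clm_ext fun m => by
    change (toLq q (unitSeq m)) n = (unitSeq m : L1 d) n
    rw [toLq, synth_unitSeq]; rfl
  exact DFunLike.congr_fun this f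

variable (q) in
/-- The `ℓ^q` norm on `ℓ¹(ℤ^d)`. -/
noncomputable def lqNorm (f : L1 d) : ℝ := ‖toLq q f‖

theorem lqNorm_nonneg (f : L1 d) : 0 ≤ lqNorm q f := norm_nonneg _

theorem lqNorm_add_le (f g : L1 d) : lqNorm q (f + g) ≤ lqNorm q f + lqNorm q g := by
  rw [lqNorm, map_add]; exact norm_add_le _ _

theorem toReal_pos_of_one_le (hq : q ≠ ∞) : 0 < q.toReal :=
  ENNReal.toReal_pos (zero_lt_one.trans_le (Fact.out : 1 ≤ q)).ne' hq

theorem lqNorm_eq_tsum (hq : q ≠ ∞) (f : L1 d) :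
    lqNorm q f = (∑' n, ‖f n‖ ^ q.toReal) ^ (1 / q.toReal) := by
  rw [lqNorm, lp.norm_eq_tsum_rpow (toReal_pos_of_one_le hq)]
  simp only [toLq_apply]

theorem lpN_eq_ofReal_lqNorm (hq : q ≠ ∞) (f : L1 d) :
    lpN d q.toReal f = ENNReal.ofReal (lqNorm q f) := by
  have hq0 := toReal_pos_of_one_le hq
  have hs : Summable fun n => ‖f n‖ ^ q.toReal := by
    simpa only [toLq_apply] using (lp.memℓp (toLq q f)).summable hq0
  have h0 : ∀ n, 0 ≤ ‖f n‖ ^ q.toReal := fun n => by positivity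
  rw [lpN, lqNorm_eq_tsum hq, ← ENNReal.ofReal_rpow_of_nonneg (tsum_nonneg h0) (by positivity),
    ENNReal.ofReal_tsum_of_nonneg h0 hs]
  congr 2
  ext n
  rw [← ENNReal.ofReal_rpow_of_nonneg (norm_nonneg _) hq0.le, ofReal_norm]
  rfl

theorem lqNorm_translateL1 (hq : q ≠ ∞) (k : Fin d → ℤ) (f : L1 d) :
    lqNorm q (translateL1 k f) = lqNorm q f := by
  rw [lqNorm_eq_tsum hq, lqNorm_eq_tsum hq,
    ← (Equiv.subRight k).tsum_eq (fun n => ‖f n‖ ^ q.toReal)]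
  simp only [translateL1_apply, Equiv.subRight_apply]

/-- Evaluation of multipliers at a sequence. -/
noncomputable def evalMultiplier (f : L1 d) : Multiplier d →L[ℂ] L1 d where
  toFun := fun X => X.1 f
  map_add' := fun _ _ => rfl
  map_smul' := fun _ _ => rfl
  cont := (ContinuousLinearMap.apply ℂ (L1 d) f).continuous.comp continuous_subtype_val

theorem evalMultiplier_mul (X Y : Multiplier d) (f : L1 d) :
    evalMultiplier f (X * Y) = evalMultiplier (evalMultiplier f Y) X := rfl

/-- Multipliers bounded on `ℓ¹` are bounded on `ℓ^q`. -/
theorem lqNorm_evalMultiplier_le (hq : q ≠ ∞) (X : Multiplier d) (f : L1 d) :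
    lqNorm q (evalMultiplier f X) ≤ ‖X‖ * lqNorm q f := by
  have hK : ∀ k : Fin d → ℤ, ‖toLq q (translateL1 k f)‖ ≤ lqNorm q f :=
    fun k => (lqNorm_translateL1 hq k f).le
  have h : toLq q ∘L evalMultiplier f ∘L synth translate norm_translate_le =
      synth (fun k => toLq q (translateL1 k f)) hK := l1_clm_ext fun k => by
    rw [synth_unitSeq]
    change toLq q (evalMultiplier f (synth translate norm_translate_le (unitSeq k))) = _
    rw [synth_unitSeq]; rfl
  have h1 := DFunLike.congr_fun h (X.1 (unitSeq 0))
  change toLq q (evalMultiplier f (synth translate norm_translate_le (X.1 (unitSeq 0)))) = _ at h1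
  rw [← multiplier_eq_synth] at h1
  have h2 := X.1.le_opNorm (unitSeq 0)
  rw [norm_unitSeq, mul_one] at h2
  rw [lqNorm, h1, mul_comm]
  refine (ContinuousLinearMap.le_opNorm _ _).trans ?_
  exact mul_le_mul (norm_synth_le _ hK) h2 (norm_nonneg _) (lqNorm_nonneg f)

/-- The pointwise product on `ℓ¹(ℤ^d)`. -/
noncomputable def mulL1 : L1 d →L[ℂ] L1 d →L[ℂ] L1 d :=
  synth (fun m => (lp.evalCLM ℂ (fun _ : Fin d → ℤ => ℂ) 1 m).smulRight (unitSeq m)) (K := 1)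
    fun m => ContinuousLinearMap.opNorm_le_bound _ zero_le_one fun f => by
      rw [ContinuousLinearMap.smulRight_apply, norm_smul, norm_unitSeq, mul_one, one_mul]
      exact lp.norm_apply_le_norm one_ne_zero f m

theorem mulL1_apply (f g : L1 d) (n : Fin d → ℤ) : mulL1 f g n = f n * g n := by
  have : lp.evalCLM ℂ (fun _ : Fin d → ℤ => ℂ) 1 n ∘L mulL1.flip g =
      g n • lp.evalCLM ℂ (fun _ : Fin d → ℤ => ℂ) 1 n := l1_clm_ext fun m => by
    change (mulL1 (unitSeq m) g) n = g n * (unitSeq m : L1 d) n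
    rw [mulL1, synth_unitSeq]
    change g m * (unitSeq m : L1 d) n = _
    rw [unitSeq_apply]
    split_ifs with h
    · rw [h]
    · simp
  rw [mul_comm]
  exact DFunLike.congr_fun this f

theorem lqNorm_mulL1_le {p p₁ p₂ : ℝ≥0∞} [Fact (1 ≤ p)] [Fact (1 ≤ p₁)] [Fact (1 ≤ p₂)]
    [p₁.HolderTriple p₂ p] (f g : L1 d) :
    lqNorm p (mulL1 f g) ≤ lqNorm p₁ f * lqNorm p₂ g := by
  have hK : ∀ _ : Fin d → ℤ, ‖ContinuousLinearMap.mul ℂ ℂ‖ ≤ ((1 : ℝ≥0) : ℝ) := fun _ =>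
    ContinuousLinearMap.opNorm_mul_le ℂ ℂ
  have h : toLq p (mulL1 f g) = lp.holderL p (fun _ => ContinuousLinearMap.mul ℂ ℂ) hK
      (toLq p₁ f) (toLq p₂ g) := by
    ext n
    rw [toLq_apply, mulL1_apply]
    change _ = toLq p₁ f n * toLq p₂ g n
    rw [toLq_apply, toLq_apply]
  rw [lqNorm, h]
  refine (ContinuousLinearMap.le_opNorm₂ _ _ _).trans ?_
  have h1 := lp.norm_holderL_le (p := p₁) (q := p₂) p (fun _ => ContinuousLinearMap.mul ℂ ℂ) hK
  rw [NNReal.coe_one] at h1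
  calc _ ≤ 1 * ‖toLq p₁ f‖ * ‖toLq p₂ g‖ := by gcongr
    _ = _ := by rw [one_mul]; rfl

/-- The carré du champ form of a multiplier. -/
noncomputable def carre (f g : L1 d) : Multiplier d →L[ℂ] L1 d :=
  mulL1.flip g ∘L evalMultiplier f + mulL1 f ∘L evalMultiplier g - evalMultiplier (mulL1 f g)

theorem carre_apply (f g : L1 d) (X : Multiplier d) :
    carre f g X = mulL1 (evalMultiplier f X) g + mulL1 f (evalMultiplier g X) -
      evalMultiplier (mulL1 f g) X := rfl

theorem evalMultiplier_diffOp (m : Fin d → ℤ) (f : L1 d) :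
    evalMultiplier f (diffOp m) = f - translateL1 m f := rfl

theorem carre_diffOp (f g : L1 d) (m : Fin d → ℤ) :
    carre f g (diffOp m) =
      mulL1 (evalMultiplier f (diffOp m)) (evalMultiplier g (diffOp m)) := by
  rw [carre_apply]
  simp only [evalMultiplier_diffOp]
  ext n
  simp only [lp.coeFn_sub, lp.coeFn_add, Pi.sub_apply, Pi.add_apply, mulL1_apply,
    translateL1_apply]
  ring

theorem one_sub_heat_eq_synth (t : ℝ) :
    1 - heat (lap d) t = synth diffOp norm_diffOp_le (heatKernel d t) := by
  refine multiplier_ext fun ξ => ?_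
  have h : symbolCLM ξ ∘L synth diffOp norm_diffOp_le =
      fourierAt 0 - symbolCLM ξ ∘L synth translate norm_translate_le := l1_clm_ext fun k => by
    change symbol ξ (synth diffOp norm_diffOp_le (unitSeq k)) =
      fourierAt 0 (unitSeq k) - symbol ξ (synth translate norm_translate_le (unitSeq k))
    rw [synth_unitSeq, synth_unitSeq, fourierAt_unitSeq]
    have h1 : chr k 0 = symbolHom ξ (1 : Multiplier d) := by simp [chr]
    rw [h1]
    exact map_sub (symbolHom ξ) _ _
  have h1 := DFunLike.congr_fun h (heatKernel d t)
  have h2 : fourierAt 0 (heatKernel d t) = 1 := by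
    change symbol 0 (heat (lap d) t) = 1
    rw [symbol_heat_lap]; simp [SinD]
  change symbol ξ (synth diffOp norm_diffOp_le _) = fourierAt 0 (heatKernel d t) -
    symbol ξ (synth translate norm_translate_le ((heat (lap d) t).1 (unitSeq 0))) at h1
  rw [h1, h2, ← multiplier_eq_synth, ← map_one (symbolHom ξ)]
  exact map_sub (symbolHom ξ) _ _

theorem norm_map_one_sub_heat_le {X : Type*} [NormedAddCommGroup X] [NormedSpace ℂ X]
    [CompleteSpace X] (φ : Multiplier d →L[ℂ] X) (t : ℝ) :
    ‖φ (1 - heat (lap d) t)‖ ≤ ∑' m, ‖heatKernel d t m‖ * ‖φ (diffOp m)‖ := by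
  have hK : ∀ m, ‖φ (diffOp m)‖ ≤ ‖φ‖ * 2 := fun m =>
    (φ.le_opNorm _).trans (by gcongr; exact norm_diffOp_le m)
  have h : φ ∘L synth diffOp norm_diffOp_le = synth (fun m => φ (diffOp m)) hK :=
    l1_clm_ext fun k => by
      change φ (synth diffOp norm_diffOp_le (unitSeq k)) = _
      rw [synth_unitSeq, synth_unitSeq]
  rw [one_sub_heat_eq_synth]
  change ‖(φ ∘L synth diffOp norm_diffOp_le) _‖ ≤ _
  rw [h]
  exact norm_synth_apply_le _ hK _

end Norms


section Leibniz

variable {d : ℕ} {q : ℝ≥0∞} [Fact (1 ≤ q)] {σ : ℝ}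

/-- The sequence `(-Δ)^{kσ} f`. -/
noncomputable def fracSeq (σ : ℝ) (k : ℕ) (f : L1 d) : L1 d :=
  evalMultiplier f (fracPow (lap d) σ ^ k)

theorem fracSeq_zero (f : L1 d) : fracSeq σ 0 f = f := by
  rw [fracSeq, pow_zero]; rfl

theorem fracSeq_succ (k : ℕ) (f : L1 d) :
    fracSeq σ (k + 1) f = fracSeq σ k (fracSeq σ 1 f) := by
  rw [fracSeq, pow_succ, evalMultiplier_mul, fracSeq, fracSeq, pow_one]

theorem fracSeq_evalMultiplier (k : ℕ) (X : Multiplier d) (f : L1 d) :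
    fracSeq σ k (evalMultiplier f X) = evalMultiplier (fracSeq σ k f) X := by
  rw [fracSeq, fracSeq, ← evalMultiplier_mul, ← evalMultiplier_mul, mul_comm]

variable (q) in
/-- The inhomogeneous Sobolev norm of order `kσ` at scale `T`. -/
noncomputable def sobolevNorm (σ : ℝ) (k : ℕ) (T : ℝ) (f : L1 d) : ℝ :=
  lqNorm q f + T ^ (k * σ) * lqNorm q (fracSeq σ k f)

theorem sobolevNorm_nonneg (k : ℕ) {T : ℝ} (hT : 0 < T) (f : L1 d) :
    0 ≤ sobolevNorm q σ k T f := by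
  have := lqNorm_nonneg (q := q) f
  have := lqNorm_nonneg (q := q) (fracSeq σ k f)
  unfold sobolevNorm; positivity

theorem exists_lqNorm_fracSeq_le (hq : q ≠ ∞) (hσ : 0 < σ) (hσ1 : σ < 1) {j k : ℕ} (hjk : j ≤ k) :
    ∃ C, 0 ≤ C ∧ ∀ T, 0 < T → ∀ f : L1 d,
      lqNorm q (fracSeq σ j f) ≤ C * T ^ (-(j * σ)) * sobolevNorm q σ k T f := by
  obtain ⟨n, rfl⟩ := Nat.exists_eq_add_of_le hjk
  obtain ⟨C, hC, h⟩ := isSmoothing_lap.exists_splitting hσ hσ1 (fracPow_lap_mul (d := d) hσ hσ1) j n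
  refine ⟨C, hC, fun T hT f => ?_⟩
  obtain ⟨U, W, hUW, hU, hW⟩ := h T hT
  have h1 : fracSeq σ j f = evalMultiplier f U + evalMultiplier (fracSeq σ (j + n) f) W := by
    rw [fracSeq, hUW, map_add, evalMultiplier_mul]; rfl
  have h0 := lqNorm_nonneg (q := q) f
  have h0' := lqNorm_nonneg (q := q) (fracSeq σ (j + n) f)
  have h2 : T ^ (n * σ) = T ^ (-(j * σ)) * T ^ (((j + n : ℕ) : ℝ) * σ) := by
    rw [← Real.rpow_add hT]; congr 1; push_cast; ring
  calc _ ≤ ‖U‖ * lqNorm q f + ‖W‖ * lqNorm q (fracSeq σ (j + n) f) := by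
        rw [h1]
        exact (lqNorm_add_le _ _).trans (add_le_add (lqNorm_evalMultiplier_le hq _ _)
          (lqNorm_evalMultiplier_le hq _ _))
    _ ≤ C * T ^ (-(j * σ)) * lqNorm q f + C * T ^ (n * σ) * lqNorm q (fracSeq σ (j + n) f) := by
        gcongr
    _ = _ := by rw [h2, sobolevNorm]; ring

theorem exists_lqNorm_diffOp_le (hq : q ≠ ∞) (hσ1 : σ < 1) {e : ℝ} (he : 0 < e) (heσ : e < σ)
    (he1 : 2 * e ≤ 1) :
    ∃ C, 0 ≤ C ∧ ∀ T, 0 < T → ∀ (m : Fin d → ℤ) (f : L1 d),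
      lqNorm q (evalMultiplier f (diffOp m)) ≤
        C * (len m ^ 2 / T) ^ e * sobolevNorm q σ 1 T f := by
  obtain ⟨C, hC, h⟩ := isSmoothing_lap.exists_splitting_of_half hσ1
    (fracPow_lap_mul (d := d) (he.trans heσ) hσ1) he heσ he1
  refine ⟨C, hC, fun T hT m f => ?_⟩
  obtain ⟨U, W, hUW, hU, hW⟩ := h (diffOp m) (len m) (len_nonneg m) (norm_diffOp_le m)
    (fun t ht => norm_diffOp_mul_heat_le m ht) T hT
  have h1 : evalMultiplier f (diffOp m) =
      evalMultiplier f U + evalMultiplier (fracSeq σ 1 f) W := by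
    rw [fracSeq, hUW, map_add, evalMultiplier_mul, pow_one]
  have h0 := lqNorm_nonneg (q := q) f
  have h0' := lqNorm_nonneg (q := q) (fracSeq σ 1 f)
  have h2 : T ^ (σ - e) = T ^ (-e) * T ^ (((1 : ℕ) : ℝ) * σ) := by
    rw [← Real.rpow_add hT]; congr 1; push_cast; ring
  have h3 : (len m ^ 2 / T) ^ e = len m ^ (2 * e) * T ^ (-e) := by
    rw [Real.div_rpow (sq_nonneg _) hT.le, Real.rpow_mul (len_nonneg m), Real.rpow_two,
      Real.rpow_neg hT.le, div_eq_mul_inv]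
  calc _ ≤ ‖U‖ * lqNorm q f + ‖W‖ * lqNorm q (fracSeq σ 1 f) := by
        rw [h1]
        exact (lqNorm_add_le _ _).trans (add_le_add (lqNorm_evalMultiplier_le hq _ _)
          (lqNorm_evalMultiplier_le hq _ _))
    _ ≤ C * len m ^ (2 * e) * T ^ (-e) * lqNorm q f +
        C * len m ^ (2 * e) * T ^ (σ - e) * lqNorm q (fracSeq σ 1 f) := by
        gcongr
    _ = _ := by rw [h2, h3, sobolevNorm]; ring

theorem exists_lqNorm_fracSeq_diffOp_le (hq : q ≠ ∞) (hσ1 : σ < 1) {e : ℝ} (he : 0 < e)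
    (heσ : e < σ) (he1 : 2 * e ≤ 1) {j k : ℕ} (hjk : j + 1 ≤ k) :
    ∃ C, 0 ≤ C ∧ ∀ T, 0 < T → ∀ (m : Fin d → ℤ) (f : L1 d),
      lqNorm q (fracSeq σ j (evalMultiplier f (diffOp m))) ≤
        C * T ^ (-(j * σ)) * sobolevNorm q σ k T f * min 1 ((len m ^ 2 / T) ^ e) := by
  have hσ := he.trans heσ
  obtain ⟨C₁, hC₁, h₁⟩ := exists_lqNorm_fracSeq_le (d := d) hq hσ hσ1 (Nat.le_of_succ_le hjk)
  obtain ⟨C₂, hC₂, h₂⟩ := exists_lqNorm_fracSeq_le (d := d) hq hσ hσ1 hjk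
  obtain ⟨C₃, hC₃, h₃⟩ := exists_lqNorm_diffOp_le (d := d) hq hσ1 he heσ he1
  refine ⟨2 * C₁ + C₃ * (C₁ + C₂), by positivity, fun T hT m f => ?_⟩
  have hS := sobolevNorm_nonneg (q := q) (σ := σ) k hT f
  have hl : 0 ≤ len m ^ 2 / T := by positivity
  have h4 := h₁ T hT f
  have h5 := h₂ T hT f
  rw [fracSeq_evalMultiplier, mul_min_of_nonneg _ _ (by positivity)]
  refine le_min ?_ ?_
  · calc _ ≤ 2 * lqNorm q (fracSeq σ j f) := by
          refine (lqNorm_evalMultiplier_le hq _ _).trans ?_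
          gcongr
          · exact lqNorm_nonneg _
          · exact norm_diffOp_le m
      _ ≤ 2 * (C₁ * T ^ (-(j * σ)) * sobolevNorm q σ k T f) := by gcongr
      _ = 2 * C₁ * T ^ (-(j * σ)) * sobolevNorm q σ k T f * 1 := by ring
      _ ≤ _ := by
          gcongr
          exact le_add_of_nonneg_right (by positivity)
  · have h6 : fracSeq σ 1 (fracSeq σ j f) = fracSeq σ (j + 1) f := by
      rw [fracSeq, fracSeq, ← evalMultiplier_mul, ← pow_add, add_comm]; rfl
    have h7 : T ^ (((1 : ℕ) : ℝ) * σ) * T ^ (-((j + 1 : ℕ) * σ)) = T ^ (-(j * σ)) := by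
      rw [← Real.rpow_add hT]; congr 1; push_cast; ring
    have h8 : sobolevNorm q σ 1 T (fracSeq σ j f) ≤
        (C₁ + C₂) * T ^ (-(j * σ)) * sobolevNorm q σ k T f := by
      calc _ ≤ C₁ * T ^ (-(j * σ)) * sobolevNorm q σ k T f +
            T ^ (((1 : ℕ) : ℝ) * σ) * (C₂ * T ^ (-((j + 1 : ℕ) * σ)) * sobolevNorm q σ k T f) := by
            rw [sobolevNorm, h6]; gcongr
        _ = _ := by rw [← h7]; ring
    calc _ ≤ C₃ * (len m ^ 2 / T) ^ e * ((C₁ + C₂) * T ^ (-(j * σ)) * sobolevNorm q σ k T f) :=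
          (h₃ T hT m _).trans (by gcongr)
      _ = C₃ * (C₁ + C₂) * T ^ (-(j * σ)) * sobolevNorm q σ k T f * (len m ^ 2 / T) ^ e := by ring
      _ ≤ _ := by
          gcongr
          exact le_add_of_nonneg_left (by positivity)

end Leibniz


section Induction

variable {d : ℕ} {p p₁ p₂ : ℝ≥0∞} [Fact (1 ≤ p)] [Fact (1 ≤ p₁)] [Fact (1 ≤ p₂)] {σ : ℝ}

variable (d p p₁ p₂) in
/-- The fractional Leibniz rule of order `kσ` with constant `C`. -/
def LeibnizRule (σ : ℝ) (k : ℕ) (C : ℝ) : Prop :=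
  ∀ f g : L1 d, lqNorm p (fracSeq σ k (mulL1 f g)) ≤
    C * (lqNorm p₁ (fracSeq σ k f) * lqNorm p₂ g + lqNorm p₁ f * lqNorm p₂ (fracSeq σ k g))

theorem min_one_rpow_mul_self_le {x : ℝ} (hx : 0 ≤ x) (e : ℝ) (he : 0 < e) :
    min 1 (x ^ e) * min 1 (x ^ e) ≤ min 1 (x ^ (2 * e)) := by
  have h0 : 0 ≤ min 1 (x ^ e) := le_min zero_le_one (by positivity)
  refine le_min (mul_le_one₀ (min_le_left _ _) h0 (min_le_left _ _)) ?_
  rw [two_mul, Real.rpow_add_of_nonneg hx he.le he.le]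
  exact mul_le_mul (min_le_right _ _) (min_le_right _ _) h0 (by positivity)

theorem LeibnizRule.exists_carre_diffOp_le (hp₁ : p₁ ≠ ∞) (hp₂ : p₂ ≠ ∞) (hσ1 : σ < 1) {e : ℝ}
    (he : 0 < e) (heσ : e < σ) (he1 : 2 * e ≤ 1) {k : ℕ} {C : ℝ} (hC : 0 ≤ C)
    (h : LeibnizRule d p p₁ p₂ σ k C) :
    ∃ C', 0 ≤ C' ∧ ∀ T, 0 < T → ∀ (m : Fin d → ℤ) (f g : L1 d),
      lqNorm p (fracSeq σ k (carre f g (diffOp m))) ≤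
        C' * T ^ (-(k * σ)) * (sobolevNorm p₁ σ (k + 1) T f * sobolevNorm p₂ σ (k + 1) T g) *
          min 1 ((len m ^ 2 / T) ^ (2 * e)) := by
  obtain ⟨C₁, hC₁, h₁⟩ := exists_lqNorm_fracSeq_diffOp_le (d := d) hp₁ hσ1 he heσ he1
    (le_refl (k + 1))
  obtain ⟨C₂, hC₂, h₂⟩ := exists_lqNorm_fracSeq_diffOp_le (d := d) hp₂ hσ1 he heσ he1
    (le_refl (k + 1))
  obtain ⟨C₃, hC₃, h₃⟩ := exists_lqNorm_fracSeq_diffOp_le (d := d) hp₁ hσ1 he heσ he1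
    (j := 0) (k := k + 1) (by omega)
  obtain ⟨C₄, hC₄, h₄⟩ := exists_lqNorm_fracSeq_diffOp_le (d := d) hp₂ hσ1 he heσ he1
    (j := 0) (k := k + 1) (by omega)
  simp only [fracSeq_zero, Nat.cast_zero, zero_mul, neg_zero, Real.rpow_zero, mul_one] at h₃ h₄
  refine ⟨C * (C₁ * C₄ + C₃ * C₂), by positivity, fun T hT m f g => ?_⟩
  have hA := sobolevNorm_nonneg (q := p₁) (σ := σ) (k + 1) hT f
  have hB := sobolevNorm_nonneg (q := p₂) (σ := σ) (k + 1) hT g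
  set A := sobolevNorm p₁ σ (k + 1) T f
  set B := sobolevNorm p₂ σ (k + 1) T g
  have hμ : 0 ≤ min 1 ((len m ^ 2 / T) ^ e) := le_min zero_le_one (by positivity)
  have hμ2 := min_one_rpow_mul_self_le (x := len m ^ 2 / T) (by positivity) e he
  set μ := min 1 ((len m ^ 2 / T) ^ e)
  rw [carre_diffOp]
  calc _ ≤ C * ((C₁ * T ^ (-(k * σ)) * A * μ) * (C₄ * B * μ) +
        (C₃ * A * μ) * (C₂ * T ^ (-(k * σ)) * B * μ)) := by
        refine (h _ _).trans ?_
        gcongr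
        · exact lqNorm_nonneg _
        · exact h₁ T hT m f
        · exact h₄ T hT m g
        · exact lqNorm_nonneg _
        · exact h₃ T hT m f
        · exact h₂ T hT m g
    _ = C * (C₁ * C₄ + C₃ * C₂) * T ^ (-(k * σ)) * (A * B) * (μ * μ) := by ring
    _ ≤ _ := by gcongr

theorem fracSeq_carre_fracPow (hσ : 0 < σ) (hσ1 : σ < 1) (k : ℕ) (f g : L1 d) :
    toLq p (fracSeq σ k (carre f g (fracPow (lap d) σ))) = (balakrishnanConst σ)⁻¹ •
      ∫ t in Set.Ioi (0 : ℝ), t ^ (-σ - 1) •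
        toLq p (fracSeq σ k (carre f g (1 - heat (lap d) t))) :=
  fracPow_map isSmoothing_lap hσ hσ1
    ((toLq p ∘L (fracPow (lap d) σ ^ k).1 ∘L carre f g).restrictScalars ℝ)

theorem LeibnizRule.exists_carre_fracPow_le (hp₁ : p₁ ≠ ∞) (hp₂ : p₂ ≠ ∞) (hσ : 0 < σ)
    (hσ1 : σ ≤ 1 / 2) {k : ℕ} {C : ℝ} (hC : 0 ≤ C) (h : LeibnizRule d p p₁ p₂ σ k C) :
    ∃ C', 0 ≤ C' ∧ ∀ T, 0 < T → ∀ (f g : L1 d),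
      lqNorm p (fracSeq σ k (carre f g (fracPow (lap d) σ))) ≤
        C' * T ^ (-((k + 1 : ℕ) * σ)) *
          (sobolevNorm p₁ σ (k + 1) T f * sobolevNorm p₂ σ (k + 1) T g) := by
  obtain ⟨C', hC', h'⟩ := h.exists_carre_diffOp_le hp₁ hp₂ (by linarith) (e := 3 / 4 * σ)
    (by linarith) (by linarith) (by linarith) hC
  have hc := balakrishnanConst_pos hσ (by linarith)
  set κ := 2 * (3 / 4 * σ) with hκ
  have hκσ : 0 < κ - σ := by rw [hκ]; linarith
  set D : ℝ := 1 + d ^ 2 * (π ^ 2 / 2)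
  refine ⟨(balakrishnanConst σ)⁻¹ * (C' * D * (1 / (κ - σ) + 1 / σ)), by positivity,
    fun T hT f g => ?_⟩
  have hA := sobolevNorm_nonneg (q := p₁) (σ := σ) (k + 1) hT f
  have hB := sobolevNorm_nonneg (q := p₂) (σ := σ) (k + 1) hT g
  have hs := h' T hT
  set A := sobolevNorm p₁ σ (k + 1) T f
  set B := sobolevNorm p₂ σ (k + 1) T g
  have h1 : ∀ t, 0 < t → ‖toLq p (fracSeq σ k (carre f g (1 - heat (lap d) t)))‖ ≤
      C' * T ^ (-(k * σ)) * (A * B) * D * min 1 ((t / T) ^ κ) := fun t ht => by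
    have h2 := norm_map_one_sub_heat_le
      (toLq p ∘L (fracPow (lap d) σ ^ k).1 ∘L carre f g) t
    refine h2.trans ?_
    have h3 : ∀ m, ‖heatKernel d t m‖ * ‖toLq p (fracSeq σ k (carre f g (diffOp m)))‖ ≤
        C' * T ^ (-(k * σ)) * (A * B) *
          (‖heatKernel d t m‖ * min 1 ((len m ^ 2 / T) ^ κ)) := fun m => by
      rw [mul_left_comm]
      exact mul_le_mul_of_nonneg_left (hs m f g) (norm_nonneg _)
    have h4 : Summable fun m => C' * T ^ (-(k * σ)) * (A * B) *
          (‖heatKernel d t m‖ * min 1 ((len m ^ 2 / T) ^ κ)) := by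
      refine Summable.mul_left _ (Summable.of_nonneg_of_le (fun m => ?_) (fun m => ?_)
        (hasSum_norm_heatKernel (d := d) ht.le).summable)
      · exact mul_nonneg (norm_nonneg _) (le_min zero_le_one (by positivity))
      · exact mul_le_of_le_one_right (norm_nonneg _) (min_le_left _ _)
    refine ((Summable.of_nonneg_of_le (fun m => by positivity) h3 h4).tsum_le_tsum h3 h4).trans ?_
    rw [tsum_mul_left, mul_assoc _ D]
    gcongr
    exact tsum_heatKernel_mul_min_le (by linarith) (by linarith) ht hT
  have h5 := norm_integral_rpow_smul_le hσ (by linarith : σ < κ) hT h1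
  rw [lqNorm, fracSeq_carre_fracPow hσ (by linarith), norm_smul,
    Real.norm_of_nonneg (by positivity)]
  have h6 : T ^ (-(((k + 1 : ℕ) : ℝ) * σ)) = T ^ (-(k * σ)) * T ^ (-σ) := by
    rw [← Real.rpow_add hT]; congr 1; push_cast; ring
  calc _ ≤ (balakrishnanConst σ)⁻¹ * (C' * T ^ (-(k * σ)) * (A * B) * D *
        (1 / (κ - σ) + 1 / σ) * T ^ (-σ)) := by gcongr
    _ = _ := by rw [h6]; ring

theorem LeibnizRule.exists_fracSeq_mulL1_le (hp₁ : p₁ ≠ ∞) (hp₂ : p₂ ≠ ∞) (hσ : 0 < σ)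
    (hσ1 : σ ≤ 1 / 2) {k : ℕ} {C : ℝ} (hC : 0 ≤ C) (h : LeibnizRule d p p₁ p₂ σ k C) :
    ∃ C', 0 ≤ C' ∧ ∀ T, 0 < T → ∀ (f g : L1 d),
      lqNorm p (fracSeq σ (k + 1) (mulL1 f g)) ≤
        C' * T ^ (-((k + 1 : ℕ) * σ)) *
          (sobolevNorm p₁ σ (k + 1) T f * sobolevNorm p₂ σ (k + 1) T g) := by
  have hσ1' : σ < 1 := by linarith
  obtain ⟨C₀, hC₀, h₀⟩ := h.exists_carre_fracPow_le hp₁ hp₂ hσ hσ1 hC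
  have hM : ∀ (q : ℝ≥0∞) [Fact (1 ≤ q)], q ≠ ∞ → ∃ M, 0 ≤ M ∧ ∀ j ∈ Finset.range (k + 2),
      ∀ T, 0 < T → ∀ f : L1 d,
      lqNorm q (fracSeq σ j f) ≤ M * T ^ (-(j * σ)) * sobolevNorm q σ (k + 1) T f := by
    intro q _ hq
    have : ∀ j : Fin (k + 2), ∃ M, 0 ≤ M ∧ ∀ T, 0 < T → ∀ f : L1 d,
        lqNorm q (fracSeq σ j f) ≤ M * T ^ (-(j * σ)) * sobolevNorm q σ (k + 1) T f :=
      fun j => exists_lqNorm_fracSeq_le hq hσ hσ1' (by omega)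
    choose M hM hM' using this
    refine ⟨∑ j, M j, Finset.sum_nonneg fun j _ => hM j, fun j hj T hT f => ?_⟩
    have h1 := hM' ⟨j, Finset.mem_range.1 hj⟩ T hT f
    have h2 := Finset.single_le_sum (f := M) (fun j _ => hM j)
      (Finset.mem_univ ⟨j, Finset.mem_range.1 hj⟩)
    have h3 := sobolevNorm_nonneg (q := q) (σ := σ) (k + 1) hT f
    exact h1.trans (by gcongr)
  obtain ⟨M₁, hM₁, h₁⟩ := hM p₁ hp₁
  obtain ⟨M₂, hM₂, h₂⟩ := hM p₂ hp₂
  refine ⟨4 * C * (M₁ * M₂) + C₀, by positivity, fun T hT f g => ?_⟩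
  have hA := sobolevNorm_nonneg (q := p₁) (σ := σ) (k + 1) hT f
  have hB := sobolevNorm_nonneg (q := p₂) (σ := σ) (k + 1) hT g
  have h0 := h₀ T hT f g
  have hf := fun j hj => h₁ j hj T hT f
  have hg := fun j hj => h₂ j hj T hT g
  set A := sobolevNorm p₁ σ (k + 1) T f
  set B := sobolevNorm p₂ σ (k + 1) T g
  have hprod : ∀ i j, i + j = k + 1 →
      lqNorm p₁ (fracSeq σ i f) * lqNorm p₂ (fracSeq σ j g) ≤
        M₁ * M₂ * T ^ (-((k + 1 : ℕ) * σ)) * (A * B) := fun i j hij => by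
    have e : T ^ (-(((k + 1 : ℕ) : ℝ) * σ)) = T ^ (-(i * σ)) * T ^ (-(j * σ)) := by
      rw [← Real.rpow_add hT, ← hij]; congr 1; push_cast; ring
    calc _ ≤ (M₁ * T ^ (-(i * σ)) * A) * (M₂ * T ^ (-(j * σ)) * B) :=
          mul_le_mul (hf i (by simp; omega)) (hg j (by simp; omega)) (lqNorm_nonneg _)
            (by positivity)
      _ = _ := by rw [e]; ring
  have hid : fracSeq σ (k + 1) (mulL1 f g) = fracSeq σ k (mulL1 (fracSeq σ 1 f) g) +
      fracSeq σ k (mulL1 f (fracSeq σ 1 g)) -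
      fracSeq σ k (carre f g (fracPow (lap d) σ)) := by
    have e1 : fracSeq σ 1 (mulL1 f g) = mulL1 (fracSeq σ 1 f) g + mulL1 f (fracSeq σ 1 g) -
        carre f g (fracPow (lap d) σ) := by
      rw [carre_apply, fracSeq, fracSeq, fracSeq, pow_one, sub_sub_cancel]
    rw [fracSeq_succ, e1]
    simp only [fracSeq]
    exact (map_sub (fracPow (lap d) σ ^ k).1 _ _).trans
      (congrArg (· - _) (map_add (fracPow (lap d) σ ^ k).1 _ _))
  have htri : lqNorm p (fracSeq σ (k + 1) (mulL1 f g)) ≤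
      lqNorm p (fracSeq σ k (mulL1 (fracSeq σ 1 f) g)) +
      lqNorm p (fracSeq σ k (mulL1 f (fracSeq σ 1 g))) +
      lqNorm p (fracSeq σ k (carre f g (fracPow (lap d) σ))) := by
    rw [hid, lqNorm, map_sub, map_add]
    exact (norm_sub_le _ _).trans (add_le_add_left (norm_add_le _ _) _)
  have b1 := h (fracSeq σ 1 f) g
  have b2 := h f (fracSeq σ 1 g)
  rw [← fracSeq_succ] at b1 b2
  have p1 := hprod (k + 1) 0 rfl
  have p2 := hprod 1 k (by omega)
  have p3 := hprod k 1 rfl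
  have p4 := hprod 0 (k + 1) (by omega)
  rw [fracSeq_zero] at p1 p4
  have c1 := mul_le_mul_of_nonneg_left (add_le_add p1 p2) hC
  have c2 := mul_le_mul_of_nonneg_left (add_le_add p3 p4) hC
  calc _ ≤ _ := htri
    _ ≤ _ := add_le_add (add_le_add (b1.trans c1) (b2.trans c2)) h0
    _ = _ := by ring

theorem le_two_mul_of_forall_pos {y C a b c e : ℝ} (hC : 0 ≤ C) (ha : 0 ≤ a) (hb : 0 ≤ b)
    (hc : 0 ≤ c) (he : 0 ≤ e)
    (h : ∀ X, 0 < X → y ≤ C * X⁻¹ * ((a + X * c) * (b + X * e))) :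
    y ≤ 2 * C * (c * b + a * e) := by
  refine le_of_forall_pos_le_add fun ε hε => ?_
  set η := ε / (C * (b + e) + 1) with hη
  have hden : 0 < C * (b + e) + 1 := by positivity
  have hη0 : 0 < η := by positivity
  have h1 := h ((a + η) / (c + η)) (by positivity)
  set X := (a + η) / (c + η) with hX
  have hX0 : 0 < X := by positivity
  have h2 : X⁻¹ * (a * b) ≤ b * (c + η) := by
    rw [hX, inv_div, div_mul_eq_mul_div, div_le_iff₀ (by positivity)]
    have : 0 ≤ b * (c + η) * η := by positivity
    nlinarith
  have h3 : X * (c * e) ≤ e * (a + η) := by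
    rw [hX, div_mul_eq_mul_div, div_le_iff₀ (by positivity)]
    have : 0 ≤ e * (a + η) * η := by positivity
    nlinarith
  have h4 : C * X⁻¹ * ((a + X * c) * (b + X * e)) =
      C * (X⁻¹ * (a * b) + X * (c * e) + (a * e + c * b)) := by
    field_simp; ring
  have h5 : C * (b + e) * η ≤ ε := by
    rw [hη, mul_div_assoc', div_le_iff₀ hden]; nlinarith
  calc y ≤ C * (b * (c + η) + e * (a + η) + (a * e + c * b)) := by
        rw [h4] at h1; exact h1.trans (by gcongr)
    _ = 2 * C * (c * b + a * e) + C * (b + e) * η := by ring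
    _ ≤ _ := by gcongr

theorem exists_leibnizRule [p₁.HolderTriple p₂ p] (hp₁ : p₁ ≠ ∞) (hp₂ : p₂ ≠ ∞) (hσ : 0 < σ)
    (hσ1 : σ ≤ 1 / 2) (k : ℕ) : ∃ C, 0 ≤ C ∧ LeibnizRule d p p₁ p₂ σ k C := by
  induction k with
  | zero =>
    refine ⟨1, zero_le_one, fun f g => ?_⟩
    simp only [fracSeq_zero, one_mul]
    exact (lqNorm_mulL1_le f g).trans (le_add_of_nonneg_right
      (mul_nonneg (lqNorm_nonneg _) (lqNorm_nonneg _)))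
  | succ k ih =>
    obtain ⟨C, hC, h⟩ := ih
    obtain ⟨C', hC', h'⟩ := h.exists_fracSeq_mulL1_le hp₁ hp₂ hσ hσ1 hC
    refine ⟨2 * C', by positivity, fun f g => ?_⟩
    refine le_two_mul_of_forall_pos hC' (lqNorm_nonneg _) (lqNorm_nonneg _) (lqNorm_nonneg _)
      (lqNorm_nonneg _) fun X hX => ?_
    have hs : 0 < ((k + 1 : ℕ) : ℝ) * σ := by positivity
    have h1 := h' (X ^ (((k + 1 : ℕ) : ℝ) * σ)⁻¹) (by positivity) f g
    rw [sobolevNorm, sobolevNorm, Real.rpow_neg (by positivity), ← Real.rpow_mul hX.le,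
      inv_mul_cancel₀ hs.ne', Real.rpow_one] at h1
    exact h1

end Induction

end FracLeibniz

/-- **Fractional Leibniz rule for the discrete Laplacian on `ℤ^d`.**
For `s > 0` and `1/p = 1/p₁ + 1/p₂` with `p, p₁, p₂ ∈ (1,∞)`, there is `C` such that for
all `f, g ∈ ℓ¹(ℤ^d)` whose Fourier transforms vanish near `0` in `𝕋^d`,
`‖(-Δ)^s(fg)‖_{ℓ^p} ≤ C (‖(-Δ)^s f‖_{ℓ^{p₁}} ‖g‖_{ℓ^{p₂}} + ‖(-Δ)^s g‖_{ℓ^{p₂}} ‖f‖_{ℓ^{p₁}})`. -/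
theorem stmt1 (d : ℕ) (hd : 1 ≤ d) (s : ℝ) (hs : 0 < s)
    (p p₁ p₂ : ℝ) (hp : 1 < p) (hp₁ : 1 < p₁) (hp₂ : 1 < p₂)
    (hppp : 1 / p = 1 / p₁ + 1 / p₂) :
    ∃ C : ℝ, 0 < C ∧
      ∀ f g : (Fin d → ℤ) → ℂ,
        Summable (fun n => ‖f n‖) → Summable (fun n => ‖g n‖) →
        (∃ ε : ℝ, 0 < ε ∧ ∀ ξ ∈ Td d, Real.sqrt (∑ j, ξ j ^ 2) < ε →
          Ftd d f ξ = 0 ∧ Ftd d g ξ = 0) →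
        lpN d p (fracLapZ d s fun n => f n * g n) ≤
          ENNReal.ofReal C *
            (lpN d p₁ (fracLapZ d s f) * lpN d p₂ g +
              lpN d p₂ (fracLapZ d s g) * lpN d p₁ f) := by
  have hfact : ∀ r : ℝ, 1 < r → Fact (1 ≤ ENNReal.ofReal r) := fun r hr =>
    ⟨ENNReal.one_le_ofReal.2 hr.le⟩
  have := hfact p hp
  have := hfact p₁ hp₁
  have := hfact p₂ hp₂
  have : (ENNReal.ofReal p₁).HolderTriple (ENNReal.ofReal p₂) (ENNReal.ofReal p) := ⟨by
    rw [← ENNReal.ofReal_inv_of_pos (by linarith), ← ENNReal.ofReal_inv_of_pos (by linarith),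
      ← ENNReal.ofReal_inv_of_pos (by linarith), ← ENNReal.ofReal_add (by positivity)
      (by positivity)]
    simp only [one_div] at hppp
    rw [hppp]⟩
  obtain ⟨M, hM⟩ := exists_nat_gt (2 * s)
  have hM0 : (0 : ℝ) < M := by linarith
  have hσ : 0 < s / M := by positivity
  have hσ1 : s / M ≤ 1 / 2 := by rw [div_le_iff₀ hM0]; linarith
  have hMs : (M : ℝ) * (s / M) = s := by field_simp
  obtain ⟨C, hC, h⟩ := FracLeibniz.exists_leibnizRule (d := d) (p := ENNReal.ofReal p)
    (p₁ := ENNReal.ofReal p₁) (p₂ := ENNReal.ofReal p₂) ENNReal.ofReal_ne_top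
    ENNReal.ofReal_ne_top hσ hσ1 M
  refine ⟨C + 1, by positivity, fun f g hf hg _ => ?_⟩
  let F : FracLeibniz.L1 d := ⟨f, memℓp_gen (by simpa using hf)⟩
  let G : FracLeibniz.L1 d := ⟨g, memℓp_gen (by simpa using hg)⟩
  have hlap : ∀ u : FracLeibniz.L1 d, fracLapZ d s u = FracLeibniz.fracSeq (s / M) M u := fun u => by
    rw [← hMs, FracLeibniz.fracLapZ_eq hσ (by linarith), hMs]; rfl
  have hfg : (fun n => f n * g n) = FracLeibniz.mulL1 F G :=
    funext fun n => (FracLeibniz.mulL1_apply F G n).symm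
  have hN : ∀ r : ℝ, 1 < r → ∀ u : FracLeibniz.L1 d, ∀ [Fact (1 ≤ ENNReal.ofReal r)],
      lpN d r u = ENNReal.ofReal (FracLeibniz.lqNorm (ENNReal.ofReal r) u) := by
    intro r hr u _
    have := FracLeibniz.lpN_eq_ofReal_lqNorm (q := ENNReal.ofReal r) ENNReal.ofReal_ne_top u
    rwa [ENNReal.toReal_ofReal (by linarith)] at this
  change lpN d p (fracLapZ d s fun n => f n * g n) ≤ ENNReal.ofReal (C + 1) *
    (lpN d p₁ (fracLapZ d s F) * lpN d p₂ G + lpN d p₂ (fracLapZ d s G) * lpN d p₁ F)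
  have n0 := fun (r : ℝ) (u : FracLeibniz.L1 d) [Fact (1 ≤ ENNReal.ofReal r)] =>
    FracLeibniz.lqNorm_nonneg (q := ENNReal.ofReal r) u
  rw [hfg, hlap, hlap, hlap, hN p hp, hN p₁ hp₁, hN p₂ hp₂, hN p₂ hp₂, hN p₁ hp₁,
    ← ENNReal.ofReal_mul (n0 _ _), ← ENNReal.ofReal_mul (n0 _ _),
    ← ENNReal.ofReal_add (mul_nonneg (n0 _ _) (n0 _ _)) (mul_nonneg (n0 _ _) (n0 _ _)),
    ← ENNReal.ofReal_mul (by positivity)]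
  refine ENNReal.ofReal_le_ofReal ((h F G).trans ?_)
  rw [mul_comm (FracLeibniz.lqNorm (ENNReal.ofReal p₂) _)]
  refine mul_le_mul_of_nonneg_right (by linarith) ?_
  exact add_nonneg (mul_nonneg (n0 _ _) (n0 _ _)) (mul_nonneg (n0 _ _) (n0 _ _))
end

section
/- Let 1 < p < ∞. There is a constant C_p such that for every f ∈ ℓ¹(ℤ), the function H f defined by H f(n) := ∫_0^{1/2} 𝓕f(ξ) e^{2π i ξ n} dξ (n ∈ ℤ) satisfies ‖H f‖_{ℓ^p(ℤ)} ≤ C_p ‖f‖_{ℓ^p(ℤ)}. -/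
open MeasureTheory Real
open scoped ENNReal NNReal

/-- The Fourier transform of `f ∈ ℓ¹(ℤ)`: `𝓕f(ξ) = ∑_{n ∈ ℤ} f(n) e^{2π i n ξ}`. -/
noncomputable def Ft1 (f : ℤ → ℂ) (ξ : ℝ) : ℂ :=
  ∑' n : ℤ, f n * Complex.exp (2 * Real.pi * Complex.I * (n : ℂ) * (ξ : ℂ))

/-- The `ℓ^p(ℤ)` norm, valued in `ℝ≥0∞`. -/
noncomputable def lpN1 (p : ℝ) (f : ℤ → ℂ) : ℝ≥0∞ :=
  (∑' n : ℤ, (‖f n‖₊ : ℝ≥0∞) ^ p) ^ (1 / p)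

/-- The projection onto positive frequencies:
`H f(n) = ∫_0^{1/2} 𝓕f(ξ) e^{2π i ξ n} dξ`. -/
noncomputable def Hop (f : ℤ → ℂ) (n : ℤ) : ℂ :=
  ∫ ξ in (0 : ℝ)..(1 / 2), Ft1 f ξ * Complex.exp (2 * Real.pi * Complex.I * (ξ : ℂ) * (n : ℂ))

/-- The complex number with the argument of `c` and modulus `‖c‖ ^ w`. -/
noncomputable def phasePow (c w : ℂ) : ℂ := c / ‖c‖ * (‖c‖ : ℂ) ^ w

theorem norm_phasePow (c : ℂ) {w : ℂ} (hw : 0 < w.re) : ‖phasePow c w‖ = ‖c‖ ^ w.re := by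
  rcases eq_or_ne c 0 with rfl | hc
  · simp [phasePow, Real.zero_rpow hw.ne']
  · have h : 0 < ‖c‖ := norm_pos_iff.mpr hc
    simp [phasePow, Complex.norm_cpow_eq_rpow_re_of_pos h, h.ne']

theorem phasePow_one (c : ℂ) : phasePow c 1 = c := by
  rcases eq_or_ne c 0 with rfl | hc
  · simp [phasePow]
  · have h : (‖c‖ : ℂ) ≠ 0 := by simpa using hc
    simp [phasePow, h]

theorem differentiable_phasePow (c : ℂ) : Differentiable ℂ (phasePow c) := by
  rcases eq_or_ne c 0 with rfl | hc
  · have : phasePow 0 = fun _ => 0 := by ext; simp [phasePow]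
    rw [this]; exact differentiable_const _
  · have h : (‖c‖ : ℂ) ≠ 0 := by simpa using hc
    unfold phasePow
    exact (differentiable_id.const_cpow (Or.inl h)).const_mul _

theorem sum_norm_phasePow_rpow {ι : Type*} (s : Finset ι) (f : ι → ℂ) {w : ℂ} {a r : ℝ}
    (ha : 0 < a) (hr : 0 < r) (hw : w.re = a / r) (hf : ∑ i ∈ s, ‖f i‖ ^ (1 / r) ≤ 1) :
    ∑ i ∈ s, ‖phasePow (f i) w‖ ^ (1 / a) ≤ 1 := by
  refine le_trans (le_of_eq (Finset.sum_congr rfl fun i _ => ?_)) hf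
  rw [norm_phasePow _ (by rw [hw]; positivity), ← Real.rpow_mul (norm_nonneg _), hw]
  congr 1
  field_simp

theorem norm_le_one_of_sum_rpow_le_one {ι : Type*} {s : Finset ι} {f : ι → ℂ} {r : ℝ} (hr : 0 < r)
    (hf : ∑ i ∈ s, ‖f i‖ ^ r ≤ 1) {i : ι} (hi : i ∈ s) : ‖f i‖ ≤ 1 := by
  have h : ‖f i‖ ^ r ≤ 1 :=
    (Finset.single_le_sum (f := fun i => ‖f i‖ ^ r) (fun j _ => by positivity) hi).trans hf
  by_contra! hlt
  exact (Real.one_lt_rpow hlt hr).not_ge h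

/-- The form with matrix `T` on the finite set `s` is bounded by `C` on the product of the unit
balls of `ℓ^(1/α)` and of its dual. -/
def FormBound {ι : Type*} (T : ι → ι → ℂ) (s : Finset ι) (C α : ℝ) : Prop :=
  ∀ f g : ι → ℂ, ∑ m ∈ s, ‖f m‖ ^ (1 / α) ≤ 1 → ∑ n ∈ s, ‖g n‖ ^ (1 / (1 - α)) ≤ 1 →
    ‖∑ n ∈ s, ∑ m ∈ s, T n m * f m * g n‖ ≤ C

/-- The Riesz–Thorin theorem for finite matrices and dual exponents. -/
theorem FormBound.interpolate {ι : Type*} {T : ι → ι → ℂ} {s : Finset ι} {C α₀ α₁ t : ℝ}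
    (h₀ : FormBound T s C α₀) (h₁ : FormBound T s C α₁) (hα₀ : α₀ ∈ Set.Ioo (0 : ℝ) 1)
    (hα₁ : α₁ ∈ Set.Ioo (0 : ℝ) 1) (ht : t ∈ Set.Icc (0 : ℝ) 1) :
    FormBound T s C ((1 - t) * α₀ + t * α₁) := by
  intro f g hf hg
  set β := (1 - t) * α₀ + t * α₁ with hβ
  have conv : ∀ x ∈ Set.Icc (0 : ℝ) 1, (1 - x) * α₀ + x * α₁ ∈ Set.Ioo (0 : ℝ) 1 := fun x hx =>
    convex_Ioo (0 : ℝ) 1 hα₀ hα₁ (sub_nonneg.mpr hx.2) hx.1 (by ring)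
  obtain ⟨hβ0, hβ1⟩ := conv t ht
  rw [← hβ] at hβ0 hβ1
  have hβ1' : 0 < 1 - β := sub_pos.mpr hβ1
  have hC : 0 ≤ C := (norm_nonneg _).trans (h₀ 0 0 (by
    simp [Real.zero_rpow (inv_pos.mpr hα₀.1).ne']) (by
    simp [Real.zero_rpow (inv_pos.mpr (sub_pos.mpr hα₀.2)).ne']))
  let w : ℂ → ℂ := fun z => (1 - z) * α₀ + z * α₁
  have hw : ∀ z, (w z).re = (1 - z.re) * α₀ + z.re * α₁ := fun z => by simp [w]
  let u : ℂ → ℂ := fun z => w z / β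
  let v : ℂ → ℂ := fun z => (1 - w z) / ((1 - β : ℝ) : ℂ)
  have hu : ∀ z, (u z).re = (w z).re / β := fun z => Complex.div_ofReal_re _ _
  have hv : ∀ z, (v z).re = (1 - (w z).re) / (1 - β) := fun z => by
    simp only [v]; rw [Complex.div_ofReal_re]; simp
  let F : ℂ → ℂ := fun z =>
    ∑ n ∈ s, ∑ m ∈ s, T n m * phasePow (f m) (u z) * phasePow (g n) (v z)
  have hdw : Differentiable ℂ w := by fun_prop
  have hdu : Differentiable ℂ u := hdw.div_const _
  have hdv : Differentiable ℂ v := (hdw.const_sub _).div_const _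
  have hd : Differentiable ℂ F := by
    refine Differentiable.fun_sum fun n _ => Differentiable.fun_sum fun m _ => ?_
    exact (((differentiable_phasePow _).comp hdu).const_mul _).mul
      ((differentiable_phasePow _).comp hdv)
  have hB : BddAbove ((norm ∘ F) '' Complex.HadamardThreeLines.verticalClosedStrip 0 1) := by
    refine ⟨∑ n ∈ s, ∑ m ∈ s, ‖T n m‖, ?_⟩
    rintro _ ⟨z, hz, rfl⟩
    obtain ⟨hz0, hz1⟩ := conv z.re hz
    rw [← hw] at hz0 hz1
    refine norm_sum_le_of_le _ fun n hn => norm_sum_le_of_le _ fun m hm => ?_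
    have e1 : 0 < (u z).re := by rw [hu]; positivity
    have e2 : 0 < (v z).re := by rw [hv]; exact div_pos (sub_pos.mpr hz1) hβ1'
    have b1 : ‖phasePow (f m) (u z)‖ ≤ 1 := by
      rw [norm_phasePow _ e1]
      exact Real.rpow_le_one (norm_nonneg _)
        (norm_le_one_of_sum_rpow_le_one (one_div_pos.mpr hβ0) hf hm) e1.le
    have b2 : ‖phasePow (g n) (v z)‖ ≤ 1 := by
      rw [norm_phasePow _ e2]
      exact Real.rpow_le_one (norm_nonneg _)
        (norm_le_one_of_sum_rpow_le_one (one_div_pos.mpr hβ1') hg hn) e2.le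
    rw [norm_mul, norm_mul]
    calc ‖T n m‖ * ‖phasePow (f m) (u z)‖ * ‖phasePow (g n) (v z)‖ ≤ ‖T n m‖ * 1 * 1 := by gcongr
      _ = ‖T n m‖ := by ring
  have ha : ∀ z ∈ Complex.re ⁻¹' {(0 : ℝ)}, ‖F z‖ ≤ C := fun z hz => by
    have hz : z.re = 0 := hz
    have hwz : (w z).re = α₀ := by rw [hw, hz]; ring
    exact h₀ _ _ (sum_norm_phasePow_rpow s f hα₀.1 hβ0 (by rw [hu, hwz]) hf)
      (sum_norm_phasePow_rpow s g (sub_pos.mpr hα₀.2) hβ1' (by rw [hv, hwz]) hg)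
  have hb : ∀ z ∈ Complex.re ⁻¹' {(1 : ℝ)}, ‖F z‖ ≤ C := fun z hz => by
    have hz : z.re = 1 := hz
    have hwz : (w z).re = α₁ := by rw [hw, hz]; ring
    exact h₁ _ _ (sum_norm_phasePow_rpow s f hα₁.1 hβ0 (by rw [hu, hwz]) hf)
      (sum_norm_phasePow_rpow s g (sub_pos.mpr hα₁.2) hβ1' (by rw [hv, hwz]) hg)
  have key := Complex.HadamardThreeLines.norm_le_interp_of_mem_verticalClosedStrip₀₁' F
    (z := (t : ℂ)) (by simpa [Complex.HadamardThreeLines.verticalClosedStrip] using ht)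
    hd.diffContOnCl hB ha hb
  have hwt : w t = β := by simp [w, hβ]
  have hut : u t = 1 := by
    simp only [u, hwt]; exact div_self (by exact_mod_cast hβ0.ne')
  have hvt : v t = 1 := by
    simp only [v, hwt]; push_cast; exact div_self (by exact_mod_cast hβ1'.ne')
  simp only [F, hut, hvt, phasePow_one, Complex.ofReal_re] at key
  rwa [← Real.rpow_add_of_nonneg hC (sub_nonneg.mpr ht.2) ht.1, sub_add_cancel,
    Real.rpow_one] at key

/-- The matrix `1 / (n - m)` of the discrete Hilbert transform, zero on the diagonal. -/
noncomputable def hilbertKernel (n m : ℤ) : ℂ := ((n : ℂ) - m)⁻¹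

/-- The discrete Hilbert transform of the restriction of `f` to the finite set `s`. -/
noncomputable def finHilbert (s : Finset ℤ) (f : ℤ → ℂ) (n : ℤ) : ℂ :=
  ∑ m ∈ s, hilbertKernel n m * f m

/-- The `ℓ^p` boundedness of the truncated Hilbert transforms, uniformly in the truncation. -/
def HilbertBound (p : ℝ) : Prop :=
  ∃ A : ℝ, 0 < A ∧ ∀ (s : Finset ℤ) (f : ℤ → ℂ),
    ∑ n ∈ s, ‖finHilbert s f n‖ ^ p ≤ A * ∑ m ∈ s, ‖f m‖ ^ p

theorem hilbertKernel_swap (n m : ℤ) : hilbertKernel m n = -hilbertKernel n m := by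
  rw [hilbertKernel, hilbertKernel, ← inv_neg, neg_sub]

theorem exists_sum_norm_hilbertKernel_sq_le :
    ∃ κ : ℝ, 0 < κ ∧ ∀ (s : Finset ℤ) (n : ℤ), ∑ m ∈ s, ‖hilbertKernel n m‖ ^ 2 ≤ κ := by
  have hs : Summable fun j : ℤ => ‖((j : ℂ))⁻¹‖ ^ 2 := by
    refine (Real.summable_one_div_int_pow.mpr one_lt_two).congr fun j => ?_
    rw [norm_inv, Complex.norm_intCast, inv_pow, sq_abs, one_div]
  refine ⟨∑' j : ℤ, ‖((j : ℂ))⁻¹‖ ^ 2, hs.tsum_pos (fun j => sq_nonneg _) 1 (by simp),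
    fun s n => ?_⟩
  have e : ∀ m : ℤ, ‖hilbertKernel n m‖ ^ 2 = ‖(((n - m : ℤ) : ℂ))⁻¹‖ ^ 2 := fun m => by
    rw [hilbertKernel, Int.cast_sub]
  simp_rw [e]
  generalize hg : (fun j : ℤ => ‖((j : ℂ))⁻¹‖ ^ 2) = g at hs
  have hg' : ∀ j : ℤ, ‖((j : ℂ))⁻¹‖ ^ 2 = g j := fun j => by rw [← hg]
  have hg0 : ∀ j, 0 ≤ g j := fun j => by rw [← hg']; exact sq_nonneg _
  simp_rw [hg']
  calc ∑ m ∈ s, g (n - m) ≤ ∑' m, g (n - m) :=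
        ((Equiv.subLeft n).summable_iff.mpr hs).sum_le_tsum s fun m _ => hg0 _
    _ = ∑' j, g j := (Equiv.subLeft n).tsum_eq g

theorem hilbertKernel_mul_hilbertKernel (n m l : ℤ) :
    hilbertKernel n m * hilbertKernel n l =
      hilbertKernel n m * hilbertKernel m l + hilbertKernel n l * hilbertKernel l m
      + (if m = l then hilbertKernel n m ^ 2 else 0)
      + (if n = m then hilbertKernel n l ^ 2 else 0)
      + (if n = l then hilbertKernel n m ^ 2 else 0) := by
  simp only [hilbertKernel]
  by_cases h1 : m = l
  · subst h1
    by_cases h2 : n = m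
    · subst h2; simp
    · simp [h2, sq]
  · by_cases h2 : n = m
    · subst h2
      have h3 : (n : ℂ) - l ≠ 0 := sub_ne_zero.mpr (by exact_mod_cast h1)
      have h4 : (l : ℂ) - n ≠ 0 := sub_ne_zero.mpr (by exact_mod_cast Ne.symm h1)
      simp [h1]
      field_simp
      ring
    · by_cases h3 : n = l
      · subst h3
        have h3 : (n : ℂ) - m ≠ 0 := sub_ne_zero.mpr (by exact_mod_cast h2)
        have h4 : (m : ℂ) - n ≠ 0 := sub_ne_zero.mpr (by exact_mod_cast h1)
        simp [h1, h2]
        field_simp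
        ring
      · have h4 : (n : ℂ) - m ≠ 0 := sub_ne_zero.mpr (by exact_mod_cast h2)
        have h5 : (n : ℂ) - l ≠ 0 := sub_ne_zero.mpr (by exact_mod_cast h3)
        have h6 : (m : ℂ) - l ≠ 0 := sub_ne_zero.mpr (by exact_mod_cast h1)
        have h7 : (l : ℂ) - m ≠ 0 := sub_ne_zero.mpr (by exact_mod_cast Ne.symm h1)
        simp [h1, h2, h3]
        field_simp
        ring

/-- The discrete form of Cotlar's identity. -/
theorem finHilbert_sq (s : Finset ℤ) (f : ℤ → ℂ) {n : ℤ} (hn : n ∈ s) :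
    finHilbert s f n ^ 2 = 2 * finHilbert s (fun m => f m * finHilbert s f m) n
      + ∑ m ∈ s, hilbertKernel n m ^ 2 * f m ^ 2
      + 2 * (f n * ∑ m ∈ s, hilbertKernel n m ^ 2 * f m) := by
  have e1 : finHilbert s f n ^ 2 =
      ∑ m ∈ s, ∑ l ∈ s, (hilbertKernel n m * hilbertKernel n l) * (f m * f l) := by
    rw [sq, finHilbert, Finset.sum_mul_sum]
    exact Finset.sum_congr rfl fun m _ => Finset.sum_congr rfl fun l _ => by ring
  have e2 : finHilbert s (fun m => f m * finHilbert s f m) n =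
      ∑ m ∈ s, ∑ l ∈ s, hilbertKernel n m * hilbertKernel m l * (f m * f l) := by
    simp only [finHilbert, Finset.mul_sum]
    exact Finset.sum_congr rfl fun m _ => Finset.sum_congr rfl fun l _ => by ring
  have e3 : finHilbert s (fun m => f m * finHilbert s f m) n =
      ∑ m ∈ s, ∑ l ∈ s, hilbertKernel n l * hilbertKernel l m * (f m * f l) := by
    rw [e2, Finset.sum_comm]
    exact Finset.sum_congr rfl fun m _ => Finset.sum_congr rfl fun l _ => by ring
  rw [e1]
  simp only [hilbertKernel_mul_hilbertKernel n, add_mul, Finset.sum_add_distrib]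
  rw [← e2, ← e3]
  simp only [ite_mul, zero_mul, Finset.sum_ite_eq, hn, if_true, Finset.sum_ite_irrel,
    Finset.sum_const_zero]
  have e4 : ∑ m ∈ s, (if m ∈ s then hilbertKernel n m ^ 2 * (f m * f m) else 0) =
      ∑ m ∈ s, hilbertKernel n m ^ 2 * f m ^ 2 :=
    Finset.sum_congr rfl fun m hm => by rw [if_pos hm]; ring
  have e5 : ∑ l ∈ s, hilbertKernel n l ^ 2 * (f n * f l) =
      f n * ∑ m ∈ s, hilbertKernel n m ^ 2 * f m := by
    rw [Finset.mul_sum]; exact Finset.sum_congr rfl fun m _ => by ring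
  have e6 : ∑ m ∈ s, hilbertKernel n m ^ 2 * (f m * f n) =
      f n * ∑ m ∈ s, hilbertKernel n m ^ 2 * f m := by
    rw [Finset.mul_sum]; exact Finset.sum_congr rfl fun m _ => by ring
  rw [e4, e5, e6]
  ring

theorem norm_finHilbert_sq_le {κ : ℝ} (s : Finset ℤ) (f : ℤ → ℂ) {n : ℤ} (hn : n ∈ s)
    (hκ : ∑ m ∈ s, ‖hilbertKernel n m‖ ^ 2 ≤ κ) :
    ‖finHilbert s f n‖ ^ 2 ≤ 2 * ‖finHilbert s (fun m => f m * finHilbert s f m) n‖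
      + κ * ‖f n‖ ^ 2 + 2 * ∑ m ∈ s, ‖hilbertKernel n m‖ ^ 2 * ‖f m‖ ^ 2 := by
  rw [← norm_pow, finHilbert_sq s f hn]
  have b1 : ‖∑ m ∈ s, hilbertKernel n m ^ 2 * f m ^ 2‖ ≤
      ∑ m ∈ s, ‖hilbertKernel n m‖ ^ 2 * ‖f m‖ ^ 2 :=
    norm_sum_le_of_le _ fun m _ => by rw [norm_mul, norm_pow, norm_pow]
  have b2 : ‖2 * (f n * ∑ m ∈ s, hilbertKernel n m ^ 2 * f m)‖ ≤
      κ * ‖f n‖ ^ 2 + ∑ m ∈ s, ‖hilbertKernel n m‖ ^ 2 * ‖f m‖ ^ 2 := by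
    calc ‖2 * (f n * ∑ m ∈ s, hilbertKernel n m ^ 2 * f m)‖
        ≤ ∑ m ∈ s, ‖hilbertKernel n m‖ ^ 2 * (‖f n‖ ^ 2 + ‖f m‖ ^ 2) := by
          rw [Finset.mul_sum, Finset.mul_sum]
          refine norm_sum_le_of_le _ fun m _ => ?_
          simp only [norm_mul, norm_pow, RCLike.norm_ofNat]
          nlinarith [mul_nonneg (sq_nonneg ‖hilbertKernel n m‖) (sq_nonneg (‖f n‖ - ‖f m‖))]
      _ = (∑ m ∈ s, ‖hilbertKernel n m‖ ^ 2) * ‖f n‖ ^ 2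
          + ∑ m ∈ s, ‖hilbertKernel n m‖ ^ 2 * ‖f m‖ ^ 2 := by
          simp only [mul_add, Finset.sum_add_distrib, Finset.sum_mul]
      _ ≤ _ := by gcongr
  refine (norm_add₃_le).trans ?_
  rw [norm_mul, RCLike.norm_ofNat]
  linarith

theorem weighted_sum_rpow_le {ι : Type*} (s : Finset ι) {p : ℝ} (hp : 1 ≤ p) {w a : ι → ℝ}
    (hw : ∀ i, 0 ≤ w i) (ha : ∀ i, 0 ≤ a i) :
    (∑ i ∈ s, w i * a i) ^ p ≤ (∑ i ∈ s, w i) ^ (p - 1) * ∑ i ∈ s, w i * a i ^ p := by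
  have hp0 : 0 < p := by linarith
  have hW : 0 ≤ ∑ i ∈ s, w i := Finset.sum_nonneg fun i _ => hw i
  have hV : 0 ≤ ∑ i ∈ s, w i * a i ^ p :=
    Finset.sum_nonneg fun i _ => mul_nonneg (hw i) (Real.rpow_nonneg (ha i) _)
  have h := Real.rpow_le_rpow (Finset.sum_nonneg fun i _ => mul_nonneg (hw i) (ha i))
    (Real.inner_le_weight_mul_Lp_of_nonneg s hp w a hw ha) hp0.le
  rw [Real.mul_rpow (by positivity) (by positivity), ← Real.rpow_mul hW, ← Real.rpow_mul hV,
    inv_mul_cancel₀ hp0.ne', Real.rpow_one, sub_mul, inv_mul_cancel₀ hp0.ne', one_mul] at h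
  exact h

theorem add_add_rpow_le {p a b c : ℝ} (hp : 1 ≤ p) (ha : 0 ≤ a) (hb : 0 ≤ b) (hc : 0 ≤ c) :
    (a + b + c) ^ p ≤ 3 ^ (p - 1) * (a ^ p + b ^ p + c ^ p) := by
  have h := Real.rpow_sum_le_const_mul_sum_rpow_of_nonneg (Finset.univ : Finset (Fin 3))
    (f := ![a, b, c]) hp (by intro i _; fin_cases i <;> simpa)
  simpa [Fin.sum_univ_three] using h

theorem HilbertBound.two_mul {p : ℝ} (hp : 1 ≤ p) (h : HilbertBound p) :
    HilbertBound (2 * p) := by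
  obtain ⟨A, hA, hAb⟩ := h
  obtain ⟨κ, hκ, hκb⟩ := exists_sum_norm_hilbertKernel_sq_le
  have hp0 : 0 ≤ p := by linarith
  have pow2 : ∀ x : ℝ, 0 ≤ x → (x ^ 2) ^ p = x ^ (2 * p) := fun x hx => by
    rw [Real.rpow_mul hx, Real.rpow_two]
  have pow2' : ∀ x : ℝ, 0 ≤ x → (x ^ p) ^ 2 = x ^ (2 * p) := fun x hx => by
    rw [mul_comm, Real.rpow_mul hx, Real.rpow_two]
  set D : ℝ := 3 ^ (p - 1) * 2 ^ p * A with hD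
  set E : ℝ := 3 ^ (p - 1) * (κ ^ p + 2 ^ p * (κ ^ (p - 1) * κ)) with hE
  refine ⟨D ^ 2 + 2 * E, by positivity, fun s f => ?_⟩
  set H := finHilbert s f
  set Y := ∑ m ∈ s, ‖f m‖ ^ (2 * p)
  have kbound : ∑ n ∈ s, (∑ m ∈ s, ‖hilbertKernel n m‖ ^ 2 * ‖f m‖ ^ 2) ^ p ≤
      κ ^ (p - 1) * κ * Y := by
    calc ∑ n ∈ s, (∑ m ∈ s, ‖hilbertKernel n m‖ ^ 2 * ‖f m‖ ^ 2) ^ p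
        ≤ ∑ n ∈ s, κ ^ (p - 1) * ∑ m ∈ s, ‖hilbertKernel n m‖ ^ 2 * (‖f m‖ ^ 2) ^ p := by
          refine Finset.sum_le_sum fun n _ => ?_
          refine (weighted_sum_rpow_le s hp (fun m => sq_nonneg ‖hilbertKernel n m‖)
            fun m => sq_nonneg ‖f m‖).trans ?_
          gcongr
          exact hκb s n
      _ = κ ^ (p - 1) * ∑ m ∈ s, (∑ n ∈ s, ‖hilbertKernel m n‖ ^ 2) * ‖f m‖ ^ (2 * p) := by
          rw [← Finset.mul_sum, Finset.sum_comm]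
          congr 1
          refine Finset.sum_congr rfl fun m _ => ?_
          rw [Finset.sum_mul]
          refine Finset.sum_congr rfl fun n _ => ?_
          rw [hilbertKernel_swap n m, norm_neg, pow2 _ (norm_nonneg _)]
      _ ≤ κ ^ (p - 1) * ∑ m ∈ s, κ * ‖f m‖ ^ (2 * p) := by
          gcongr with m hm
          exact hκb s m
      _ = _ := by rw [← Finset.mul_sum, mul_assoc]
  have main : ∑ n ∈ s, ‖H n‖ ^ (2 * p) ≤
      D * ∑ m ∈ s, ‖f m * H m‖ ^ p + E * Y := by
    calc ∑ n ∈ s, ‖H n‖ ^ (2 * p)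
        ≤ ∑ n ∈ s, 3 ^ (p - 1) * (2 ^ p * ‖finHilbert s (fun m => f m * H m) n‖ ^ p
          + κ ^ p * ‖f n‖ ^ (2 * p)
          + 2 ^ p * (∑ m ∈ s, ‖hilbertKernel n m‖ ^ 2 * ‖f m‖ ^ 2) ^ p) := by
          refine Finset.sum_le_sum fun n hn => ?_
          have hS : 0 ≤ ∑ m ∈ s, ‖hilbertKernel n m‖ ^ 2 * ‖f m‖ ^ 2 :=
            Finset.sum_nonneg fun m _ => by positivity
          rw [← pow2 _ (norm_nonneg _), ← pow2 _ (norm_nonneg _),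
            ← Real.mul_rpow (by positivity) (by positivity),
            ← Real.mul_rpow (by positivity) (by positivity), ← Real.mul_rpow (by positivity) hS]
          exact (Real.rpow_le_rpow (by positivity)
            (norm_finHilbert_sq_le s f hn (hκb s n)) hp0).trans
            (add_add_rpow_le hp (by positivity) (by positivity) (by positivity))
      _ = 3 ^ (p - 1) * (2 ^ p * ∑ n ∈ s, ‖finHilbert s (fun m => f m * H m) n‖ ^ p
          + κ ^ p * Y
          + 2 ^ p * ∑ n ∈ s, (∑ m ∈ s, ‖hilbertKernel n m‖ ^ 2 * ‖f m‖ ^ 2) ^ p) := by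
          simp only [← Finset.mul_sum, Finset.sum_add_distrib, Y]
      _ ≤ 3 ^ (p - 1) * (2 ^ p * (A * ∑ m ∈ s, ‖f m * H m‖ ^ p)
          + κ ^ p * Y + 2 ^ p * (κ ^ (p - 1) * κ * Y)) := by
          gcongr
          exact hAb s _
      _ = _ := by rw [hD, hE]; ring
  have amgm : D * ∑ m ∈ s, ‖f m * H m‖ ^ p ≤
      D ^ 2 / 2 * Y + 1 / 2 * ∑ m ∈ s, ‖H m‖ ^ (2 * p) := by
    rw [Finset.mul_sum, Finset.mul_sum, Finset.mul_sum, ← Finset.sum_add_distrib]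
    refine Finset.sum_le_sum fun m _ => ?_
    rw [norm_mul, Real.mul_rpow (norm_nonneg _) (norm_nonneg _), ← pow2' _ (norm_nonneg _),
      ← pow2' _ (norm_nonneg _)]
    nlinarith [sq_nonneg (D * ‖f m‖ ^ p - ‖H m‖ ^ p)]
  linarith

/-- The character `x ↦ e^{2π i j x}`. -/
noncomputable def expChar (j : ℤ) (x : ℝ) : ℂ := Complex.exp (2 * π * Complex.I * j * x)

theorem continuous_expChar (j : ℤ) : Continuous (expChar j) := by
  unfold expChar; fun_prop

theorem expChar_mul (j k : ℤ) (x : ℝ) : expChar j x * expChar k x = expChar (j + k) x := by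
  rw [expChar, expChar, expChar, ← Complex.exp_add]; push_cast; ring_nf

theorem conj_expChar (j : ℤ) (x : ℝ) : (starRingEnd ℂ) (expChar j x) = expChar (-j) x := by
  rw [expChar, expChar, ← Complex.exp_conj]
  simp [map_ofNat]

theorem norm_expChar (j : ℤ) (x : ℝ) : ‖expChar j x‖ = 1 := by
  rw [expChar, show (2 * π * Complex.I * j * x : ℂ) = ((2 * π * j * x : ℝ) : ℂ) * Complex.I by
    push_cast; ring]
  exact Complex.norm_exp_ofReal_mul_I _

theorem integral_expChar_of_ne_zero {j : ℤ} (hj : j ≠ 0) (b : ℝ) :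
    ∫ x in (0 : ℝ)..b, expChar j x = (expChar j b - 1) / (2 * π * Complex.I * j) := by
  have h : (2 * π * Complex.I * j : ℂ) ≠ 0 := by
    simp [Real.pi_ne_zero, hj]
  have := integral_exp_mul_complex (a := 0) (b := b) h
  simpa [expChar] using this

theorem integral_expChar_zero_one (j : ℤ) :
    ∫ x in (0 : ℝ)..1, expChar j x = if j = 0 then 1 else 0 := by
  split_ifs with hj
  · simp [hj, expChar]
  · rw [integral_expChar_of_ne_zero hj]
    have : expChar j 1 = 1 := by
      rw [expChar, Complex.exp_eq_one_iff]
      exact ⟨j, by push_cast; ring⟩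
    simp [this]

theorem integral_norm_sq_sum_expChar {ι : Type*} [DecidableEq ι] (s : Finset ι) (f : ι → ℂ)
    {e : ι → ℤ} (he : Function.Injective e) :
    ∫ x in (0 : ℝ)..1, ‖∑ m ∈ s, f m * expChar (e m) x‖ ^ 2 = ∑ m ∈ s, ‖f m‖ ^ 2 := by
  have key : ∀ x : ℝ, ((‖∑ m ∈ s, f m * expChar (e m) x‖ ^ 2 : ℝ) : ℂ) =
      ∑ m ∈ s, ∑ l ∈ s, (f m * (starRingEnd ℂ) (f l)) * expChar (e m - e l) x := fun x => by
    push_cast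
    rw [← Complex.mul_conj', map_sum, Finset.sum_mul_sum]
    refine Finset.sum_congr rfl fun m _ => Finset.sum_congr rfl fun l _ => ?_
    rw [map_mul, conj_expChar, sub_eq_add_neg, ← expChar_mul]
    ring
  have hc : ∀ m l, Continuous fun x => (f m * (starRingEnd ℂ) (f l)) * expChar (e m - e l) x :=
    fun m l => continuous_const.mul (continuous_expChar _)
  apply Complex.ofReal_injective
  rw [← intervalIntegral.integral_ofReal]
  simp_rw [key]
  rw [intervalIntegral.integral_finsetSum fun m _ =>
    (continuous_finsetSum s fun l _ => hc m l).intervalIntegrable _ _]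
  push_cast
  refine Finset.sum_congr rfl fun m hm => ?_
  rw [intervalIntegral.integral_finsetSum fun l _ => (hc m l).intervalIntegrable _ _]
  simp_rw [intervalIntegral.integral_const_mul, integral_expChar_zero_one, sub_eq_zero,
    he.eq_iff, mul_ite, mul_one, mul_zero]
  rw [Finset.sum_ite_eq, if_pos hm, Complex.mul_conj']

theorem hilbertKernel_eq_integral (n m : ℤ) :
    hilbertKernel n m = -(2 * π * Complex.I) *
      ∫ x in (0 : ℝ)..1, ((x - 1 / 2 : ℝ) : ℂ) * (expChar m x * expChar (-n) x) := by
  have h := bernoulliFourierCoeff_eq one_ne_zero (n - m)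
  rw [bernoulliFourierCoeff, fourierCoeffOn_eq_integral] at h
  have e : ∀ x : ℝ, fourier (-(n - m)) (x : AddCircle ((1 : ℝ) - 0)) • ((bernoulliFun 1 x : ℝ) : ℂ)
      = ((x - 1 / 2 : ℝ) : ℂ) * (expChar m x * expChar (-n) x) := fun x => by
    rw [fourier_coe_apply, bernoulliFun_one, expChar_mul, expChar, smul_eq_mul, mul_comm]
    congr 2
    push_cast; ring
  simp_rw [e] at h
  simp only [sub_zero, div_one, one_smul, Nat.factorial_one, Nat.cast_one, pow_one] at h
  rw [h, hilbertKernel]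
  push_cast
  have : (2 * π * Complex.I : ℂ) ≠ 0 := Complex.two_pi_I_ne_zero
  rw [neg_mul, ← mul_div_assoc, mul_neg, mul_one, neg_div, neg_neg, ← div_div, div_self this,
    one_div]

theorem formBound_hilbertKernel_half (s : Finset ℤ) : FormBound hilbertKernel s π (1 / 2) := by
  intro f g hf hg
  norm_num at hf hg
  let F : ℝ → ℂ := fun x => ∑ m ∈ s, f m * expChar m x
  let G : ℝ → ℂ := fun x => ∑ n ∈ s, g n * expChar (-n) x
  have hF : Continuous F :=
    continuous_finsetSum _ fun m _ => continuous_const.mul (continuous_expChar _)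
  have hG : Continuous G :=
    continuous_finsetSum _ fun m _ => continuous_const.mul (continuous_expChar _)
  have hFi : ∫ x in (0 : ℝ)..1, ‖F x‖ ^ 2 ≤ 1 :=
    (integral_norm_sq_sum_expChar s f (e := fun m => m) Function.injective_id).trans_le hf
  have hGi : ∫ x in (0 : ℝ)..1, ‖G x‖ ^ 2 ≤ 1 :=
    (integral_norm_sq_sum_expChar s g (e := fun m => -m) neg_injective).trans_le hg
  have hc : ∀ n m : ℤ, Continuous fun x : ℝ => ((x - 1 / 2 : ℝ) : ℂ) *
      (f m * expChar m x * (g n * expChar (-n) x)) := fun n m => by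
    have := continuous_expChar m
    have := continuous_expChar (-n)
    fun_prop
  have key : ∑ n ∈ s, ∑ m ∈ s, hilbertKernel n m * f m * g n =
      -(2 * π * Complex.I) * ∫ x in (0 : ℝ)..1, ((x - 1 / 2 : ℝ) : ℂ) * (F x * G x) := by
    have e1 : ∀ x : ℝ, ((x - 1 / 2 : ℝ) : ℂ) * (F x * G x) = ∑ n ∈ s, ∑ m ∈ s,
        ((x - 1 / 2 : ℝ) : ℂ) * (f m * expChar m x * (g n * expChar (-n) x)) := fun x => by
      simp only [F, G]
      rw [Finset.sum_mul_sum, Finset.sum_comm]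
      simp only [Finset.mul_sum]
    simp_rw [e1]
    rw [intervalIntegral.integral_finsetSum fun n _ =>
      (continuous_finsetSum s fun m _ => hc n m).intervalIntegrable _ _, Finset.mul_sum]
    refine Finset.sum_congr rfl fun n _ => ?_
    rw [intervalIntegral.integral_finsetSum fun m _ => (hc n m).intervalIntegrable _ _,
      Finset.mul_sum]
    refine Finset.sum_congr rfl fun m _ => ?_
    rw [hilbertKernel_eq_integral, mul_assoc, mul_assoc, ← intervalIntegral.integral_mul_const]
    congr 2
    ext x
    ring
  have bound : ‖∫ x in (0 : ℝ)..1, ((x - 1 / 2 : ℝ) : ℂ) * (F x * G x)‖ ≤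
      ∫ x in (0 : ℝ)..1, (1 / 4 * ‖F x‖ ^ 2 + 1 / 4 * ‖G x‖ ^ 2) := by
    refine intervalIntegral.norm_integral_le_of_norm_le zero_le_one
      (Filter.Eventually.of_forall fun x hx => ?_)
      (Continuous.intervalIntegrable (by fun_prop) _ _)
    have hx' : |x - 1 / 2| ≤ 1 / 2 := abs_le.mpr ⟨by linarith [hx.1], by linarith [hx.2]⟩
    rw [norm_mul, norm_mul, Complex.norm_real, Real.norm_eq_abs]
    calc |x - 1 / 2| * (‖F x‖ * ‖G x‖) ≤ 1 / 2 * (‖F x‖ * ‖G x‖) := by gcongr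
      _ ≤ _ := by nlinarith [sq_nonneg (‖F x‖ - ‖G x‖)]
  rw [intervalIntegral.integral_add (Continuous.intervalIntegrable (by fun_prop) _ _)
    (Continuous.intervalIntegrable (by fun_prop) _ _), intervalIntegral.integral_const_mul,
    intervalIntegral.integral_const_mul] at bound
  have hpi := Real.pi_pos
  have h2 : ‖-(2 * π * Complex.I : ℂ)‖ = 2 * π := by
    simp [abs_of_pos hpi]
  rw [key, norm_mul, h2]
  nlinarith

/-- A bound for the bilinear form gives a bound for the operator. -/
theorem hilbertBound_of_formBound {p C : ℝ} (hp : 1 < p)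
    (h : ∀ s, FormBound hilbertKernel s C (1 / p)) : HilbertBound p := by
  have hp0 : 0 < p := by linarith
  have hC : 0 ≤ C := by simpa using h ∅ 0 0 (by simp) (by simp)
  refine ⟨(C + 1) ^ p, by positivity, fun s f => ?_⟩
  have hle : C ^ p ≤ (C + 1) ^ p := by gcongr; linarith
  set H := finHilbert s f with hH
  set S := ∑ n ∈ s, ‖H n‖ ^ p with hS
  set Y := ∑ m ∈ s, ‖f m‖ ^ p with hY
  have hS0 : 0 ≤ S := Finset.sum_nonneg fun n _ => by positivity
  have hY0 : 0 ≤ Y := Finset.sum_nonneg fun n _ => by positivity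
  rcases hS0.eq_or_lt with hS1 | hS1
  · rw [← hS1]; positivity
  rcases hY0.eq_or_lt with hY1 | hY1
  · exfalso
    have hf : ∀ m ∈ s, f m = 0 := fun m hm => by
      have := (Finset.sum_eq_zero_iff_of_nonneg fun i _ => by positivity).mp hY1.symm m hm
      simpa [Real.rpow_eq_zero (norm_nonneg _) hp0.ne'] using this
    have hH0 : ∀ n, H n = 0 := fun n => Finset.sum_eq_zero fun m hm => by rw [hf m hm, mul_zero]
    simp [hS, hH0, Real.zero_rpow hp0.ne'] at hS1
  set q := 1 / (1 - 1 / p) with hq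
  have hq' : q = p / (p - 1) := by
    have : p - 1 ≠ 0 := by linarith
    rw [hq]; field_simp
  have hp1 : 0 < p - 1 := by linarith
  have hq0 : 0 < q := by rw [hq']; positivity
  let c : ℝ := Y ^ (-(1 / p))
  let d : ℝ := S ^ (-(1 / q))
  have hc : 0 < c := Real.rpow_pos_of_pos hY1 _
  have hd : 0 < d := Real.rpow_pos_of_pos hS1 _
  let g : ℤ → ℂ := fun n => (starRingEnd ℂ) (H n) * ((‖H n‖ ^ (p - 2) : ℝ) : ℂ)
  have hg : ∀ n, ‖g n‖ ^ q = ‖H n‖ ^ p := fun n => by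
    rcases eq_or_ne (H n) 0 with h0 | h0
    · simp [g, h0, Real.zero_rpow hp0.ne', Real.zero_rpow hq0.ne']
    · have hn : 0 < ‖H n‖ := norm_pos_iff.mpr h0
      have : ‖g n‖ = ‖H n‖ ^ (p - 1) := by
        simp only [g, norm_mul, RCLike.norm_conj, Complex.norm_real]
        rw [Real.norm_of_nonneg (by positivity), ← Real.rpow_one_add' hn.le (by linarith)]
        ring_nf
      rw [this, ← Real.rpow_mul hn.le, hq']
      congr 1; field_simp
  have hHg : ∀ n, H n * g n = ((‖H n‖ ^ p : ℝ) : ℂ) := fun n => by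
    rcases eq_or_ne (H n) 0 with h0 | h0
    · simp [h0, Real.zero_rpow hp0.ne']
    · have hn : 0 < ‖H n‖ := norm_pos_iff.mpr h0
      simp only [g]
      rw [← mul_assoc, Complex.mul_conj', ← Complex.ofReal_pow, ← Complex.ofReal_mul,
        ← Real.rpow_natCast, ← Real.rpow_add hn]
      norm_num
  have key := h s (fun m => c * f m) (fun n => d * g n) (by
    simp only [norm_mul, Complex.norm_real, Real.norm_of_nonneg hc.le, one_div_one_div]
    simp_rw [Real.mul_rpow hc.le (norm_nonneg _)]
    rw [← Finset.mul_sum, ← Real.rpow_mul hY0, neg_mul, one_div_mul_cancel hp0.ne',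
      Real.rpow_neg_one, inv_mul_cancel₀ hY1.ne']) (by
    simp only [norm_mul, Complex.norm_real, Real.norm_of_nonneg hd.le]
    rw [← hq]
    simp_rw [Real.mul_rpow hd.le (norm_nonneg _), hg]
    rw [← Finset.mul_sum, ← Real.rpow_mul hS0, neg_mul, one_div_mul_cancel hq0.ne',
      Real.rpow_neg_one, inv_mul_cancel₀ hS1.ne'])
  have e : ∑ n ∈ s, ∑ m ∈ s, hilbertKernel n m * (c * f m) * (d * g n) = ((c * d * S : ℝ) : ℂ) := by
    rw [hS]
    rw [Complex.ofReal_mul, Complex.ofReal_mul, Complex.ofReal_sum, Finset.mul_sum]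
    refine Finset.sum_congr rfl fun n _ => ?_
    rw [← hHg, hH, finHilbert, Finset.sum_mul,
      Finset.mul_sum]
    exact Finset.sum_congr rfl fun m _ => by ring
  rw [e, Complex.norm_real, Real.norm_of_nonneg (by positivity)] at key
  have e2 : c * d * S = (S / Y) ^ (1 / p) := by
    have : d * S = S ^ (1 / p) := by
      simp only [d]
      rw [← Real.rpow_add_one hS1.ne', hq]
      congr 1
      rw [one_div_one_div]; ring
    rw [mul_assoc, this, Real.div_rpow hS0 hY0, div_eq_mul_inv (S ^ _), ← Real.rpow_neg hY0, mul_comm]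
  rw [e2] at key
  have h3 := Real.rpow_le_rpow (by positivity) key hp0.le
  rw [← Real.rpow_mul (by positivity), one_div_mul_cancel hp0.ne', Real.rpow_one,
    div_le_iff₀ hY1] at h3
  exact h3.trans (by gcongr)

/-- A bound for the operator gives bounds for the bilinear form at both dual exponents. -/
theorem HilbertBound.exists_formBound {p : ℝ} (hp : 1 < p) (h : HilbertBound p) :
    ∃ C, ∀ s, FormBound hilbertKernel s C (1 / p) ∧
      FormBound hilbertKernel s C (1 - 1 / p) := by
  obtain ⟨A, hA, hAb⟩ := h
  have hp0 : 0 < p := by linarith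
  set q := 1 / (1 - 1 / p) with hq
  have hpq : p.HolderConjugate q := by
    rw [Real.holderConjugate_iff]
    refine ⟨hp, ?_⟩
    rw [hq]; simp
  have main : ∀ (s : Finset ℤ) (f g : ℤ → ℂ), ∑ m ∈ s, ‖f m‖ ^ p ≤ 1 → ∑ n ∈ s, ‖g n‖ ^ q ≤ 1 →
      ‖∑ n ∈ s, ∑ m ∈ s, hilbertKernel n m * f m * g n‖ ≤ A / p + 1 / q := by
    intro s f g hf hg
    calc ‖∑ n ∈ s, ∑ m ∈ s, hilbertKernel n m * f m * g n‖
        ≤ ∑ n ∈ s, (‖finHilbert s f n‖ ^ p / p + ‖g n‖ ^ q / q) := by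
          refine norm_sum_le_of_le _ fun n _ => ?_
          rw [← Finset.sum_mul, norm_mul]
          exact Real.young_inequality_of_nonneg (norm_nonneg _) (norm_nonneg _) hpq
      _ = (∑ n ∈ s, ‖finHilbert s f n‖ ^ p) / p + (∑ n ∈ s, ‖g n‖ ^ q) / q := by
          rw [Finset.sum_add_distrib, Finset.sum_div, Finset.sum_div]
      _ ≤ A / p + 1 / q := by
          have := hpq.symm.pos
          gcongr
          calc _ ≤ A * ∑ m ∈ s, ‖f m‖ ^ p := hAb s f
            _ ≤ A * 1 := by gcongr
            _ = A := mul_one A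
  refine ⟨A / p + 1 / q, fun s => ⟨fun f g hf hg => ?_, fun f g hf hg => ?_⟩⟩
  · rw [one_div_one_div] at hf
    exact main s f g hf hg
  · rw [sub_sub_cancel, one_div_one_div] at hg
    have := main s g f hg hf
    rwa [Finset.sum_comm, ← norm_neg, ← Finset.sum_neg_distrib, show
      ∑ m ∈ s, -∑ n ∈ s, hilbertKernel n m * f m * g n =
        ∑ m ∈ s, ∑ n ∈ s, hilbertKernel m n * g n * f m from
      Finset.sum_congr rfl fun m _ => by
        rw [← Finset.sum_neg_distrib]
        exact Finset.sum_congr rfl fun n _ => by rw [hilbertKernel_swap n m]; ring]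

theorem hilbertBound_two_pow (k : ℕ) : HilbertBound (2 ^ (k + 1)) := by
  induction k with
  | zero =>
    norm_num
    exact hilbertBound_of_formBound one_lt_two formBound_hilbertKernel_half
  | succ k ih =>
    rw [pow_succ']
    exact ih.two_mul (one_le_pow₀ one_le_two)

/-- The `ℓ^p` boundedness of the truncated discrete Hilbert transforms. -/
theorem hilbertBound {p : ℝ} (hp : 1 < p) : HilbertBound p := by
  have hp0 : 0 < p := by linarith
  have hp1 : 0 < 1 - 1 / p := by rw [sub_pos, div_lt_one hp0]; exact hp
  have hp1' : 0 < 1 / p := by positivity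
  obtain ⟨k, hk⟩ := pow_unbounded_of_one_lt (max p (1 / (1 - 1 / p))) one_lt_two
  set a : ℝ := 2 ^ (k + 1) with ha
  have hak : (2 : ℝ) ^ k < a := pow_lt_pow_right₀ one_lt_two k.lt_succ_self
  have h1 : p < a := (le_max_left _ _).trans_lt (hk.trans hak)
  have h2 : 1 / (1 - 1 / p) < a := (le_max_right _ _).trans_lt (hk.trans hak)
  have ha0 : 0 < a := by linarith
  have h1' : 1 / a < 1 / p := one_div_lt_one_div_of_lt hp0 h1
  have h2' : 1 / a < 1 - 1 / p := by
    have := one_div_lt_one_div_of_lt (by positivity) h2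
    rwa [one_div_one_div] at this
  have ha0' : 0 < 1 / a := by positivity
  obtain ⟨C, hC⟩ := (hilbertBound_two_pow k).exists_formBound (hp.trans h1)
  refine hilbertBound_of_formBound hp (C := C) fun s => ?_
  obtain ⟨b0, b1⟩ := hC s
  have hne : 0 < 1 - 2 * (1 / a) := by linarith
  have := b0.interpolate b1 (t := (1 / p - 1 / a) / (1 - 2 * (1 / a)))
    ⟨ha0', by linarith⟩ ⟨by linarith, by linarith⟩
    ⟨div_nonneg (by linarith) hne.le, by rw [div_le_one hne]; linarith⟩
  convert this using 1
  rw [show ∀ t : ℝ, (1 - t) * (1 / a) + t * (1 - 1 / a) = 1 / a + t * (1 - 2 * (1 / a)) from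
    fun t => by ring, div_mul_cancel₀ _ hne.ne']
  ring

theorem norm_hilbertKernel_le_one (n m : ℤ) : ‖hilbertKernel n m‖ ≤ 1 := by
  rw [hilbertKernel, ← Int.cast_sub, norm_inv, Complex.norm_intCast]
  rcases eq_or_ne (n - m) 0 with h | h
  · simp [h]
  · exact inv_le_one_of_one_le₀ (by exact_mod_cast Int.one_le_abs h)

theorem summable_hilbertKernel_mul {g : ℤ → ℂ} (hg : Summable fun m => ‖g m‖) (n : ℤ) :
    Summable fun m => hilbertKernel n m * g m := by
  refine Summable.of_norm_bounded hg fun m => ?_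
  rw [norm_mul]
  exact mul_le_of_le_one_left (norm_nonneg _) (norm_hilbertKernel_le_one n m)

theorem summable_norm_rpow {g : ℤ → ℂ} (hg : Summable fun m => ‖g m‖) {p : ℝ} (hp : 1 ≤ p) :
    Summable fun m => ‖g m‖ ^ p := by
  refine Summable.of_norm_bounded_eventually hg ?_
  filter_upwards [hg.tendsto_cofinite_zero.eventually_le_const one_pos] with m hm
  rw [Real.norm_of_nonneg (by positivity)]
  exact Real.rpow_le_self_of_le_one (norm_nonneg _) hm hp

theorem sum_norm_tsum_hilbertKernel_rpow_le {p A : ℝ} (hp : 1 ≤ p) (hA : 0 ≤ A)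
    (h : ∀ (s : Finset ℤ) (f : ℤ → ℂ),
      ∑ n ∈ s, ‖finHilbert s f n‖ ^ p ≤ A * ∑ m ∈ s, ‖f m‖ ^ p)
    {g : ℤ → ℂ} (hg : Summable fun m => ‖g m‖) (N : Finset ℤ) :
    ∑ n ∈ N, ‖∑' m, hilbertKernel n m * g m‖ ^ p ≤ A * ∑' m, ‖g m‖ ^ p := by
  have hp0 : 0 ≤ p := by linarith
  have ht : Filter.Tendsto (fun s : Finset ℤ => ∑ n ∈ N, ‖finHilbert s g n‖ ^ p) Filter.atTop
      (nhds (∑ n ∈ N, ‖∑' m, hilbertKernel n m * g m‖ ^ p)) :=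
    tendsto_finsetSum _ fun n _ =>
      (Filter.Tendsto.norm (summable_hilbertKernel_mul hg n).hasSum).rpow_const (Or.inr hp0)
  refine le_of_tendsto ht ?_
  filter_upwards [Filter.eventually_ge_atTop N] with s hs
  calc ∑ n ∈ N, ‖finHilbert s g n‖ ^ p ≤ ∑ n ∈ s, ‖finHilbert s g n‖ ^ p :=
        Finset.sum_le_sum_of_subset_of_nonneg hs fun n _ _ => by positivity
    _ ≤ A * ∑ m ∈ s, ‖g m‖ ^ p := h s g
    _ ≤ A * ∑' m, ‖g m‖ ^ p := by
        gcongr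
        exact (summable_norm_rpow hg hp).sum_le_tsum s fun m _ => by positivity

theorem integral_expChar_half (j : ℤ) :
    ∫ x in (0 : ℝ)..(1 / 2), expChar j x =
      (if j = 0 then 1 / 2 else 0) + (2 * π * Complex.I)⁻¹ * (((-1) ^ j - 1) * (j : ℂ)⁻¹) := by
  split_ifs with hj
  · simp [hj, expChar]
  · rw [integral_expChar_of_ne_zero hj]
    have : expChar j (1 / 2 : ℝ) = (-1) ^ j := by
      rw [expChar, ← Complex.exp_pi_mul_I, ← Complex.exp_int_mul]
      congr 1; push_cast; ring
    rw [this, zero_add, div_eq_mul_inv, mul_inv]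
    ring

theorem Hop_eq_tsum {f : ℤ → ℂ} (hf : Summable fun n => ‖f n‖) (n : ℤ) :
    Hop f n = ∑' m, f m * ∫ x in (0 : ℝ)..(1 / 2), expChar (m + n) x := by
  have e : ∀ x : ℝ, Ft1 f x * Complex.exp (2 * Real.pi * Complex.I * (x : ℂ) * (n : ℂ)) =
      ∑' m, f m * expChar (m + n) x := fun x => by
    rw [Ft1, ← tsum_mul_right]
    refine tsum_congr fun m => ?_
    rw [← expChar_mul, expChar, expChar, mul_assoc]
    congr 3
    ring
  have hs : ∀ x, Summable fun m => f m * expChar (m + n) x := fun x =>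
    Summable.of_norm_bounded hf fun m => by rw [norm_mul, norm_expChar, mul_one]
  rw [Hop]
  simp_rw [e, ← intervalIntegral.integral_const_mul]
  refine (intervalIntegral.hasSum_integral_of_dominated_convergence (fun m _ => ‖f m‖)
    (fun m => ?_) (fun m => ?_) ?_ ?_ ?_).tsum_eq.symm
  · exact (continuous_const.mul (continuous_expChar _)).aestronglyMeasurable
  · exact Filter.Eventually.of_forall fun x _ => by rw [norm_mul, norm_expChar, mul_one]
  · exact Filter.Eventually.of_forall fun x _ => hf
  · exact intervalIntegrable_const
  · exact Filter.Eventually.of_forall fun x _ => (hs x).hasSum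

theorem Hop_eq_hilbert {f : ℤ → ℂ} (hf : Summable fun n => ‖f n‖) (n : ℤ) :
    Hop f n = f (-n) / 2 + (2 * π * Complex.I)⁻¹ *
      ((-1) ^ n * ∑' m, hilbertKernel n m * ((-1) ^ m * f (-m))
        - ∑' m, hilbertKernel n m * f (-m)) := by
  have hg : Summable fun m => ‖f (-m)‖ := (Equiv.neg ℤ).summable_iff.mpr hf
  have hg' : Summable fun m => ‖(-1) ^ m * f (-m)‖ := by simpa using hg
  have h1 := summable_hilbertKernel_mul hg n
  have h2 := summable_hilbertKernel_mul hg' n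
  have hδ : HasSum (fun m : ℤ => if m = n then f (-n) / 2 else 0) (f (-n) / 2) :=
    hasSum_ite_eq n _
  rw [Hop_eq_tsum hf, ← (Equiv.neg ℤ).tsum_eq]
  refine Eq.trans (tsum_congr fun m => ?_)
    (hδ.add (((h2.hasSum.mul_left _).sub h1.hasSum).mul_left _)).tsum_eq
  have hpow : ((-1 : ℂ)) ^ (-m + n) = (-1) ^ n * (-1) ^ m := by
    rw [zpow_add₀ (by norm_num), zpow_neg, ← inv_zpow, mul_comm]
    norm_num
  have hk : ((-m + n : ℤ) : ℂ)⁻¹ = hilbertKernel n m := by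
    rw [hilbertKernel]; push_cast; ring_nf
  have hz : -m + n = 0 ↔ m = n := by omega
  rw [Equiv.neg_apply, integral_expChar_half, hpow, hk]
  simp only [hz]
  split_ifs with h
  · subst h; ring
  · ring

theorem norm_Hop_le {f : ℤ → ℂ} (hf : Summable fun n => ‖f n‖) (n : ℤ) :
    ‖Hop f n‖ ≤ ‖f (-n)‖ + ‖∑' m, hilbertKernel n m * ((-1) ^ m * f (-m))‖
      + ‖∑' m, hilbertKernel n m * f (-m)‖ := by
  have hpi : ‖(2 * π * Complex.I : ℂ)⁻¹‖ ≤ 1 := by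
    have : ‖(2 * π * Complex.I : ℂ)‖ = 2 * π := by simp [abs_of_pos Real.pi_pos]
    rw [norm_inv, this]
    exact inv_le_one_of_one_le₀ (by linarith [Real.pi_gt_three])
  rw [Hop_eq_hilbert hf, add_assoc]
  refine (norm_add_le _ _).trans (add_le_add ?_ ?_)
  · rw [norm_div, RCLike.norm_ofNat]
    linarith [norm_nonneg (f (-n))]
  · rw [norm_mul]
    refine (mul_le_of_le_one_left (norm_nonneg _) hpi).trans ((norm_sub_le _ _).trans_eq ?_)
    simp

theorem sum_norm_Hop_rpow_le {p : ℝ} (hp : 1 < p) :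
    ∃ B : ℝ, 0 < B ∧ ∀ f : ℤ → ℂ, Summable (fun n => ‖f n‖) → ∀ N : Finset ℤ,
      ∑ n ∈ N, ‖Hop f n‖ ^ p ≤ B * ∑' n, ‖f n‖ ^ p := by
  obtain ⟨A, hA, hAb⟩ := hilbertBound hp
  refine ⟨3 ^ (p - 1) * (1 + A + A), by positivity, fun f hf N => ?_⟩
  have hg : Summable fun m => ‖f (-m)‖ := (Equiv.neg ℤ).summable_iff.mpr hf
  have hg' : Summable fun m => ‖(-1) ^ m * f (-m)‖ := by simpa using hg
  have e1 : ∑' m, ‖f (-m)‖ ^ p = ∑' m, ‖f m‖ ^ p := (Equiv.neg ℤ).tsum_eq fun m => ‖f m‖ ^ p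
  have b1 : ∑ n ∈ N, ‖f (-n)‖ ^ p ≤ ∑' m, ‖f m‖ ^ p :=
    ((summable_norm_rpow hg hp.le).sum_le_tsum N fun m _ => by positivity).trans_eq e1
  have b2 := sum_norm_tsum_hilbertKernel_rpow_le hp.le hA.le hAb hg' N
  have b3 := sum_norm_tsum_hilbertKernel_rpow_le hp.le hA.le hAb hg N
  simp only [norm_mul, norm_zpow, norm_neg, norm_one, one_zpow, one_mul] at b2
  rw [e1] at b2 b3
  calc ∑ n ∈ N, ‖Hop f n‖ ^ p
      ≤ ∑ n ∈ N, 3 ^ (p - 1) * (‖f (-n)‖ ^ p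
        + ‖∑' m, hilbertKernel n m * ((-1) ^ m * f (-m))‖ ^ p
        + ‖∑' m, hilbertKernel n m * f (-m)‖ ^ p) := by
        refine Finset.sum_le_sum fun n _ => ?_
        exact (Real.rpow_le_rpow (norm_nonneg _) (norm_Hop_le hf n) (by linarith)).trans
          (add_add_rpow_le hp.le (norm_nonneg _) (norm_nonneg _) (norm_nonneg _))
    _ ≤ 3 ^ (p - 1) * (∑' m, ‖f m‖ ^ p + A * ∑' m, ‖f m‖ ^ p + A * ∑' m, ‖f m‖ ^ p) := by
        rw [← Finset.mul_sum, Finset.sum_add_distrib, Finset.sum_add_distrib]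
        gcongr
    _ = _ := by ring

/-- **`ℓ^p` boundedness of the projection onto positive frequencies on `ℤ`**
(a consequence of the `ℓ^p` boundedness of the discrete Hilbert transform):
for `1 < p < ∞` there is `C_p` with `‖H f‖_{ℓ^p} ≤ C_p ‖f‖_{ℓ^p}` for all `f ∈ ℓ¹(ℤ)`. -/
theorem stmt2 (p : ℝ) (hp : 1 < p) :
    ∃ C : ℝ, 0 < C ∧
      ∀ f : ℤ → ℂ, Summable (fun n => ‖f n‖) →
        lpN1 p (Hop f) ≤ ENNReal.ofReal C * lpN1 p f := by
  have hp0 : 0 < p := by linarith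
  obtain ⟨B, hB, h⟩ := sum_norm_Hop_rpow_le hp
  refine ⟨B ^ (1 / p), by positivity, fun f hf => ?_⟩
  have e : ∀ z : ℂ, (‖z‖₊ : ℝ≥0∞) ^ p = ENNReal.ofReal (‖z‖ ^ p) := fun z => by
    rw [← ENNReal.ofReal_rpow_of_nonneg (norm_nonneg _) hp0.le, ofReal_norm, enorm_eq_nnnorm]
  rw [lpN1, lpN1, ← ENNReal.ofReal_rpow_of_nonneg hB.le (by positivity),
    ← ENNReal.mul_rpow_of_nonneg _ _ (by positivity)]
  refine ENNReal.rpow_le_rpow ?_ (by positivity)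
  simp_rw [e]
  rw [← ENNReal.ofReal_tsum_of_nonneg (fun n => by positivity) (summable_norm_rpow hf hp.le),
    ← ENNReal.ofReal_mul hB.le, ENNReal.tsum_eq_iSup_sum]
  refine iSup_le fun N => ?_
  rw [← ENNReal.ofReal_sum_of_nonneg fun n _ => by positivity]
  exact ENNReal.ofReal_le_ofReal (h f hf N)
end

section
/- Let d ≥ 1 be an integer, set b := 7 + (log₂ d)/2, and let k ∈ ℤ with k ≤ 2 + (log₂ d)/2. If ξ, η ∈ ℝ^d satisfy 2^{k−1} ≤ Sin(ξ−η) ≤ 2^{k+1} and Sin(η) ≤ 2^{k−b}, then 2^{k−3−b} ≤ Sin(ξ) ≤ 2^{k+3+b}. -/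
open Real

theorem SinD_eq_norm (d : ℕ) (ξ : Fin d → ℝ) :
    SinD d ξ = 2 * ‖WithLp.toLp 2 (fun j => |Real.sin (Real.pi * ξ j)|)‖ := by
  rw [SinD, EuclideanSpace.norm_eq, Real.sqrt_mul (by norm_num),
    show (4 : ℝ) = 2 ^ 2 by norm_num, Real.sqrt_sq (by norm_num)]
  simp

theorem abs_sin_add_le (x y : ℝ) : |Real.sin (x + y)| ≤ |Real.sin x| + |Real.sin y| := by
  rw [Real.sin_add]
  refine (abs_add_le _ _).trans ?_
  rw [abs_mul, abs_mul]
  exact add_le_add (mul_le_of_le_one_right (abs_nonneg _) (Real.abs_cos_le_one _))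
    (mul_le_of_le_one_left (abs_nonneg _) (Real.abs_cos_le_one _))

theorem SinD_add_le (d : ℕ) (ξ η : Fin d → ℝ) : SinD d (ξ + η) ≤ SinD d ξ + SinD d η := by
  simp only [SinD_eq_norm, ← mul_add]
  refine mul_le_mul_of_nonneg_left ?_ zero_le_two
  refine le_trans ?_ (norm_add_le _ _)
  simp only [EuclideanSpace.norm_eq]
  refine Real.sqrt_le_sqrt (Finset.sum_le_sum fun j _ => ?_)
  refine pow_le_pow_left₀ (norm_nonneg _) ?_ 2
  simp only [PiLp.add_apply, Pi.add_apply, Real.norm_eq_abs, abs_abs, mul_add]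
  exact (abs_sin_add_le _ _).trans (le_abs_self _)

theorem SinD_neg (d : ℕ) (ξ : Fin d → ℝ) : SinD d (-ξ) = SinD d ξ := by
  simp [SinD]

/-- **The spectral support-separation property (PF) for the discrete Laplacian on `ℤ^d`**,
with `b = 7 + (log₂ d)/2`: if `k ≤ 2 + (log₂ d)/2` and `ξ, η ∈ ℝ^d` satisfy
`2^{k-1} ≤ Sin(ξ-η) ≤ 2^{k+1}` and `Sin(η) ≤ 2^{k-b}`, then
`2^{k-3-b} ≤ Sin(ξ) ≤ 2^{k+3+b}`. -/
theorem stmt4 (d : ℕ) (hd : 1 ≤ d) (k : ℤ)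
    (hk : (k : ℝ) ≤ 2 + Real.logb 2 d / 2)
    (ξ η : Fin d → ℝ)
    (h1 : (2 : ℝ) ^ ((k : ℝ) - 1) ≤ SinD d (ξ - η))
    (h2 : SinD d (ξ - η) ≤ (2 : ℝ) ^ ((k : ℝ) + 1))
    (h3 : SinD d η ≤ (2 : ℝ) ^ ((k : ℝ) - (7 + Real.logb 2 d / 2))) :
    (2 : ℝ) ^ ((k : ℝ) - 3 - (7 + Real.logb 2 d / 2)) ≤ SinD d ξ ∧
      SinD d ξ ≤ (2 : ℝ) ^ ((k : ℝ) + 3 + (7 + Real.logb 2 d / 2)) := by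
  have hL : 0 ≤ Real.logb 2 d := Real.logb_nonneg one_lt_two (by exact_mod_cast hd)
  have upper : SinD d ξ ≤ SinD d (ξ - η) + SinD d η := by
    simpa using SinD_add_le d (ξ - η) η
  have lower : SinD d (ξ - η) ≤ SinD d ξ + SinD d η := by
    simpa [sub_eq_add_neg, SinD_neg] using SinD_add_le d ξ (-η)
  have mono {s t : ℝ} (hst : s ≤ t) : (2 : ℝ) ^ s ≤ 2 ^ t :=
    Real.rpow_le_rpow_of_exponent_le one_le_two hst
  have double (t : ℝ) : (2 : ℝ) ^ (t + 1) = 2 * 2 ^ t := by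
    rw [Real.rpow_add_one two_ne_zero, mul_comm]
  constructor
  · have e := double ((k : ℝ) - 2)
    rw [show (k : ℝ) - 2 + 1 = k - 1 by ring] at e
    have hη := h3.trans (mono (t := (k : ℝ) - 2) (by linarith))
    have hξ := mono (s := (k : ℝ) - 3 - (7 + Real.logb 2 d / 2)) (t := (k : ℝ) - 2) (by linarith)
    linarith
  · have e := double ((k : ℝ) + 1)
    have hη := h3.trans (mono (t := (k : ℝ) + 1) (by linarith))
    have hξ := mono (s := (k : ℝ) + 1 + 1) (t := (k : ℝ) + 3 + (7 + Real.logb 2 d / 2))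
      (by linarith)
    linarith
end

section
/- Let d ≥ 1 be an integer and let ξ, η ∈ ℝ^d be such that |cos(π η_j)| ≥ 1/2 for every j = 1, …, d. Then √d · Sin(ξ) ≥ (1/2) · Sin(ξ−η) − √d · Sin(η). -/
open Real

theorem sin_sub_sq_le (a b : ℝ) :
    Real.sin (a - b) ^ 2 ≤ 2 * Real.sin a ^ 2 + 2 * Real.sin b ^ 2 := by
  rw [Real.sin_sub]
  nlinarith [sq_nonneg (Real.sin a * Real.cos b + Real.cos a * Real.sin b),
    mul_le_mul_of_nonneg_left (Real.cos_sq_le_one b) (sq_nonneg (Real.sin a)),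
    mul_le_mul_of_nonneg_left (Real.cos_sq_le_one a) (sq_nonneg (Real.sin b))]

theorem SinD_nonneg (d : ℕ) (ξ : Fin d → ℝ) : 0 ≤ SinD d ξ :=
  Real.sqrt_nonneg _

theorem SinD_sq (d : ℕ) (ξ : Fin d → ℝ) :
    SinD d ξ ^ 2 = 4 * ∑ j, Real.sin (Real.pi * ξ j) ^ 2 :=
  Real.sq_sqrt (by positivity)

theorem SinD_sub_sq_le (d : ℕ) (ξ η : Fin d → ℝ) :
    SinD d (ξ - η) ^ 2 ≤ 2 * SinD d ξ ^ 2 + 2 * SinD d η ^ 2 := by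
  have h : ∑ j, Real.sin (Real.pi * (ξ - η) j) ^ 2 ≤
      ∑ j, (2 * Real.sin (Real.pi * ξ j) ^ 2 + 2 * Real.sin (Real.pi * η j) ^ 2) :=
    Finset.sum_le_sum fun j _ => by
      rw [Pi.sub_apply, mul_sub]
      exact sin_sub_sq_le _ _
  rw [Finset.sum_add_distrib, ← Finset.mul_sum, ← Finset.mul_sum] at h
  simp only [SinD_sq]
  linarith

/-- **Reverse triangle type inequality for `Sin` on `ℝ^d`:** if `|cos(π η_j)| ≥ 1/2` for
every `j`, then `√d · Sin(ξ) ≥ (1/2) Sin(ξ-η) − √d · Sin(η)`. -/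
theorem stmt6 (d : ℕ) (hd : 1 ≤ d) (ξ η : Fin d → ℝ)
    (hcos : ∀ j, (1 : ℝ) / 2 ≤ |Real.cos (Real.pi * η j)|) :
    (1 : ℝ) / 2 * SinD d (ξ - η) - Real.sqrt d * SinD d η ≤ Real.sqrt d * SinD d ξ := by
  have hd1 : (1 : ℝ) ≤ Real.sqrt d := Real.one_le_sqrt.mpr (by exact_mod_cast hd)
  have hξ := SinD_nonneg d ξ
  have hη := SinD_nonneg d η
  have half_le : 1 / 2 * SinD d (ξ - η) ≤ SinD d ξ + SinD d η :=
    le_of_sq_le_sq (by nlinarith [SinD_sub_sq_le d ξ η, mul_nonneg hξ hη]) (by positivity)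
  nlinarith [mul_le_mul_of_nonneg_right hd1 (add_nonneg hξ hη)]
end
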